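/- Let α > 0 and 4/3 < p < 4. The set Γ is a complete interpolating sequence for F^p_φ if and only if the following three conditions hold: (a) Γ is d_ρ-separated; (b) the sequence (δ_n)_{n≥0} is bounded; (c) there exists an integer N ≥ 1 such that 1/(4α) − 1/(qα) < ∇_N ≤ Δ_N < 1/(pα) − 1/(4α). -/

import Mathlib

open MeasureTheory Complex
open scoped ENNReal

noncomputable section

/-- `log⁺ t = max (log t) 0`. -/
def logPlus (t : ℝ) : ℝ := max (Real.log t) 0

/-- The weight `φ(z) = α (log⁺ |z|)²`. -/
def phi (α : ℝ) (z : ℂ) : ℝ := α * (logPlus ‖z‖) ^ 2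

/-- `‖f‖_{p,φ}^p = ∫_ℂ |f(z) e^{-φ(z)}|^p dm(z)` as an extended nonnegative real. -/
def fockNormP (α p : ℝ) (f : ℂ → ℂ) : ℝ≥0∞ :=
  ∫⁻ z : ℂ, ENNReal.ofReal ((‖f z‖ * Real.exp (-(phi α z))) ^ p)

/-- Membership in the Fock space `F^p_φ`: entire and finite norm. -/
def MemFock (α p : ℝ) (f : ℂ → ℂ) : Prop :=
  Differentiable ℂ f ∧ fockNormP α p f < ⊤

/-- The discrete norm `‖f‖_{p,φ,Λ}^p = Σ_{λ∈Λ} (1+|λ|)² |f(λ)|^p e^{-pφ(λ)}`. -/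
def discNormP (α p : ℝ) (Λ : Set ℂ) (f : ℂ → ℂ) : ℝ≥0∞ :=
  ∑' lam : Λ, ENNReal.ofReal
    ((1 + ‖(lam : ℂ)‖) ^ 2 * ‖f (lam : ℂ)‖ ^ p *
      Real.exp (-(p * phi α (lam : ℂ))))

/-- `Λ` is sampling for `F^p_φ`. -/
def Sampling (α p : ℝ) (Λ : Set ℂ) : Prop :=
  ∃ C : ℝ, 1 ≤ C ∧ ∀ f : ℂ → ℂ, MemFock α p f →
    (ENNReal.ofReal C)⁻¹ * fockNormP α p f ≤ discNormP α p Λ f ∧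
    discNormP α p Λ f ≤ ENNReal.ofReal C * fockNormP α p f

/-- `Λ` is interpolating for `F^p_φ`. -/
def Interpolating (α p : ℝ) (Λ : Set ℂ) : Prop :=
  ∀ v : ℂ → ℂ,
    (∑' lam : Λ, ENNReal.ofReal
      ((1 + ‖(lam : ℂ)‖) ^ 2 * ‖v (lam : ℂ)‖ ^ p *
        Real.exp (-(p * phi α (lam : ℂ))))) < ⊤ →
    ∃ f : ℂ → ℂ, MemFock α p f ∧ ∀ lam ∈ Λ, f lam = v lam

/-- `Λ` is a complete interpolating sequence for `F^p_φ`. -/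
def CompleteInterpolating (α p : ℝ) (Λ : Set ℂ) : Prop :=
  Sampling α p Λ ∧ Interpolating α p Λ

/-- `ρ(z) = |z| / √(2α)`. -/
def rhoF (α : ℝ) (z : ℂ) : ℝ := ‖z‖ / Real.sqrt (2 * α)

/-- `d_ρ(z,w) = |z-w| / (1 + min(ρ(z), ρ(w)))`. -/
def dRho (α : ℝ) (z w : ℂ) : ℝ :=
  ‖z - w‖ / (1 + min (rhoF α z) (rhoF α w))

/-- `Λ` is `d_ρ`-separated. -/
def DRhoSeparated (α : ℝ) (Λ : Set ℂ) : Prop :=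
  ∃ ε : ℝ, 0 < ε ∧ ∀ l ∈ Λ, ∀ l' ∈ Λ, l ≠ l' → ε ≤ dRho α l l'

/-- The average `(1/N) Σ_{k=n}^{n+N-1} δ_k`. -/
def avgD (δ : ℕ → ℝ) (N n : ℕ) : ℝ := (1 / (N : ℝ)) * ∑ k ∈ Finset.range N, δ (n + k)

/-- weighted Jensen/Hölder for sums -/
lemma jensen_tsum {p : ℝ} (hp : 1 ≤ p) (w x : ℕ → ℝ≥0∞) :
    (∑' k, w k * x k) ^ p ≤ (∑' k, w k) ^ (p - 1) * ∑' k, w k * x k ^ p := by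
  have hp0 : 0 < p := by linarith
  have h1 : ∑' k, w k * x k ≤ (∑' k, w k) ^ (1 - p⁻¹) * (∑' k, w k * x k ^ p) ^ p⁻¹ := by
    rw [ENNReal.tsum_eq_iSup_sum]
    refine iSup_le fun s => ?_
    refine (ENNReal.inner_le_weight_mul_Lp_of_nonneg s hp w x).trans ?_
    have : 0 ≤ 1 - p⁻¹ := by
      rw [sub_nonneg]; exact inv_le_one_of_one_le₀ hp
    gcongr
    · exact ENNReal.sum_le_tsum s
    · exact ENNReal.sum_le_tsum s
  calc (∑' k, w k * x k) ^ p
      ≤ ((∑' k, w k) ^ (1 - p⁻¹) * (∑' k, w k * x k ^ p) ^ p⁻¹) ^ p := by gcongr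
    _ = _ := by
      rw [ENNReal.mul_rpow_of_nonneg _ _ hp0.le, ← ENNReal.rpow_mul, ← ENNReal.rpow_mul,
        inv_mul_cancel₀ hp0.ne', ENNReal.rpow_one]
      congr 2
      field_simp

lemma schur {p : ℝ} (hp : 1 ≤ p) (K : ℕ → ℕ → ℝ≥0∞) (x : ℕ → ℝ≥0∞) (A B : ℝ≥0∞)
    (hr : ∀ n, ∑' k, K n k ≤ A) (hc : ∀ k, ∑' n, K n k ≤ B) :
    ∑' n, (∑' k, K n k * x k) ^ p ≤ A ^ (p - 1) * B * ∑' k, x k ^ p := by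
  calc ∑' n, (∑' k, K n k * x k) ^ p
      ≤ ∑' n, A ^ (p - 1) * ∑' k, K n k * x k ^ p := by
        refine ENNReal.tsum_le_tsum fun n => (jensen_tsum hp _ _).trans ?_
        have : 0 ≤ p - 1 := by linarith
        gcongr
        exact hr n
    _ = A ^ (p - 1) * ∑' k, (∑' n, K n k) * x k ^ p := by
        rw [ENNReal.tsum_mul_left, ENNReal.tsum_comm]
        simp_rw [ENNReal.tsum_mul_right]
    _ ≤ A ^ (p - 1) * ∑' k, B * x k ^ p := by
        gcongr with k
        exact hc k
    _ = _ := by rw [ENNReal.tsum_mul_left, mul_assoc]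

/-- finite sums of exponentials are uniformly bounded -/
lemma sumExp {c : ℝ} (hc : 0 < c) : ∃ C : ℝ, 0 < C ∧ ∀ (A : Finset ℕ) (u : ℝ),
    ∑ m ∈ A, Real.exp (-c * |u - m|) ≤ C := by
  have hs : Summable (fun j : ℤ => Real.exp (-c * |(j : ℝ)|)) := by
    have h0 : Summable (fun n : ℕ => Real.exp (-c * (n : ℝ))) := by
      have := Real.summable_exp_nat_mul_iff.mpr (show -c < 0 by linarith)
      refine this.congr fun n => by ring_nf
    apply Summable.of_nat_of_neg
    · simpa using h0
    · simpa using h0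
  refine ⟨Real.exp c * ∑' j : ℤ, Real.exp (-c * |(j : ℝ)|) + 1, ?_, fun A u => ?_⟩
  · have : 0 ≤ ∑' j : ℤ, Real.exp (-c * |(j : ℝ)|) := tsum_nonneg fun _ => (Real.exp_pos _).le
    positivity
  · have h1 : ∀ m ∈ A, Real.exp (-c * |u - m|) ≤
        Real.exp c * Real.exp (-c * |(((m : ℤ) - ⌊u⌋ : ℤ) : ℝ)|) := by
      intro m _
      rw [← Real.exp_add]
      apply Real.exp_le_exp.mpr
      push_cast
      have ha : |(m : ℝ) - ⌊u⌋| ≤ |u - m| + 1 := by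
        have h2 := Int.floor_le u
        have h3 := Int.lt_floor_add_one u
        rw [abs_le]
        constructor
        · linarith [le_abs_self (u - m)]
        · linarith [neg_abs_le (u - m)]
      nlinarith
    calc ∑ m ∈ A, Real.exp (-c * |u - m|)
        ≤ ∑ m ∈ A, Real.exp c * Real.exp (-c * |(((m : ℤ) - ⌊u⌋ : ℤ) : ℝ)|) :=
          Finset.sum_le_sum h1
      _ = Real.exp c * ∑ j ∈ A.image (fun m : ℕ => (m : ℤ) - ⌊u⌋), Real.exp (-c * |(j : ℝ)|) := by
          rw [← Finset.mul_sum, Finset.sum_image]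
          intro a _ b _ h
          simpa using h
      _ ≤ Real.exp c * ∑' j : ℤ, Real.exp (-c * |(j : ℝ)|) := by
          gcongr
          exact hs.sum_le_tsum _ fun _ _ => (Real.exp_pos _).le
      _ ≤ _ := by linarith

lemma ofReal_tsum_le {f : ℕ → ℝ} (hf : ∀ n, 0 ≤ f n) {C : ℝ}
    (h : ∀ A : Finset ℕ, ∑ m ∈ A, f m ≤ C) : ∑' n, ENNReal.ofReal (f n) ≤ ENNReal.ofReal C := by
  rw [ENNReal.tsum_eq_iSup_sum]
  refine iSup_le fun s => ?_
  rw [← ENNReal.ofReal_sum_of_nonneg fun i _ => hf i]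
  exact ENNReal.ofReal_le_ofReal (h s)

lemma tsumExp {c : ℝ} (hc : 0 < c) : ∃ C : ℝ, 0 < C ∧ ∀ (u : ℝ),
    ∑' m : ℕ, ENNReal.ofReal (Real.exp (-c * |u - m|)) ≤ ENNReal.ofReal C := by
  obtain ⟨C, hC, h⟩ := sumExp hc
  exact ⟨C, hC, fun u => ofReal_tsum_le (fun _ => (Real.exp_pos _).le) fun A => h A u⟩

/-- Schur test for a kernel dominated by `A exp(-c|u n - k|)`. -/
lemma schurU {p : ℝ} (hp : 1 ≤ p) {c : ℝ} (hc : 0 < c) (u : ℕ → ℝ) (D : ℝ)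
    (hD : ∀ k : ℕ, ∑' n, ENNReal.ofReal (Real.exp (-c * |u n - k|)) ≤ ENNReal.ofReal D) :
    ∃ C : ℝ, 0 < C ∧ ∀ A : ℝ, 0 ≤ A → ∀ x : ℕ → ℝ≥0∞,
      ∑' n, (∑' k : ℕ, ENNReal.ofReal (A * Real.exp (-c * |u n - k|)) * x k) ^ p ≤
        ENNReal.ofReal (C * A ^ p) * ∑' k, x k ^ p := by
  have hp0 : 0 < p := by linarith
  obtain ⟨C1, hC1, h1⟩ := tsumExp hc
  refine ⟨C1 ^ (p - 1) * (max D 1), by positivity, fun A hA x => ?_⟩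
  have h2 := schur hp (fun n k => ENNReal.ofReal (Real.exp (-c * |u n - k|))) x
    (ENNReal.ofReal C1) (ENNReal.ofReal (max D 1)) (fun n => h1 (u n))
    (fun k => (hD k).trans (ENNReal.ofReal_le_ofReal (le_max_left _ _)))
  calc ∑' n, (∑' k : ℕ, ENNReal.ofReal (A * Real.exp (-c * |u n - k|)) * x k) ^ p
      = ENNReal.ofReal A ^ p *
        ∑' n, (∑' k : ℕ, ENNReal.ofReal (Real.exp (-c * |u n - k|)) * x k) ^ p := by
        rw [← ENNReal.tsum_mul_left]
        congr 1; ext n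
        rw [← ENNReal.mul_rpow_of_nonneg _ _ hp0.le, ← ENNReal.tsum_mul_left]
        congr 2; ext k
        rw [ENNReal.ofReal_mul hA, mul_assoc]
    _ ≤ ENNReal.ofReal A ^ p * (ENNReal.ofReal C1 ^ (p - 1) * ENNReal.ofReal (max D 1) *
        ∑' k, x k ^ p) := by gcongr
    _ = _ := by
        rw [ENNReal.ofReal_mul (by positivity), ENNReal.ofReal_mul (by positivity),
          ENNReal.ofReal_rpow_of_nonneg hA hp0.le,
          ENNReal.ofReal_rpow_of_nonneg hC1.le (by linarith)]
        ring

/-- column bound for `u n` close to `n` -/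
lemma colBound {c : ℝ} (hc : 0 < c) (B : ℝ) : ∃ D : ℝ, 0 < D ∧ ∀ u : ℕ → ℝ,
    (∀ n : ℕ, |u n - n| ≤ B) →
    ∀ k : ℕ, ∑' n, ENNReal.ofReal (Real.exp (-c * |u n - k|)) ≤ ENNReal.ofReal D := by
  obtain ⟨C1, hC1, h1⟩ := sumExp hc
  refine ⟨Real.exp (c * B) * C1, by positivity, fun u hu k => ?_⟩
  refine ofReal_tsum_le (fun _ => (Real.exp_pos _).le) fun A => ?_
  calc ∑ m ∈ A, Real.exp (-c * |u m - k|)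
      ≤ ∑ m ∈ A, Real.exp (c * B) * Real.exp (-c * |(k : ℝ) - m|) := by
        refine Finset.sum_le_sum fun m _ => ?_
        rw [← Real.exp_add]
        apply Real.exp_le_exp.mpr
        have := abs_sub_le (k : ℝ) (u m) m
        rw [abs_sub_comm (k : ℝ) (u m)] at this
        nlinarith [hu m]
    _ ≤ _ := by rw [← Finset.mul_sum]; gcongr; exact h1 A k

/-- `f` is represented by the power series with coefficients `a`. -/
def PSRep (a : ℕ → ℂ) (f : ℂ → ℂ) : Prop := ∀ z, HasSum (fun k => a k * z ^ k) (f z)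

lemma exists_rep {f : ℂ → ℂ} (hf : Differentiable ℂ f) : ∃ a, PSRep a f := by
  refine ⟨fun n => (n.factorial : ℂ)⁻¹ * iteratedDeriv n f 0, fun z => ?_⟩
  have := Complex.hasSum_taylorSeries_of_entire hf 0 z
  have e : (fun k => (k.factorial : ℂ)⁻¹ * iteratedDeriv k f 0 * z ^ k) =
      (fun n : ℕ => (n.factorial : ℂ)⁻¹ • (z - 0) ^ n • iteratedDeriv n f 0) := by
    ext n
    simp only [smul_eq_mul, sub_zero]
    ring
  rw [e]
  exact this

lemma PSRep.hasFPS {a : ℕ → ℂ} {f : ℂ → ℂ} (h : PSRep a f) :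
    HasFPowerSeriesOnBall f (FormalMultilinearSeries.ofScalars ℂ a) 0 ⊤ := by
  refine ⟨?_, by simp, fun {y} _ => ?_⟩
  · rw [top_le_iff]
    refine ENNReal.eq_top_of_forall_nnreal_le fun r => ?_
    apply FormalMultilinearSeries.le_radius_of_summable
    have := (h (r : ℂ)).summable.norm
    refine this.congr fun n => ?_
    simp [FormalMultilinearSeries.ofScalars_norm]
  · simp only [FormalMultilinearSeries.ofScalars_apply_eq, smul_eq_mul, zero_add]
    exact h y

lemma PSRep.differentiable {a : ℕ → ℂ} {f : ℂ → ℂ} (h : PSRep a f) : Differentiable ℂ f := by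
  have := h.hasFPS.differentiableOn
  simpa [differentiableOn_univ] using this

lemma PSRep.scale {a : ℕ → ℂ} {f : ℂ → ℂ} (h : PSRep a f) (z : ℂ) :
    PSRep (fun k => a k * z ^ k) (fun w => f (z * w)) := by
  intro w
  convert (h (z * w)) using 2 with n
  simp only [mul_pow]; ring

lemma PSRep.coef_le {a : ℕ → ℂ} {f : ℂ → ℂ} (h : PSRep a f) (z : ℂ) (k : ℕ) :
    ‖a k‖ * ‖z‖ ^ k ≤
      (2 * Real.pi)⁻¹ * ∫ θ : ℝ in 0..2 * Real.pi, ‖f (z * circleMap 0 1 θ)‖ := by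
  have h1 := (h.scale z).hasFPS
  have h2 : HasFPowerSeriesOnBall (fun w => f (z * w))
      (cauchyPowerSeries (fun w => f (z * w)) 0 ((1 : NNReal) : ℝ)) 0 (1 : NNReal) :=
    (h.scale z).differentiable.differentiableOn.hasFPowerSeriesOnBall (R := 1) one_pos
  have h3 := h1.hasFPowerSeriesAt.eq_formalMultilinearSeries h2.hasFPowerSeriesAt
  have h4 := norm_cauchyPowerSeries_le (fun w => f (z * w)) 0 ((1 : NNReal) : ℝ) k
  rw [← h3, FormalMultilinearSeries.ofScalars_norm] at h4
  simpa using h4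

lemma PSRep.coef_le_sup {a : ℕ → ℂ} {f : ℂ → ℂ} (h : PSRep a f) {R M : ℝ} (hR : 0 ≤ R)
    (hM : ∀ z, ‖z‖ = R → ‖f z‖ ≤ M) (k : ℕ) : ‖a k‖ * R ^ k ≤ M := by
  have h1 := h.coef_le (R : ℂ) k
  have hn : ‖(R : ℂ)‖ = R := by simp [abs_of_nonneg hR]
  rw [hn] at h1
  refine h1.trans ?_
  have h2 : ∫ θ : ℝ in 0..2 * Real.pi, ‖f (R * circleMap 0 1 θ)‖ ≤
      ∫ θ : ℝ in 0..2 * Real.pi, M := by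
    apply intervalIntegral.integral_mono_on Real.two_pi_pos.le
    · apply Continuous.intervalIntegrable
      exact (h.differentiable.continuous.comp
        (continuous_const.mul (continuous_circleMap 0 1))).norm
    · simp
    · intro θ _
      apply hM
      simp [abs_of_nonneg hR]
  rw [intervalIntegral.integral_const, sub_zero, smul_eq_mul] at h2
  have hpi := Real.two_pi_pos
  calc _ ≤ (2 * Real.pi)⁻¹ * (2 * Real.pi * M) := by gcongr
    _ = M := by field_simp

lemma PSRep.sub {a b : ℕ → ℂ} {f g : ℂ → ℂ} (h : PSRep a f) (h' : PSRep b g) :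
    PSRep (fun k => a k - b k) (fun z => f z - g z) := by
  intro z
  have e : (fun k => (a k - b k) * z ^ k) = (fun k => a k * z ^ k - b k * z ^ k) := by
    ext n
    ring
  rw [e]
  exact (h z).sub (h' z)

lemma PSRep.sum {ι : Type*} (s : Finset ι) {a : ι → ℕ → ℂ} {f : ι → ℂ → ℂ}
    (h : ∀ i ∈ s, PSRep (a i) (f i)) (c : ι → ℂ) :
    PSRep (fun k => ∑ i ∈ s, c i * a i k) (fun z => ∑ i ∈ s, c i * f i z) := by
  intro z
  have := hasSum_sum (s := s) (f := fun i k => c i * (a i k * z ^ k)) (a := fun i => c i * f i z)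
    (fun i hi => (h i hi z).mul_left (c i))
  convert this using 2 with n
  rw [Finset.sum_mul]
  exact Finset.sum_congr rfl fun i _ => by ring

lemma rep_poly (P : Polynomial ℂ) : PSRep P.coeff (fun z => P.eval z) := by
  intro z
  beta_reduce
  rw [Polynomial.eval_eq_sum_range]
  apply hasSum_sum_of_ne_finset_zero
  intro b hb
  rw [Polynomial.coeff_eq_zero_of_natDegree_lt, zero_mul]
  simpa using hb

def Wt (α p : ℝ) (k : ℕ) : ℝ := Real.exp ((k : ℝ) ^ 2 / (4 * α) + k / (p * α))
def gk (α p : ℝ) (s : ℝ) : ℝ := Real.exp (-(s ^ 2) / (4 * α) + s / (p * α))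
def lpz (z : ℂ) : ℝ := logPlus ‖z‖
def Qz (α p : ℝ) (z : ℂ) : ℝ := Real.exp (2 * lpz z / p - phi α z)
/-- the `p`-th power of the weighted `ℓ^p` norm of the coefficients -/
def SN (α p : ℝ) (a : ℕ → ℂ) : ℝ≥0∞ := ∑' k, ENNReal.ofReal ((‖a k‖ * Wt α p k) ^ p)

lemma Wt_pos (α p : ℝ) (k : ℕ) : 0 < Wt α p k := Real.exp_pos _
lemma gk_pos (α p : ℝ) (s : ℝ) : 0 < gk α p s := Real.exp_pos _
lemma Qz_pos (α p : ℝ) (z : ℂ) : 0 < Qz α p z := Real.exp_pos _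
lemma lpz_nonneg (z : ℂ) : 0 ≤ lpz z := le_max_right _ _

lemma gk_decay {α p : ℝ} (hα : 0 < α) (hp : 1 ≤ p) {b : ℝ} (hb : 0 ≤ b) :
    ∃ C : ℝ, 0 < C ∧ ∀ s, gk α p s ≤ C * Real.exp (-b * |s|) := by
  refine ⟨Real.exp (α * (1 / (p * α) + b) ^ 2), Real.exp_pos _, fun s => ?_⟩
  rw [← Real.exp_add]
  apply Real.exp_le_exp.mpr
  have hd : 0 ≤ 1 / (p * α) := by positivity
  set d := 1 / (p * α) with hdd
  have h1 : s / (p * α) = d * s := by rw [hdd]; ring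
  rw [h1]
  have h2 : d * s ≤ d * |s| := by gcongr; exact le_abs_self s
  have h3 : -(s ^ 2) / (4 * α) = -(|s| ^ 2) / (4 * α) := by rw [sq_abs]
  rw [h3]
  have h4 : -(|s| ^ 2) / (4 * α) + (d + b) * |s| - α * (d + b) ^ 2 =
      -((|s| - 2 * α * (d + b)) ^ 2) / (4 * α) := by field_simp; ring
  have h5 : -((|s| - 2 * α * (d + b)) ^ 2) / (4 * α) ≤ 0 := by
    apply div_nonpos_of_nonpos_of_nonneg
    · nlinarith [sq_nonneg (|s| - 2 * α * (d + b))]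
    · positivity
  linarith

lemma wk_id {α p : ℝ} (hα : 0 < α) (hp : 1 ≤ p) (k : ℕ) (t : ℝ) :
    Real.exp (k * t) * Real.exp (2 * t / p - α * t ^ 2) = Wt α p k * gk α p (2 * α * t - k) := by
  unfold Wt gk
  rw [← Real.exp_add, ← Real.exp_add]
  congr 1
  have hp0 : p ≠ 0 := by linarith
  field_simp
  ring

lemma norm_le_exp_lpz (z : ℂ) : ‖z‖ ≤ Real.exp (lpz z) := by
  unfold lpz logPlus
  rcases eq_or_lt_of_le (norm_nonneg z) with h | h
  · rw [← h]; positivity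
  · calc ‖z‖ = Real.exp (Real.log ‖z‖) := (Real.exp_log h).symm
      _ ≤ _ := Real.exp_le_exp.mpr (le_max_left _ _)

lemma exp_lpz_of_one_le {z : ℂ} (h : 1 ≤ ‖z‖) : Real.exp (lpz z) = ‖z‖ := by
  unfold lpz logPlus
  rw [max_eq_left (Real.log_nonneg h), Real.exp_log (by linarith)]

lemma kb_le {α p : ℝ} (hα : 0 < α) (hp : 1 ≤ p) (k : ℕ) (z : ℂ) :
    ‖z‖ ^ k * Qz α p z ≤ Wt α p k * gk α p (2 * α * lpz z - k) := by
  rw [← wk_id hα hp]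
  unfold Qz phi
  change _ * Real.exp (2 * lpz z / p - α * lpz z ^ 2) ≤ _
  gcongr
  rw [Real.exp_nat_mul]
  gcongr
  exact norm_le_exp_lpz z

lemma kb_eq {α p : ℝ} (hα : 0 < α) (hp : 1 ≤ p) (k : ℕ) (z : ℂ) (h : 1 ≤ ‖z‖ ∨ k = 0) :
    ‖z‖ ^ k * Qz α p z = Wt α p k * gk α p (2 * α * lpz z - k) := by
  rw [← wk_id hα hp]
  unfold Qz phi
  change _ * Real.exp (2 * lpz z / p - α * lpz z ^ 2) = _
  congr 1
  rcases h with h | h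
  · rw [Real.exp_nat_mul, exp_lpz_of_one_le h]
  · simp [h]

lemma pointEval {α p : ℝ} (hα : 0 < α) (hp : 1 ≤ p) {a : ℕ → ℂ} {f : ℂ → ℂ} (h : PSRep a f)
    (z : ℂ) : ENNReal.ofReal (‖f z‖ * Qz α p z) ≤
      ∑' k : ℕ, ENNReal.ofReal (gk α p (2 * α * lpz z - k)) *
        ENNReal.ofReal (‖a k‖ * Wt α p k) := by
  have hs := (h z).summable.norm
  have hQ := Qz_pos α p z
  calc ENNReal.ofReal (‖f z‖ * Qz α p z)
      ≤ ENNReal.ofReal ((∑' k, ‖a k * z ^ k‖) * Qz α p z) := by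
        apply ENNReal.ofReal_le_ofReal
        gcongr
        rw [← (h z).tsum_eq]
        exact norm_tsum_le_tsum_norm hs
    _ = ∑' k, ENNReal.ofReal (‖a k * z ^ k‖ * Qz α p z) := by
        rw [← tsum_mul_right, ENNReal.ofReal_tsum_of_nonneg _ (hs.mul_right _)]
        intro n; positivity
    _ ≤ _ := by
        refine ENNReal.tsum_le_tsum fun k => ?_
        rw [← ENNReal.ofReal_mul (gk_pos _ _ _).le]
        apply ENNReal.ofReal_le_ofReal
        rw [norm_mul, norm_pow, mul_assoc]
        calc ‖a k‖ * (‖z‖ ^ k * Qz α p z)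
            ≤ ‖a k‖ * (Wt α p k * gk α p (2 * α * lpz z - k)) := by
              exact mul_le_mul_of_nonneg_left (kb_le hα hp k z) (norm_nonneg _)
          _ = _ := by ring

lemma SN_term {α p : ℝ} (hp : 1 ≤ p) (a : ℕ → ℂ) (k : ℕ) :
    ENNReal.ofReal ((‖a k‖ * Wt α p k) ^ p) = ENNReal.ofReal (‖a k‖ * Wt α p k) ^ p := by
  rw [ENNReal.ofReal_rpow_of_nonneg (mul_nonneg (norm_nonneg _) (Wt_pos _ _ _).le) (by linarith)]

lemma coef_le_of_SN {α p : ℝ} (hp : 1 ≤ p) (a : ℕ → ℂ) {S : ℝ} (hS : 0 ≤ S)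
    (h : SN α p a ≤ ENNReal.ofReal (S ^ p)) (k : ℕ) : ‖a k‖ * Wt α p k ≤ S := by
  have h1 := (ENNReal.le_tsum k).trans h
  rw [ENNReal.ofReal_le_ofReal_iff (by positivity)] at h1
  have := Wt_pos α p k
  exact (Real.rpow_le_rpow_iff (by positivity) hS (by linarith)).mp h1

lemma exists_rep_of_bdd {α p : ℝ} (hα : 0 < α) (hp : 1 ≤ p) (a : ℕ → ℂ) {S : ℝ}
    (h : ∀ k, ‖a k‖ * Wt α p k ≤ S) : PSRep a (fun z => ∑' k, a k * z ^ k) := by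
  intro z
  apply Summable.hasSum
  apply Summable.of_norm
  obtain ⟨C, hC, hg⟩ := gk_decay hα hp (b := 1) (by norm_num)
  obtain ⟨C1, hC1, h1⟩ := sumExp (c := 1) one_pos
  have hQ := Qz_pos α p z
  have hb : ∀ k : ℕ, ‖a k * z ^ k‖ ≤
      S * C / Qz α p z * Real.exp (-1 * |2 * α * lpz z - k|) := by
    intro k
    have hk := kb_le hα hp k z
    have hw := Wt_pos α p k
    rw [norm_mul, norm_pow, div_mul_eq_mul_div, le_div_iff₀ hQ]
    have hS : 0 ≤ S := le_trans (by positivity) (h 0 |>.trans' (by have := Wt_pos α p 0; positivity : (0:ℝ) ≤ ‖a 0‖ * Wt α p 0))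
    calc ‖a k‖ * ‖z‖ ^ k * Qz α p z = ‖a k‖ * (‖z‖ ^ k * Qz α p z) := by ring
      _ ≤ ‖a k‖ * (Wt α p k * gk α p (2 * α * lpz z - k)) := by gcongr
      _ = (‖a k‖ * Wt α p k) * gk α p (2 * α * lpz z - k) := by ring
      _ ≤ S * (C * Real.exp (-1 * |2 * α * lpz z - k|)) := by
        have := gk_pos α p (2 * α * lpz z - k)
        gcongr
        · exact h k
        · exact hg _
      _ = _ := by ring
  refine Summable.of_nonneg_of_le (fun _ => norm_nonneg _) hb ?_
  apply Summable.mul_left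
  exact summable_of_sum_le (fun _ => (Real.exp_pos _).le) (fun A => h1 A _)

lemma exists_rep_of_SN {α p : ℝ} (hα : 0 < α) (hp : 1 ≤ p) (a : ℕ → ℂ) (h : SN α p a < ⊤) :
    PSRep a (fun z => ∑' k, a k * z ^ k) := by
  have hp0 : 0 < p := by linarith
  apply exists_rep_of_bdd hα hp a (S := (SN α p a).toReal ^ p⁻¹)
  apply coef_le_of_SN hp
  · positivity
  · rw [← Real.rpow_mul ENNReal.toReal_nonneg, inv_mul_cancel₀ hp0.ne', Real.rpow_one,
      ENNReal.ofReal_toReal h.ne]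

lemma fock_integrand {α p : ℝ} (hp : 1 ≤ p) (f : ℂ → ℂ) (z : ℂ) :
    ENNReal.ofReal ((‖f z‖ * Real.exp (-(phi α z))) ^ p) =
      ENNReal.ofReal (Real.exp (-2 * lpz z)) * ENNReal.ofReal (‖f z‖ * Qz α p z) ^ p := by
  have hp0 : 0 < p := by linarith
  have hQ := Qz_pos α p z
  rw [ENNReal.ofReal_rpow_of_nonneg (by positivity) hp0.le, ← ENNReal.ofReal_mul (by positivity)]
  congr 1
  have h1 : Real.exp (-(phi α z)) = Real.exp (-2 * lpz z / p) * Qz α p z := by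
    unfold Qz; rw [← Real.exp_add]; congr 1; ring
  rw [h1, Real.mul_rpow (by positivity) (by positivity), Real.mul_rpow (by positivity) hQ.le,
    Real.mul_rpow (by positivity) hQ.le, ← Real.exp_mul]
  have h2 : -2 * lpz z / p * p = -2 * lpz z := by field_simp
  rw [h2]; ring

lemma fock_le_SN {α p : ℝ} (hα : 0 < α) (hp : 1 ≤ p) : ∃ C : ℝ, 0 < C ∧ ∀ a f, PSRep a f →
    fockNormP α p f ≤ ENNReal.ofReal C * SN α p a := by
  have hp0 : 0 < p := by linarith
  obtain ⟨C, hC, hg⟩ := gk_decay hα hp (b := 1) (by norm_num)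
  obtain ⟨D, hD, hcol⟩ := colBound (c := 1) one_pos 0
  obtain ⟨C2, hC2, hS⟩ := schurU hp (c := 1) one_pos (fun n => (n : ℝ)) D
    (hcol _ (by simp))
  refine ⟨Real.exp (1 / α) * Real.pi * (C2 * (C * Real.exp 1) ^ p), by positivity,
    fun a f h => ?_⟩
  set X : ℕ → ℝ≥0∞ := fun k => ENNReal.ofReal (‖a k‖ * Wt α p k) with hX
  set H : ℕ → ℝ≥0∞ := fun j => (∑' k : ℕ, ENNReal.ofReal (C * Real.exp 1 *
    Real.exp (-1 * |(j : ℝ) - k|)) * X k) ^ p with hH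
  have hpt : ∀ z, ENNReal.ofReal ((‖f z‖ * Real.exp (-(phi α z))) ^ p) ≤
      ∑' i : ℕ, (Metric.ball (0 : ℂ) (Real.exp ((i + 1) / (2 * α)))).indicator
        (fun _ => ENNReal.ofReal (Real.exp (-(i / α))) * H i) z := by
    intro z
    set j := ⌊2 * α * lpz z⌋₊ with hj
    have hnn : 0 ≤ 2 * α * lpz z := by have := lpz_nonneg z; positivity
    have hj1 : (j : ℝ) ≤ 2 * α * lpz z := Nat.floor_le hnn
    have hj2 : 2 * α * lpz z < j + 1 := Nat.lt_floor_add_one _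
    refine le_trans ?_ (ENNReal.le_tsum j)
    have hz : z ∈ Metric.ball (0 : ℂ) (Real.exp ((j + 1) / (2 * α))) := by
      rw [mem_ball_zero_iff]
      refine (norm_le_exp_lpz z).trans_lt (Real.exp_lt_exp.mpr ?_)
      rw [lt_div_iff₀ (by positivity)]; linarith
    rw [Set.indicator_of_mem hz, fock_integrand hp]
    gcongr
    · have : (j : ℝ) / α ≤ 2 * lpz z := by rw [div_le_iff₀ hα]; linarith
      linarith
    · refine ENNReal.rpow_le_rpow ?_ hp0.le
      refine (pointEval hα hp h z).trans (ENNReal.tsum_le_tsum fun k => ?_)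
      gcongr
      refine (hg _).trans ?_
      rw [mul_assoc C, ← Real.exp_add]
      gcongr
      have : |(j : ℝ) - k| ≤ |2 * α * lpz z - k| + 1 := by
        rw [abs_le]
        constructor
        · linarith [neg_abs_le (2 * α * lpz z - k)]
        · linarith [le_abs_self (2 * α * lpz z - k)]
      linarith
  calc fockNormP α p f
      ≤ ∫⁻ z, ∑' i : ℕ, (Metric.ball (0 : ℂ) (Real.exp ((i + 1) / (2 * α)))).indicator
        (fun _ => ENNReal.ofReal (Real.exp (-(i / α))) * H i) z := lintegral_mono hpt
    _ = ∑' i : ℕ, ENNReal.ofReal (Real.exp (-(i / α))) * H i *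
          volume (Metric.ball (0 : ℂ) (Real.exp ((i + 1) / (2 * α)))) := by
        rw [lintegral_tsum]
        · congr 1; ext i
          rw [lintegral_indicator measurableSet_ball, setLIntegral_const]
        · intro i
          exact (measurable_const.indicator measurableSet_ball).aemeasurable
    _ = ∑' i : ℕ, ENNReal.ofReal (Real.exp (1 / α) * Real.pi) * H i := by
        congr 1; ext i
        have e : ENNReal.ofReal (Real.exp (-(i / α))) *
            volume (Metric.ball (0 : ℂ) (Real.exp ((i + 1) / (2 * α)))) =
            ENNReal.ofReal (Real.exp (1 / α) * Real.pi) := by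
          rw [Complex.volume_ball, ← ENNReal.ofReal_pow (Real.exp_pos _).le,
            show ((NNReal.pi : NNReal) : ℝ≥0∞) = ENNReal.ofReal Real.pi by
              rw [ENNReal.ofReal, ← NNReal.coe_real_pi, Real.toNNReal_coe],
            ← ENNReal.ofReal_mul (by positivity), ← ENNReal.ofReal_mul (by positivity)]
          congr 1
          rw [← mul_assoc, ← Real.exp_nat_mul, ← Real.exp_add]
          congr 2
          push_cast; field_simp; ring
        rw [mul_right_comm, e]
    _ = ENNReal.ofReal (Real.exp (1 / α) * Real.pi) * ∑' i, H i := ENNReal.tsum_mul_left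
    _ ≤ ENNReal.ofReal (Real.exp (1 / α) * Real.pi) *
        (ENNReal.ofReal (C2 * (C * Real.exp 1) ^ p) * ∑' k, X k ^ p) := by
        gcongr
        exact hS _ (by positivity) X
    _ = _ := by
        rw [← mul_assoc, ← ENNReal.ofReal_mul (by positivity)]
        congr 1
        unfold SN
        congr 1; ext k
        rw [SN_term hp]

lemma jensen_circle {p : ℝ} (hp : 1 < p) (h : ℝ → ℝ≥0∞) (hm : Measurable h) :
    (∫⁻ θ in Set.Ioc 0 (2 * Real.pi), h θ) ^ p ≤
      ENNReal.ofReal (2 * Real.pi) ^ (p - 1) * ∫⁻ θ in Set.Ioc 0 (2 * Real.pi), h θ ^ p := by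
  have hp0 : 0 < p := by linarith
  have hq := Real.HolderConjugate.conjExponent hp
  have h1 := ENNReal.lintegral_mul_le_Lp_mul_Lq (volume.restrict (Set.Ioc 0 (2 * Real.pi))) hq
    hm.aemeasurable (g := 1) aemeasurable_const
  simp only [Pi.mul_apply, Pi.one_apply, mul_one, ENNReal.one_rpow, lintegral_const,
    MeasurableSet.univ, Measure.restrict_apply, Set.univ_inter, Real.volume_Ioc, sub_zero,
    one_mul] at h1
  calc _ ≤ ((∫⁻ θ in Set.Ioc 0 (2 * Real.pi), h θ ^ p) ^ (1 / p) *
        ENNReal.ofReal (2 * Real.pi) ^ (1 / p.conjExponent)) ^ p := by gcongr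
    _ = _ := by
      rw [ENNReal.mul_rpow_of_nonneg _ _ hp0.le, ← ENNReal.rpow_mul, ← ENNReal.rpow_mul,
        one_div_mul_cancel hp0.ne', ENNReal.rpow_one, mul_comm]
      congr 2
      unfold Real.conjExponent
      have : p - 1 ≠ 0 := by linarith
      field_simp

lemma rot_lintegral (F : ℂ → ℝ≥0∞) (θ : ℝ) :
    ∫⁻ z, F (z * circleMap 0 1 θ) = ∫⁻ z, F z := by
  have hm := (rotation (Circle.exp θ)).measurePreserving
  have := hm.lintegral_comp_emb
    (rotation (Circle.exp θ)).toHomeomorph.measurableEmbedding F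
  rw [← this]
  congr 1; ext z
  simp [circleMap, Circle.coe_exp, mul_comm]


lemma SN_le_fock {α p : ℝ} (hα : 0 < α) (hp : 1 < p) : ∃ C : ℝ, 0 < C ∧ ∀ a f, PSRep a f →
    SN α p a ≤ ENNReal.ofReal C * fockNormP α p f := by
  have hp0 : 0 < p := by linarith
  set c : ℝ := Real.exp (-(p / (4 * α)) - 1 / α) * (Real.pi * (Real.exp (1 / α) - 1)) with hc
  have hpi := Real.pi_pos
  have he1 : 0 < Real.exp (1 / α) - 1 := by
    have : 0 < 1 / α := by positivity
    have := Real.add_one_lt_exp this.ne'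
    linarith
  have hc0 : 0 < c := by positivity
  set C0 : ℝ := (2 * Real.pi)⁻¹ ^ p * (2 * Real.pi) ^ (p - 1) with hC0
  have hC00 : 0 < C0 := by positivity
  refine ⟨c⁻¹ * (C0 * (2 * Real.pi)), by positivity, fun a f h => ?_⟩
  set F : ℂ → ℝ≥0∞ := fun z => ENNReal.ofReal ((‖f z‖ * Real.exp (-(phi α z))) ^ p) with hF
  have hfc : Continuous f := h.differentiable.continuous
  have hlm : Measurable (fun z : ℂ => phi α z) := by
    unfold phi logPlus
    fun_prop
  have hFm : Measurable F := by
    simp only [hF]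
    have := hfc.measurable
    fun_prop
  set G : ℂ → ℝ≥0∞ := fun z => ∫⁻ θ in Set.Ioc 0 (2 * Real.pi), F (z * circleMap 0 1 θ) with hG
  have hcm : Measurable (fun x : ℂ × ℝ => F (x.1 * circleMap 0 1 x.2)) := by
    apply hFm.comp
    have : Continuous (fun x : ℂ × ℝ => x.1 * circleMap 0 1 x.2) := by
      have := continuous_circleMap 0 1
      fun_prop
    exact this.measurable
  have hGint : ∫⁻ z, G z = ENNReal.ofReal (2 * Real.pi) * fockNormP α p f := by
    rw [hG, lintegral_lintegral_swap hcm.aemeasurable]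
    simp_rw [rot_lintegral F]
    rw [setLIntegral_const, Real.volume_Ioc, sub_zero, mul_comm]
    rfl
  have hphi : ∀ z θ, phi α (z * circleMap 0 1 θ) = phi α z := by
    intro z θ
    unfold phi
    rw [norm_mul]
    simp [circleMap]
  have hpt : ∀ z k, ENNReal.ofReal (‖a k‖ * ‖z‖ ^ k * Real.exp (-(phi α z))) ^ p ≤
      ENNReal.ofReal C0 * G z := by
    intro z k
    have h1 := h.coef_le z k
    have hcont : Continuous fun θ : ℝ => ‖f (z * circleMap 0 1 θ)‖ := by
      have := continuous_circleMap 0 1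
      fun_prop
    rw [intervalIntegral.integral_of_le (by positivity)] at h1
    have h2 : ENNReal.ofReal (∫ θ in Set.Ioc 0 (2 * Real.pi), ‖f (z * circleMap 0 1 θ)‖) =
        ∫⁻ θ in Set.Ioc 0 (2 * Real.pi), ENNReal.ofReal ‖f (z * circleMap 0 1 θ)‖ := by
      apply ofReal_integral_eq_lintegral_ofReal
      · exact (hcont.integrableOn_Icc (a := 0) (b := 2 * Real.pi)).mono_set Set.Ioc_subset_Icc_self
      · exact Filter.Eventually.of_forall fun _ => norm_nonneg _
    calc ENNReal.ofReal (‖a k‖ * ‖z‖ ^ k * Real.exp (-(phi α z))) ^ p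
        ≤ (ENNReal.ofReal ((2 * Real.pi)⁻¹) * ∫⁻ θ in Set.Ioc 0 (2 * Real.pi),
            ENNReal.ofReal (‖f (z * circleMap 0 1 θ)‖ * Real.exp (-(phi α z)))) ^ p := by
          gcongr
          simp_rw [ENNReal.ofReal_mul (norm_nonneg (f _))]
          rw [lintegral_mul_const _ (by have := hcont.measurable; fun_prop), ← h2, ← mul_assoc,
            ← ENNReal.ofReal_mul (by positivity), ← ENNReal.ofReal_mul' (by positivity)]
          gcongr
      _ ≤ ENNReal.ofReal ((2 * Real.pi)⁻¹) ^ p * (ENNReal.ofReal (2 * Real.pi) ^ (p - 1) *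
            ∫⁻ θ in Set.Ioc 0 (2 * Real.pi),
            ENNReal.ofReal (‖f (z * circleMap 0 1 θ)‖ * Real.exp (-(phi α z))) ^ p) := by
          rw [ENNReal.mul_rpow_of_nonneg _ _ hp0.le]
          gcongr
          apply jensen_circle hp
          have := hcont.measurable; fun_prop
      _ = _ := by
          rw [← mul_assoc, ENNReal.ofReal_rpow_of_pos (by positivity),
            ENNReal.ofReal_rpow_of_pos (by positivity), ← ENNReal.ofReal_mul (by positivity)]
          congr 1
          simp only [hG, hF, hphi]
          congr 1; ext θ
          rw [ENNReal.ofReal_rpow_of_nonneg (by positivity) hp0.le]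
  set A : ℕ → Set ℂ := fun k => Metric.ball (0 : ℂ) (Real.exp (((k : ℝ) + 1) / (2 * α))) \
    Metric.ball (0 : ℂ) (Real.exp ((k : ℝ) / (2 * α))) with hA
  have hAm : ∀ k, MeasurableSet (A k) := fun k => measurableSet_ball.diff measurableSet_ball
  have hAd : Pairwise (Function.onFun Disjoint A) := by
    have key : ∀ i j, i < j → Disjoint (A i) (A j) := by
      intro i j hij
      rw [Set.disjoint_left]
      intro z hz hz'
      simp only [hA, Set.mem_sdiff, mem_ball_zero_iff, not_lt] at hz hz'
      have : Real.exp (((i : ℝ) + 1) / (2 * α)) ≤ Real.exp ((j : ℝ) / (2 * α)) := by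
        gcongr
        exact_mod_cast hij
      linarith [hz.1, hz'.2]
    intro i j hij
    rcases lt_or_gt_of_ne hij with h | h
    · exact key i j h
    · exact (key j i h).symm
  have hvol : ∀ k : ℕ, volume (A k) =
      ENNReal.ofReal (Real.exp (k / α) * (Real.pi * (Real.exp (1 / α) - 1))) := by
    intro k
    have hpi' : ((NNReal.pi : NNReal) : ℝ≥0∞) = ENNReal.ofReal Real.pi := by
      rw [ENNReal.ofReal, ← NNReal.coe_real_pi, Real.toNNReal_coe]
    rw [hA, measure_sdiff (Metric.ball_subset_ball (by gcongr; linarith))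
      measurableSet_ball.nullMeasurableSet measure_ball_lt_top.ne, Complex.volume_ball,
      Complex.volume_ball, ← ENNReal.ofReal_pow (Real.exp_pos _).le,
      ← ENNReal.ofReal_pow (Real.exp_pos _).le, hpi',
      ← ENNReal.ofReal_mul (by positivity), ← ENNReal.ofReal_mul (by positivity),
      ← ENNReal.ofReal_sub _ (by positivity)]
    congr 1
    rw [← Real.exp_nat_mul, ← Real.exp_nat_mul]
    have e1 : ((2 : ℕ) : ℝ) * (((k : ℝ) + 1) / (2 * α)) = k / α + 1 / α := by
      push_cast; field_simp
    have e2 : ((2 : ℕ) : ℝ) * ((k : ℝ) / (2 * α)) = k / α := by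
      push_cast; field_simp
    rw [e1, e2, Real.exp_add]; ring
  have hAk : ∀ k : ℕ, ∀ z ∈ A k, ENNReal.ofReal ((‖a k‖ * Wt α p k) ^ p) *
      ENNReal.ofReal (Real.exp (-(p / (4 * α)) - (k + 1) / α)) ≤ ENNReal.ofReal C0 * G z := by
    intro k z hz
    refine le_trans ?_ (hpt z k)
    simp only [hA, Set.mem_sdiff, mem_ball_zero_iff, not_lt] at hz
    have hz1 : 1 ≤ ‖z‖ := le_trans (Real.one_le_exp (by positivity)) hz.2
    have hW := Wt_pos α p k
    have hl := exp_lpz_of_one_le hz1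
    rw [← hl] at hz
    have h1 := (Real.exp_lt_exp.mp hz.1)
    have h2 := (Real.exp_le_exp.mp hz.2)
    rw [lt_div_iff₀ (by positivity)] at h1
    rw [div_le_iff₀ (by positivity)] at h2
    set t := lpz z with ht
    have e1 : ‖z‖ ^ k * Real.exp (-(phi α z)) =
        Wt α p k * gk α p (2 * α * t - k) * Real.exp (-(2 * t / p)) := by
      rw [← wk_id hα hp.le, ← hl, ← Real.exp_nat_mul, ← Real.exp_add, ← Real.exp_add,
        ← Real.exp_add]
      congr 1
      unfold phi
      rw [ht]; unfold lpz
      ring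
    rw [ENNReal.ofReal_rpow_of_nonneg (by positivity) hp0.le, ← ENNReal.ofReal_mul (by positivity)]
    apply ENNReal.ofReal_le_ofReal
    have e2 : Real.exp (-(p / (4 * α)) - (k + 1) / α) =
        Real.exp (-(1 / (4 * α)) - (k + 1) / (p * α)) ^ p := by
      rw [← Real.exp_mul]; congr 1; field_simp
    rw [e2, ← Real.mul_rpow (by positivity) (by positivity), mul_assoc, mul_assoc, e1]
    rw [mul_assoc (Wt α p k)]
    gcongr
    unfold gk
    rw [← Real.exp_add, Real.exp_le_exp]
    have hs0 : 0 ≤ 2 * α * t - k := by linarith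
    have hs1 : 2 * α * t - k ≤ 1 := by linarith
    have g1 : (2 * α * t - k) ^ 2 / (4 * α) ≤ 1 / (4 * α) := by
      gcongr
      nlinarith
    have g2 : 0 ≤ (2 * α * t - k) / (p * α) := by positivity
    have g3 : 2 * t / p ≤ (k + 1) / (p * α) := by
      rw [div_le_div_iff₀ hp0 (by positivity)]
      nlinarith
    rw [neg_div]
    linarith
  have hfin : ENNReal.ofReal c * SN α p a ≤
      ENNReal.ofReal C0 * (ENNReal.ofReal (2 * Real.pi) * fockNormP α p f) := by
    rw [← hGint]
    calc ENNReal.ofReal c * SN α p a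
        = ∑' k : ℕ, ENNReal.ofReal ((‖a k‖ * Wt α p k) ^ p) *
          ENNReal.ofReal (Real.exp (-(p / (4 * α)) - (k + 1) / α)) * volume (A k) := by
          unfold SN
          rw [← ENNReal.tsum_mul_left]
          congr 1; ext k
          rw [hvol, mul_assoc, ← ENNReal.ofReal_mul (Real.exp_pos (-(p / (4 * α)) - (k + 1) / α)).le,
            mul_comm (ENNReal.ofReal c)]
          congr 2
          rw [hc, ← mul_assoc (Real.exp _) (Real.exp _), ← Real.exp_add]
          congr 2
          field_simp; ring
      _ ≤ ∑' k : ℕ, ∫⁻ z in A k, ENNReal.ofReal C0 * G z := by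
          refine ENNReal.tsum_le_tsum fun k => ?_
          rw [← setLIntegral_const]
          exact setLIntegral_mono' (hAm k) (hAk k)
      _ = ∫⁻ z in ⋃ k, A k, ENNReal.ofReal C0 * G z := (lintegral_iUnion hAm hAd _).symm
      _ ≤ ∫⁻ z, ENNReal.ofReal C0 * G z := setLIntegral_le_lintegral _ _
      _ = ENNReal.ofReal C0 * ∫⁻ z, G z := lintegral_const_mul' _ _ ENNReal.ofReal_ne_top
  calc SN α p a = ENNReal.ofReal c⁻¹ * (ENNReal.ofReal c * SN α p a) := by
        rw [← mul_assoc, ← ENNReal.ofReal_mul (by positivity), inv_mul_cancel₀ hc0.ne',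
          ENNReal.ofReal_one, one_mul]
    _ ≤ ENNReal.ofReal c⁻¹ * (ENNReal.ofReal C0 *
        (ENNReal.ofReal (2 * Real.pi) * fockNormP α p f)) := by gcongr
    _ = _ := by
        rw [ENNReal.ofReal_mul (p := c⁻¹) (by positivity), ENNReal.ofReal_mul hC00.le]
        simp only [mul_assoc]

def DN (α p : ℝ) (γ : ℕ → ℂ) (f : ℂ → ℂ) : ℝ≥0∞ :=
  ∑' n, ENNReal.ofReal ((‖f (γ n)‖ * Qz α p (γ n)) ^ p)

def SampN (α p : ℝ) (γ : ℕ → ℂ) : Prop :=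
  ∃ C : ℝ, 0 < C ∧ ∀ a f, PSRep a f → SN α p a < ⊤ →
    SN α p a ≤ ENNReal.ofReal C * DN α p γ f ∧ DN α p γ f ≤ ENNReal.ofReal C * SN α p a

def IntN (α p : ℝ) (γ : ℕ → ℂ) : Prop :=
  ∀ v : ℕ → ℂ, (∑' n, ENNReal.ofReal ((‖v n‖ * Qz α p (γ n)) ^ p)) < ⊤ →
    ∃ a f, PSRep a f ∧ SN α p a < ⊤ ∧ ∀ n, f (γ n) = v n

lemma term_id {α p : ℝ} (hp : 1 < p) (v z : ℂ) :
    (‖v‖ * Qz α p z) ^ p = Real.exp (lpz z) ^ 2 * ‖v‖ ^ p * Real.exp (-(p * phi α z)) := by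
  have hQ := Qz_pos α p z
  have hp0 : 0 < p := by linarith
  rw [Real.mul_rpow (norm_nonneg _) hQ.le]
  unfold Qz
  rw [← Real.exp_mul, ← Real.exp_nat_mul, mul_right_comm, ← Real.exp_add, mul_comm]
  congr 2
  push_cast
  field_simp
  ring

lemma exp_lpz_le (z : ℂ) : Real.exp (lpz z) ≤ 1 + ‖z‖ := by
  unfold lpz logPlus
  rcases eq_or_lt_of_le (norm_nonneg z) with h | h
  · rw [← h]; simp
  · rcases le_total (Real.log ‖z‖) 0 with h1 | h1
    · rw [max_eq_right h1, Real.exp_zero]; linarith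
    · rw [max_eq_left h1, Real.exp_log h]; linarith

lemma le_exp_lpz (z : ℂ) : 1 + ‖z‖ ≤ 2 * Real.exp (lpz z) := by
  have h1 := norm_le_exp_lpz z
  have h2 := Real.one_le_exp (lpz_nonneg z)
  linarith

lemma disc_term_ge {α p : ℝ} (hp : 1 < p) (v z : ℂ) :
    (‖v‖ * Qz α p z) ^ p ≤ (1 + ‖z‖) ^ 2 * ‖v‖ ^ p * Real.exp (-(p * phi α z)) := by
  rw [term_id hp]
  gcongr
  exact exp_lpz_le z

lemma disc_term_le {α p : ℝ} (hp : 1 < p) (v z : ℂ) :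
    (1 + ‖z‖) ^ 2 * ‖v‖ ^ p * Real.exp (-(p * phi α z)) ≤ 4 * (‖v‖ * Qz α p z) ^ p := by
  rw [term_id hp]
  have := le_exp_lpz z
  calc _ ≤ (2 * Real.exp (lpz z)) ^ 2 * ‖v‖ ^ p * Real.exp (-(p * phi α z)) := by gcongr
    _ = _ := by ring

lemma disc_ge {α p : ℝ} (hp : 1 < p) {γ : ℕ → ℂ} (hinj : Function.Injective γ) (v : ℂ → ℂ) :
    DN α p γ v ≤ ∑' lam : Set.range γ, ENNReal.ofReal
      ((1 + ‖(lam : ℂ)‖) ^ 2 * ‖v (lam : ℂ)‖ ^ p * Real.exp (-(p * phi α (lam : ℂ)))) := by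
  rw [tsum_range (f := fun lam : ℂ => ENNReal.ofReal
      ((1 + ‖(lam : ℂ)‖) ^ 2 * ‖v (lam : ℂ)‖ ^ p * Real.exp (-(p * phi α (lam : ℂ))))) hinj]
  exact ENNReal.tsum_le_tsum fun n => ENNReal.ofReal_le_ofReal (disc_term_ge hp _ _)

lemma disc_le {α p : ℝ} (hp : 1 < p) {γ : ℕ → ℂ} (hinj : Function.Injective γ) (v : ℂ → ℂ) :
    ∑' lam : Set.range γ, ENNReal.ofReal
      ((1 + ‖(lam : ℂ)‖) ^ 2 * ‖v (lam : ℂ)‖ ^ p * Real.exp (-(p * phi α (lam : ℂ)))) ≤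
      ENNReal.ofReal 4 * DN α p γ v := by
  rw [tsum_range (f := fun lam : ℂ => ENNReal.ofReal
      ((1 + ‖(lam : ℂ)‖) ^ 2 * ‖v (lam : ℂ)‖ ^ p * Real.exp (-(p * phi α (lam : ℂ))))) hinj]
  unfold DN
  rw [← ENNReal.tsum_mul_left]
  refine ENNReal.tsum_le_tsum fun n => ?_
  rw [← ENNReal.ofReal_mul (by norm_num)]
  exact ENNReal.ofReal_le_ofReal (disc_term_le hp _ _)

lemma sampling_iff {α p : ℝ} (hα : 0 < α) (hp : 1 < p) {γ : ℕ → ℂ}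
    (hinj : Function.Injective γ) : Sampling α p (Set.range γ) ↔ SampN α p γ := by
  obtain ⟨C1, hC1, h1⟩ := fock_le_SN hα hp.le
  obtain ⟨C2, hC2, h2⟩ := SN_le_fock hα hp
  constructor
  · rintro ⟨C, hC, h⟩
    have hC0 : 0 < C := by linarith
    refine ⟨C2 * (C * 4) + C * C1, by positivity, fun a f hr hf => ?_⟩
    obtain ⟨g1, g2⟩ := h f ⟨hr.differentiable, (h1 a f hr).trans_lt
      (ENNReal.mul_lt_top ENNReal.ofReal_lt_top hf)⟩
    constructor
    · calc SN α p a ≤ ENNReal.ofReal C2 * fockNormP α p f := h2 a f hr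
        _ = ENNReal.ofReal C2 * (ENNReal.ofReal C * ((ENNReal.ofReal C)⁻¹ * fockNormP α p f)) := by
            rw [← mul_assoc (ENNReal.ofReal C), ENNReal.mul_inv_cancel (by simpa using hC0)
              ENNReal.ofReal_ne_top, one_mul]
        _ ≤ ENNReal.ofReal C2 * (ENNReal.ofReal C * (ENNReal.ofReal 4 * DN α p γ f)) := by
            refine mul_le_mul_right (mul_le_mul_right ?_ _) _
            exact g1.trans (disc_le hp hinj f)
        _ = ENNReal.ofReal (C2 * (C * 4)) * DN α p γ f := by
            rw [ENNReal.ofReal_mul hC2.le, ENNReal.ofReal_mul hC0.le]; ring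
        _ ≤ _ := by gcongr; have : 0 < C * C1 := by positivity
                    linarith
    · calc DN α p γ f ≤ _ := (disc_ge hp hinj f).trans g2
        _ ≤ ENNReal.ofReal C * (ENNReal.ofReal C1 * SN α p a) := by gcongr; exact h1 a f hr
        _ = ENNReal.ofReal (C * C1) * SN α p a := by
            rw [ENNReal.ofReal_mul hC0.le]; ring
        _ ≤ _ := by gcongr; have : 0 < C2 * (C * 4) := by positivity
                    linarith
  · rintro ⟨C, hC, h⟩
    set K := C1 * C + 4 * (C * C2) + 1 with hK
    have hK0 : 0 < K := by positivity
    refine ⟨K, by rw [hK]; have : 0 < C1 * C + 4 * (C * C2) := by positivity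
                  linarith, fun f hf => ?_⟩
    obtain ⟨a, hr⟩ := exists_rep hf.1
    have hSN : SN α p a < ⊤ := (h2 a f hr).trans_lt
      (ENNReal.mul_lt_top ENNReal.ofReal_lt_top hf.2)
    obtain ⟨g1, g2⟩ := h a f hr hSN
    constructor
    · refine le_trans ?_ (disc_ge hp hinj f)
      rw [mul_comm, ← div_eq_mul_inv]
      refine ENNReal.div_le_of_le_mul ?_
      calc fockNormP α p f ≤ _ := h1 a f hr
        _ ≤ ENNReal.ofReal C1 * (ENNReal.ofReal C * DN α p γ f) := by gcongr
        _ = ENNReal.ofReal (C1 * C) * DN α p γ f := by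
            rw [ENNReal.ofReal_mul hC1.le]; ring
        _ ≤ ENNReal.ofReal K * DN α p γ f := by
            gcongr; have : 0 < C * C2 := by positivity
            linarith
        _ = _ := mul_comm _ _
    · calc discNormP α p (Set.range γ) f ≤ ENNReal.ofReal 4 * DN α p γ f := disc_le hp hinj f
        _ ≤ ENNReal.ofReal 4 * (ENNReal.ofReal C * (ENNReal.ofReal C2 * fockNormP α p f)) := by
            gcongr
            refine g2.trans ?_
            gcongr
            exact h2 a f hr
        _ = ENNReal.ofReal (4 * (C * C2)) * fockNormP α p f := by
            rw [ENNReal.ofReal_mul (by norm_num : (0:ℝ) ≤ 4), ENNReal.ofReal_mul hC.le]; ring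
        _ ≤ _ := by
            gcongr; have : 0 < C1 * C := by positivity
            linarith

lemma interpolating_iff {α p : ℝ} (hα : 0 < α) (hp : 1 < p) {γ : ℕ → ℂ}
    (hinj : Function.Injective γ) : Interpolating α p (Set.range γ) ↔ IntN α p γ := by
  obtain ⟨C1, hC1, h1⟩ := fock_le_SN hα hp.le
  obtain ⟨C2, hC2, h2⟩ := SN_le_fock hα hp
  constructor
  · intro h v hv
    set w : ℂ → ℂ := fun z => v (Function.invFun γ z) with hw
    have hwv : ∀ n, w (γ n) = v n := fun n => by
      simp only [hw]; rw [Function.leftInverse_invFun hinj]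
    have hD : DN α p γ w < ⊤ := by
      unfold DN
      simpa only [hwv] using hv
    have hD2 := (disc_le hp hinj w).trans_lt (ENNReal.mul_lt_top ENNReal.ofReal_lt_top hD)
    obtain ⟨f, hf, hfv⟩ := h w hD2
    obtain ⟨a, hr⟩ := exists_rep hf.1
    refine ⟨a, f, hr, (h2 a f hr).trans_lt
      (ENNReal.mul_lt_top ENNReal.ofReal_lt_top hf.2), fun n => ?_⟩
    rw [hfv _ ⟨n, rfl⟩, hwv]
  · intro h v hv
    obtain ⟨a, f, hr, hs, hfv⟩ := h (fun n => v (γ n)) ((disc_ge hp hinj v).trans_lt hv)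
    refine ⟨f, ⟨hr.differentiable, (h1 a f hr).trans_lt
      (ENNReal.mul_lt_top ENNReal.ofReal_lt_top hs)⟩, ?_⟩
    rintro _ ⟨n, rfl⟩
    exact hfv n

def tt (α : ℝ) (δ : ℕ → ℝ) (n : ℕ) : ℝ := (1 + (n : ℝ)) / (2 * α) + δ n
def uu (α : ℝ) (γ : ℕ → ℂ) (n : ℕ) : ℝ := 2 * α * lpz (γ n)
def UU (α p : ℝ) : ℝ := 1 / (p * α) - 1 / (4 * α)
def EE (α p : ℝ) (δ : ℕ → ℝ) (k : ℕ) : ℝ := ∑ m ∈ Finset.range k, (UU α p - δ m)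

lemma uu_nonneg {α : ℝ} (hα : 0 < α) (γ : ℕ → ℂ) (n : ℕ) : 0 ≤ uu α γ n := by
  have := lpz_nonneg (γ n)
  unfold uu; positivity

lemma lpz_eq {α : ℝ} {γ : ℕ → ℂ} {δ : ℕ → ℝ} (hn : ∀ n, ‖γ n‖ = Real.exp (tt α δ n)) (n : ℕ) :
    lpz (γ n) = max (tt α δ n) 0 := by
  unfold lpz logPlus; rw [hn, Real.log_exp]

lemma uu_bdd {α : ℝ} (hα : 0 < α) {γ : ℕ → ℂ} {δ : ℕ → ℝ}
    (hn : ∀ n, ‖γ n‖ = Real.exp (tt α δ n)) {B : ℝ} (hB : ∀ n, |δ n| ≤ B) (n : ℕ) :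
    |uu α γ n - n| ≤ 1 + 2 * α * B := by
  unfold uu
  rw [lpz_eq hn]
  have hb := abs_le.mp (hB n)
  have hB0 : 0 ≤ B := (abs_nonneg _).trans (hB n)
  have h1 : 2 * α * tt α δ n = 1 + n + 2 * α * δ n := by unfold tt; field_simp
  have h2 : 2 * α * δ n ≤ 2 * α * B := by gcongr; exact hb.2
  have h3 : 2 * α * (-B) ≤ 2 * α * δ n := by gcongr; exact hb.1
  have h5 : 0 ≤ 2 * α * B := by positivity
  have h4 : (0 : ℝ) ≤ n := Nat.cast_nonneg n
  rw [mul_max_of_nonneg _ _ (by positivity : 0 ≤ 2 * α), mul_zero, abs_le, h1]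
  constructor
  · have := le_max_left (1 + n + 2 * α * δ n) 0
    linarith
  · have : max (1 + n + 2 * α * δ n) 0 ≤ n + 1 + 2 * α * B := max_le (by linarith) (by linarith)
    linarith

lemma DN_le_R {α p : ℝ} (hα : 0 < α) (hp : 1 ≤ p) {γ : ℕ → ℂ} {D : ℝ}
    (hcol : ∀ k : ℕ, ∑' n, ENNReal.ofReal (Real.exp (-1 * |uu α γ n - k|)) ≤ ENNReal.ofReal D) :
    ∃ C : ℝ, 0 < C ∧ ∀ R : ℝ, ∀ a f, PSRep a f →
      (∀ n k : ℕ, f (γ n) ≠ 0 → a k ≠ 0 → R ≤ |uu α γ n - k|) →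
      DN α p γ f ≤ ENNReal.ofReal (C * Real.exp (-R) ^ p) * SN α p a := by
  have hp0 : 0 < p := by linarith
  obtain ⟨C, hC, hg⟩ := gk_decay hα hp (b := 2) (by norm_num)
  obtain ⟨C2, hC2, hS⟩ := schurU hp (c := 1) one_pos (uu α γ) D hcol
  refine ⟨C2 * C ^ p, by positivity, fun R a f h hR => ?_⟩
  have := hS (C * Real.exp (-R)) (by positivity) (fun k => ENNReal.ofReal (‖a k‖ * Wt α p k))
  rw [Real.mul_rpow (by positivity) (by positivity), ← mul_assoc] at this
  unfold SN
  simp_rw [SN_term hp]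
  refine le_trans ?_ this
  unfold DN
  refine ENNReal.tsum_le_tsum fun n => ?_
  have hQ := Qz_pos α p (γ n)
  rw [← ENNReal.ofReal_rpow_of_nonneg (by positivity) hp0.le]
  refine ENNReal.rpow_le_rpow ?_ hp0.le
  by_cases hf : f (γ n) = 0
  · simp [hf]
  refine (pointEval hα hp h (γ n)).trans (ENNReal.tsum_le_tsum fun k => ?_)
  by_cases ha : a k = 0
  · simp [ha]
  refine mul_le_mul_left (ENNReal.ofReal_le_ofReal ?_) _
  refine (hg _).trans ?_
  rw [mul_assoc C, ← Real.exp_add]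
  gcongr
  have := hR n k hf ha
  unfold uu at *
  linarith

lemma DN_le {α p : ℝ} (hα : 0 < α) (hp : 1 ≤ p) {γ : ℕ → ℂ} {D : ℝ}
    (hcol : ∀ k : ℕ, ∑' n, ENNReal.ofReal (Real.exp (-1 * |uu α γ n - k|)) ≤ ENNReal.ofReal D) :
    ∃ C : ℝ, 0 < C ∧ ∀ a f, PSRep a f → DN α p γ f ≤ ENNReal.ofReal C * SN α p a := by
  obtain ⟨C, hC, h⟩ := DN_le_R hα hp hcol
  refine ⟨C, hC, fun a f hf => ?_⟩
  simpa using h 0 a f hf (fun _ _ _ _ => abs_nonneg _)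

lemma sum_tt {α : ℝ} (δ : ℕ → ℝ) (k : ℕ) :
    ∑ m ∈ Finset.range k, tt α δ m = k * (k + 1) / (4 * α) + ∑ m ∈ Finset.range k, δ m := by
  induction k with
  | zero => simp
  | succ k ih =>
    rw [Finset.sum_range_succ, ih, Finset.sum_range_succ]
    unfold tt; push_cast
    rcases eq_or_ne α 0 with h | h
    · simp [h]
    · field_simp; ring

/-- key identity -/
lemma key_id {α p : ℝ} (hα : 0 < α) (hp : 1 ≤ p) (δ : ℕ → ℝ) (k : ℕ) (t : ℝ) :
    ∑ m ∈ Finset.range k, (t - tt α δ m) + (2 * t / p - α * t ^ 2) =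
      EE α p δ k + (2 * (t - k / (2 * α)) / p - α * (t - k / (2 * α)) ^ 2) := by
  have hp0 : p ≠ 0 := by linarith
  unfold EE UU
  rw [Finset.sum_sub_distrib, Finset.sum_sub_distrib, sum_tt]
  simp only [Finset.sum_const, Finset.card_range, nsmul_eq_mul]
  field_simp
  ring

lemma Qn_id {α p : ℝ} (hα : 0 < α) (hp : 1 ≤ p) {γ : ℕ → ℂ} {δ : ℕ → ℝ}
    (hn : ∀ n, ‖γ n‖ = Real.exp (tt α δ n)) {B : ℝ} (hB : ∀ n, |δ n| ≤ B) :
    ∃ C : ℝ, 0 < C ∧ ∀ n, |∑ m ∈ Finset.range n, (tt α δ n - tt α δ m) +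
      Real.log (Qz α p (γ n)) - EE α p δ n| ≤ C := by
  have hp0 : 0 < p := by linarith
  have hB0 : 0 ≤ B := (abs_nonneg _).trans (hB 0)
  set S := (1 + 2 * α * B) / (2 * α) with hS
  have hS0 : 0 < S := by positivity
  refine ⟨2 * S / p + α * S ^ 2 + 2 * α * B * B, by positivity, fun n => ?_⟩
  have h1 := key_id hα hp δ n (lpz (γ n))
  have h2 : Real.log (Qz α p (γ n)) = 2 * lpz (γ n) / p - α * lpz (γ n) ^ 2 := by
    unfold Qz; rw [Real.log_exp]; rfl
  have h3 : ∑ m ∈ Finset.range n, (lpz (γ n) - tt α δ m) =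
      ∑ m ∈ Finset.range n, (tt α δ n - tt α δ m) + n * (lpz (γ n) - tt α δ n) := by
    rw [Finset.sum_sub_distrib, Finset.sum_sub_distrib]; simp; ring
  set s := lpz (γ n) - n / (2 * α) with hs
  have hsb : |s| ≤ S := by
    have := uu_bdd hα hn hB n
    have e : s = (uu α γ n - n) / (2 * α) := by rw [hs]; unfold uu; field_simp
    rw [e, abs_div, abs_of_pos (by positivity : 0 < 2 * α), hS]
    exact div_le_div_of_nonneg_right this (by positivity)
  have h4 : 0 ≤ n * (lpz (γ n) - tt α δ n) ∧ n * (lpz (γ n) - tt α δ n) ≤ 2 * α * B * B := by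
    rw [lpz_eq hn]
    rcases le_total 0 (tt α δ n) with h | h
    · rw [max_eq_left h]; simp; positivity
    · rw [max_eq_right h]
      have hb := abs_le.mp (hB n)
      have : (1 + (n : ℝ)) / (2 * α) ≤ B := by unfold tt at h; linarith
      have hc : (n : ℝ) ≤ 2 * α * B := by
        rw [div_le_iff₀ (by positivity)] at this; linarith
      have h0 : (0 : ℝ) ≤ (1 + (n : ℝ)) / (2 * α) := by positivity
      have hd : 0 - tt α δ n ≤ B := by unfold tt; linarith
      refine ⟨mul_nonneg (Nat.cast_nonneg _) (by linarith), ?_⟩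
      exact mul_le_mul hc hd (by linarith) (by positivity)
  have h5 : |2 * s / p - α * s ^ 2| ≤ 2 * S / p + α * S ^ 2 := by
    refine (abs_sub _ _).trans ?_
    rw [abs_div, abs_mul, abs_mul, abs_of_pos hp0, abs_of_pos hα, abs_pow]
    simp only [Nat.abs_ofNat]
    gcongr
  have e : ∑ m ∈ Finset.range n, (tt α δ n - tt α δ m) + Real.log (Qz α p (γ n)) - EE α p δ n
      = (2 * s / p - α * s ^ 2) - n * (lpz (γ n) - tt α δ n) := by
    rw [h2]; linarith
  rw [e]
  have := abs_le.mp h5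
  rw [abs_le]; constructor <;> linarith [h4.1, h4.2]

/-- upper product bound -/
lemma prod_upper {α : ℝ} (hα : 0 < α) {δ : ℕ → ℝ} {B : ℝ} (hB : ∀ n, |δ n| ≤ B) (B0 : ℝ) :
    ∃ C : ℝ, 0 < C ∧ ∀ (A : Finset ℕ) (k : ℕ) (t : ℝ), |t - k / (2 * α)| ≤ B0 →
      ∏ m ∈ A, (1 + Real.exp (t - tt α δ m)) ≤
        Real.exp (C + ∑ m ∈ A, if m < k then t - tt α δ m else 0) := by
  obtain ⟨C1, hC1, h1⟩ := sumExp (c := 1 / (2 * α)) (by positivity)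
  set K := Real.exp (B0 + 1 / (2 * α) + B) with hK
  refine ⟨K * C1, by positivity, fun A k t ht => ?_⟩
  calc ∏ m ∈ A, (1 + Real.exp (t - tt α δ m))
      ≤ ∏ m ∈ A, Real.exp (K * Real.exp (-(1 / (2 * α)) * |(k : ℝ) - m|) +
          if m < k then t - tt α δ m else 0) := by
        refine Finset.prod_le_prod (fun _ _ => by positivity) fun m _ => ?_
        have hb := abs_le.mp (hB m)
        have htb := abs_le.mp ht
        have e : t - tt α δ m = (t - k / (2 * α)) - 1 / (2 * α) - δ m +
            1 / (2 * α) * (k - m) := by unfold tt; field_simp; ring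
        have hpos : 0 < 1 / (2 * α) := by positivity
        split_ifs with hm
        · have hkm : (m : ℝ) < k := by exact_mod_cast hm
          rw [Real.exp_add, abs_of_pos (by linarith)]
          have : 1 + Real.exp (t - tt α δ m) =
              (1 + Real.exp (-(t - tt α δ m))) * Real.exp (t - tt α δ m) := by
            rw [Real.exp_neg]; field_simp; ring
          rw [this]
          gcongr
          rw [add_comm]
          refine (Real.add_one_le_exp _).trans (Real.exp_le_exp.mpr ?_)
          rw [hK, ← Real.exp_add, Real.exp_le_exp]
          linarith
        · have hkm : (k : ℝ) ≤ m := by exact_mod_cast not_lt.mp hm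
          rw [add_zero, abs_of_nonpos (by linarith), add_comm]
          refine (Real.add_one_le_exp _).trans (Real.exp_le_exp.mpr ?_)
          rw [hK, ← Real.exp_add, Real.exp_le_exp]
          linarith
    _ = Real.exp (K * ∑ m ∈ A, Real.exp (-(1 / (2 * α)) * |(k : ℝ) - m|) +
          ∑ m ∈ A, if m < k then t - tt α δ m else 0) := by
        rw [← Real.exp_sum, Finset.sum_add_distrib, Finset.mul_sum]
    _ ≤ _ := by
        gcongr
        exact h1 A k

lemma sepFactor {c0 : ℝ} (hc0 : 0 < c0) : ∃ K : ℝ, 0 < K ∧ ∀ z w : ℂ, w ≠ 0 →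
    c0 * min ‖z‖ ‖w‖ ≤ ‖z - w‖ → Real.exp (-(K * (‖z‖ / ‖w‖))) ≤ ‖1 - z / w‖ := by
  refine ⟨2 + 2 * |Real.log (c0 / 2)|, by positivity, fun z w hw h => ?_⟩
  have hw0 : 0 < ‖w‖ := norm_pos_iff.mpr hw
  set y := ‖z‖ / ‖w‖ with hy
  have hy0 : 0 ≤ y := by positivity
  have e1 : ‖1 - z / w‖ = ‖z - w‖ / ‖w‖ := by
    rw [← norm_div, ← norm_neg]; congr 1; field_simp; ring
  rcases le_or_gt y (1 / 2) with h2 | h2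
  · have : 1 - y ≤ ‖1 - z / w‖ := by
      have := norm_sub_norm_le 1 (z / w)
      rwa [norm_one, norm_div] at this
    refine le_trans ?_ this
    have h3 : Real.exp (-(2 * y)) ≤ 1 - y := by
      have h4 := Real.add_one_le_exp (2 * y)
      rw [Real.exp_neg]
      rw [inv_le_comm₀ (Real.exp_pos _) (by linarith)]
      refine le_trans ?_ h4
      rw [inv_le_iff_one_le_mul₀ (by linarith)]
      nlinarith
    refine le_trans (Real.exp_le_exp.mpr ?_) h3
    have : 0 ≤ 2 * |Real.log (c0 / 2)| * y := by positivity
    linarith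
  · rw [e1]
    have h3 : c0 / 2 ≤ ‖z - w‖ / ‖w‖ := by
      rw [le_div_iff₀ hw0]
      refine le_trans ?_ h
      have hz : ‖w‖ / 2 ≤ ‖z‖ := by
        rw [hy, lt_div_iff₀ hw0] at h2; linarith
      have : ‖w‖ / 2 ≤ min ‖z‖ ‖w‖ := le_min hz (by linarith)
      calc c0 / 2 * ‖w‖ = c0 * (‖w‖ / 2) := by ring
        _ ≤ _ := by gcongr
    refine le_trans ?_ h3
    rw [← Real.le_log_iff_exp_le (by positivity)]
    have := neg_abs_le (Real.log (c0 / 2))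
    have h4 : |Real.log (c0 / 2)| * 1 ≤ |Real.log (c0 / 2)| * (2 * y) := by gcongr; linarith
    nlinarith

/-- lower product bound at the nodes for separated sequences -/
lemma prod_lower {α : ℝ} (hα : 0 < α) {γ : ℕ → ℂ} {δ : ℕ → ℝ}
    (hn : ∀ n, ‖γ n‖ = Real.exp (tt α δ n)) {B : ℝ} (hB : ∀ n, |δ n| ≤ B)
    {c0 : ℝ} (hc0 : 0 < c0) (hsep : ∀ m n, m ≠ n → c0 * min ‖γ m‖ ‖γ n‖ ≤ ‖γ m - γ n‖) :
    ∃ C : ℝ, 0 < C ∧ ∀ (A : Finset ℕ) (n : ℕ), n ∉ A →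
      Real.exp (-C + ∑ m ∈ A, if m < n then tt α δ n - tt α δ m else 0) ≤
        ∏ m ∈ A, ‖1 - γ n / γ m‖ := by
  obtain ⟨C1, hC1, h1⟩ := sumExp (c := 1 / (2 * α)) (by positivity)
  obtain ⟨K, hK, hF⟩ := sepFactor hc0
  have hγ : ∀ n, γ n ≠ 0 := fun n => norm_pos_iff.mp (by rw [hn]; positivity)
  set K1 := K * Real.exp (2 * B) with hK1
  refine ⟨K1 * C1, by positivity, fun A n hnA => ?_⟩
  have hle : ∀ i j : ℕ, i < j → ‖γ i‖ / ‖γ j‖ ≤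
      Real.exp (2 * B) * Real.exp (-(1 / (2 * α)) * ((j : ℝ) - i)) := by
    intro i j _
    rw [hn, hn, ← Real.exp_sub, ← Real.exp_add, Real.exp_le_exp]
    have hi := abs_le.mp (hB i)
    have hj := abs_le.mp (hB j)
    have e : tt α δ i - tt α δ j = δ i - δ j + -(1 / (2 * α)) * ((j : ℝ) - i) := by
      unfold tt; field_simp; ring
    rw [e]; linarith
  calc Real.exp (-(K1 * C1) + ∑ m ∈ A, if m < n then tt α δ n - tt α δ m else 0)
      ≤ Real.exp (-(K1 * ∑ m ∈ A, Real.exp (-(1 / (2 * α)) * |(n : ℝ) - m|)) +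
          ∑ m ∈ A, if m < n then tt α δ n - tt α δ m else 0) := by
        gcongr
        exact h1 A n
    _ = ∏ m ∈ A, Real.exp (-(K1 * Real.exp (-(1 / (2 * α)) * |(n : ℝ) - m|)) +
          if m < n then tt α δ n - tt α δ m else 0) := by
        rw [← Real.exp_sum, Finset.sum_add_distrib, Finset.mul_sum, Finset.sum_neg_distrib]
    _ ≤ _ := by
        refine Finset.prod_le_prod (fun _ _ => by positivity) fun m hm => ?_
        have hne : m ≠ n := fun h => hnA (h ▸ hm)
        split_ifs with hmn
        · have hmn' : (m : ℝ) < n := by exact_mod_cast hmn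
          have e : ‖1 - γ n / γ m‖ = ‖1 - γ m / γ n‖ * Real.exp (tt α δ n - tt α δ m) := by
            rw [Real.exp_sub, ← hn, ← hn, ← norm_div, ← norm_mul, ← norm_neg]
            congr 1
            have := hγ n; have := hγ m
            field_simp; ring
          rw [e, Real.exp_add, abs_of_pos (by linarith)]
          gcongr
          refine le_trans ?_ (hF (γ m) (γ n) (hγ n) (hsep m n hne))
          refine Real.exp_le_exp.mpr (neg_le_neg ?_)
          rw [hK1, mul_assoc]
          gcongr
          exact hle m n hmn
        · have hmn' : n < m := lt_of_le_of_ne (not_lt.mp hmn) (Ne.symm hne)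
          have hmn2 : (n : ℝ) < m := by exact_mod_cast hmn'
          rw [add_zero, abs_of_neg (by linarith), neg_sub]
          refine le_trans ?_ (hF (γ n) (γ m) (hγ m) (hsep n m hne.symm))
          refine Real.exp_le_exp.mpr (neg_le_neg ?_)
          rw [hK1, mul_assoc]
          gcongr
          exact (hle n m hmn')

/-- lower bound for the Jensen-type products -/
lemma prod_lowerR {α : ℝ} (hα : 0 < α) {δ : ℕ → ℝ} {B : ℝ} (hB : ∀ n, |δ n| ≤ B) (B0 : ℝ) :
    ∃ C : ℝ, 0 < C ∧ ∀ (A : Finset ℕ) (k : ℕ) (t : ℝ), |t - k / (2 * α)| ≤ B0 →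
      (∀ m ∈ A, m < k ∧ Real.exp (-(t - tt α δ m)) ≤ 1 / 2) →
      Real.exp (-C + ∑ m ∈ A, (t - tt α δ m)) ≤ ∏ m ∈ A, (Real.exp (t - tt α δ m) - 1) := by
  obtain ⟨C1, hC1, h1⟩ := sumExp (c := 1 / (2 * α)) (by positivity)
  set K := 2 * Real.exp (B0 + 1 / (2 * α) + B) with hK
  refine ⟨K * C1, by positivity, fun A k t ht hA => ?_⟩
  calc Real.exp (-(K * C1) + ∑ m ∈ A, (t - tt α δ m))
      ≤ Real.exp (-(K * ∑ m ∈ A, Real.exp (-(1 / (2 * α)) * |(k : ℝ) - m|)) +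
          ∑ m ∈ A, (t - tt α δ m)) := by
        gcongr
        exact h1 A k
    _ = ∏ m ∈ A, Real.exp (-(K * Real.exp (-(1 / (2 * α)) * |(k : ℝ) - m|)) +
          (t - tt α δ m)) := by
        rw [← Real.exp_sum, Finset.sum_add_distrib, Finset.mul_sum, Finset.sum_neg_distrib]
    _ ≤ _ := by
        refine Finset.prod_le_prod (fun _ _ => by positivity) fun m hm => ?_
        obtain ⟨hmk, h2⟩ := hA m hm
        have hkm : (m : ℝ) < k := by exact_mod_cast hmk
        have hb := abs_le.mp (hB m)
        have htb := abs_le.mp ht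
        have e : t - tt α δ m = (t - k / (2 * α)) - 1 / (2 * α) - δ m +
            1 / (2 * α) * (k - m) := by unfold tt; field_simp; ring
        have e2 : Real.exp (t - tt α δ m) - 1 =
            (1 - Real.exp (-(t - tt α δ m))) * Real.exp (t - tt α δ m) := by
          rw [Real.exp_neg]; field_simp
        rw [e2, Real.exp_add, abs_of_pos (by linarith)]
        gcongr
        set y := Real.exp (-(t - tt α δ m)) with hy
        have hy0 : 0 < y := Real.exp_pos _
        have h3 : Real.exp (-(2 * y)) ≤ 1 - y := by
          have h4 := Real.add_one_le_exp (2 * y)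
          rw [Real.exp_neg]
          rw [inv_le_comm₀ (Real.exp_pos _) (by linarith)]
          refine le_trans ?_ h4
          rw [inv_le_iff_one_le_mul₀ (by linarith)]
          nlinarith
        refine le_trans ?_ h3
        refine Real.exp_le_exp.mpr (neg_le_neg ?_)
        rw [hK, mul_assoc]
        gcongr
        rw [hy, ← Real.exp_add, Real.exp_le_exp]
        linarith

lemma window {x : ℕ → ℝ} {K η : ℝ} (hK : ∀ n, |x n| ≤ K) (hη : 0 < η) {N : ℕ} (hN : 1 ≤ N)
    (h : ∀ n, η * N ≤ ∑ j ∈ Finset.range N, x (n + j)) :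
    ∀ r n : ℕ, η * r - (K + η) * N ≤ ∑ j ∈ Finset.range r, x (n + j) := by
  have hK0 : 0 ≤ K := (abs_nonneg _).trans (hK 0)
  intro r
  induction r using Nat.strong_induction_on with
  | _ r ih =>
    intro n
    rcases lt_or_ge r N with hr | hr
    · have h1 : -(K * r) ≤ ∑ j ∈ Finset.range r, x (n + j) := by
        have : ∑ j ∈ Finset.range r, -K ≤ ∑ j ∈ Finset.range r, x (n + j) :=
          Finset.sum_le_sum fun j _ => (abs_le.mp (hK (n + j))).1
        simp at this; linarith
      have hr' : (r : ℝ) ≤ N := by exact_mod_cast hr.le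
      nlinarith
    · obtain ⟨s, rfl⟩ := Nat.exists_eq_add_of_le hr
      rw [Finset.sum_range_add]
      have h1 := h n
      have h2 := ih s (by omega) (n + N)
      simp only [add_assoc] at h2 ⊢
      push_cast
      linarith

lemma EE_add (α p : ℝ) (δ : ℕ → ℝ) (k r : ℕ) :
    EE α p δ (k + r) = EE α p δ k + ∑ j ∈ Finset.range r, (UU α p - δ (k + j)) := by
  unfold EE; rw [Finset.sum_range_add]

lemma sum_ite_range (x : ℕ → ℝ) {k M : ℕ} (h : k ≤ M) :
    ∑ m ∈ Finset.range M, (if m < k then x m else 0) = ∑ m ∈ Finset.range k, x m := by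
  rw [← Finset.sum_filter]
  congr 1; ext m; simp; omega

lemma lag_eval {γ : ℕ → ℂ} (hinj : Function.Injective γ) (hγ : ∀ n, γ n ≠ 0) (M n : ℕ) (z : ℂ) :
    (Lagrange.basis (Finset.range M) γ n).eval z =
      ∏ m ∈ (Finset.range M).erase n, ((1 - z / γ m) / (1 - γ n / γ m)) := by
  unfold Lagrange.basis
  rw [Polynomial.eval_prod]
  refine Finset.prod_congr rfl fun m hm => ?_
  have hne : n ≠ m := (Finset.ne_of_mem_erase hm).symm
  have h1 : γ n - γ m ≠ 0 := sub_ne_zero.mpr (hinj.ne hne)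
  have h1' : γ m - γ n ≠ 0 := sub_ne_zero.mpr (hinj.ne hne.symm)
  have h2 := hγ m
  have h3 : 1 - γ n / γ m = (γ m - γ n) / γ m := by field_simp
  unfold Lagrange.basisDivisor
  simp only [Polynomial.eval_mul, Polynomial.eval_C, Polynomial.eval_sub, Polynomial.eval_X]
  rw [h3]
  field_simp
  ring

lemma lag_coef {α p : ℝ} (hα : 0 < α) (hp : 1 ≤ p) {γ : ℕ → ℂ} (hinj : Function.Injective γ)
    {δ : ℕ → ℝ}
    (hn : ∀ n, ‖γ n‖ = Real.exp (tt α δ n)) {B : ℝ} (hB : ∀ n, |δ n| ≤ B)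
    {c0 : ℝ} (hc0 : 0 < c0) (hsep : ∀ m n, m ≠ n → c0 * min ‖γ m‖ ‖γ n‖ ≤ ‖γ m - γ n‖)
    {ε C : ℝ} (hw1 : ∀ r n : ℕ, ε * r - C ≤ ∑ j ∈ Finset.range r, (UU α p - δ (n + j)))
    (hw2 : ∀ r n : ℕ, ε * r - C ≤ ∑ j ∈ Finset.range r, (δ (n + j) - (UU α p - 1 / (2 * α)))) :
    ∃ C' : ℝ, 0 < C' ∧ ∀ M n k : ℕ, n < M → k < M →
      ‖(Lagrange.basis (Finset.range M) γ n).coeff k‖ * Wt α p k ≤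
        C' * Real.exp (-ε * |(k : ℝ) - n|) * Qz α p (γ n) := by
  have hp0 : 0 < p := by linarith
  have hB0 : 0 ≤ B := (abs_nonneg _).trans (hB 0)
  have hγ : ∀ n, γ n ≠ 0 := fun n => norm_pos_iff.mp (by rw [hn]; positivity)
  obtain ⟨C1, hC1, hup⟩ := prod_upper hα hB 0
  obtain ⟨C2, hC2, hlo⟩ := prod_lower hα hn hB hc0 hsep
  obtain ⟨C3, hC3, hQ⟩ := Qn_id hα hp hn hB
  refine ⟨Real.exp (C1 + C2 + C3 + C + 1 / (2 * α) + B), Real.exp_pos _,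
    fun M n k hnM hkM => ?_⟩
  set t : ℝ := k / (2 * α) with ht
  set A := (Finset.range M).erase n with hA
  have hnM' : n ∈ Finset.range M := Finset.mem_range.mpr hnM
  set S1 := ∑ m ∈ A, (if m < k then t - tt α δ m else 0) with hS1
  set S2 := ∑ m ∈ A, (if m < n then tt α δ n - tt α δ m else 0) with hS2
  have hsup : ∀ z : ℂ, ‖z‖ = Real.exp t →
      ‖(Lagrange.basis (Finset.range M) γ n).eval z‖ ≤ Real.exp (C1 + S1 + C2 - S2) := by
    intro z hz
    rw [lag_eval hinj hγ, Finset.prod_div_distrib, norm_div, norm_prod, norm_prod]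
    have h1 : ∏ m ∈ A, ‖1 - z / γ m‖ ≤ Real.exp (C1 + S1) := by
      refine le_trans ?_ (hup A k t (by simp [ht]))
      refine Finset.prod_le_prod (fun _ _ => norm_nonneg _) fun m _ => ?_
      refine (norm_sub_le _ _).trans ?_
      rw [norm_one, norm_div, hz, hn, Real.exp_sub]
    have h2 := hlo A n (by simp [hA])
    calc _ ≤ Real.exp (C1 + S1) / Real.exp (-C2 + S2) := by gcongr
      _ = _ := by rw [← Real.exp_sub]; congr 1; ring
  have h1 := (rep_poly (Lagrange.basis (Finset.range M) γ n)).coef_le_sup (Real.exp_pos t).le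
    hsup k
  have eW : Wt α p k = Real.exp t ^ k * Real.exp (2 * t / p - α * t ^ 2) := by
    unfold Wt
    rw [← Real.exp_nat_mul, ← Real.exp_add, ht]
    congr 1
    field_simp
    ring
  have e1 : S1 = ∑ m ∈ Finset.range k, (t - tt α δ m) - (if n < k then t - tt α δ n else 0) := by
    rw [← sum_ite_range (fun m => t - tt α δ m) hkM.le, ← Finset.sum_erase_add _ _ hnM']
    ring
  have e2 : S2 = ∑ m ∈ Finset.range n, (tt α δ n - tt α δ m) := by
    rw [← sum_ite_range (fun m => tt α δ n - tt α δ m) hnM.le, ← Finset.sum_erase_add _ _ hnM']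
    simp [hS2, hA]
  have hk := key_id hα hp δ k t
  have hz : t - k / (2 * α) = 0 := by simp [ht]
  rw [hz] at hk
  have hQn := abs_le.mp (hQ n)
  rw [← e2] at hQn
  rw [eW, ← mul_assoc]
  have hQp := Qz_pos α p (γ n)
  refine (mul_le_mul_of_nonneg_right h1 (Real.exp_pos _).le).trans ?_
  rw [← Real.exp_log hQp, ← Real.exp_add, ← Real.exp_add, ← Real.exp_add, Real.exp_le_exp]
  have hd : |δ n| ≤ B := hB n
  have hd' := abs_le.mp hd
  have hpos : 0 < 1 / (2 * α) := by positivity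
  rcases lt_or_ge n k with hnk | hnk
  · obtain ⟨r, rfl⟩ := Nat.exists_eq_add_of_lt hnk
    rw [if_pos hnk] at e1
    have h3 := EE_add α p δ n (r + 1)
    rw [← add_assoc] at h3
    have h4 := hw2 (r + 1) n
    have h5 : ∑ j ∈ Finset.range (r + 1), (δ (n + j) - (UU α p - 1 / (2 * α))) =
        -∑ j ∈ Finset.range (r + 1), (UU α p - δ (n + j)) + (r + 1) / (2 * α) := by
      rw [← Finset.sum_neg_distrib, ← sub_eq_iff_eq_add', ← Finset.sum_sub_distrib]
      simp only [Finset.sum_sub_distrib, Finset.sum_const, Finset.card_range, Finset.sum_neg_distrib]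
      simp
      ring
    have h6 : t - tt α δ n = (r + 1) / (2 * α) - 1 / (2 * α) - δ n := by
      rw [ht]; unfold tt; push_cast; field_simp; ring
    have h7 : |((n + r + 1 : ℕ) : ℝ) - n| = r + 1 := by
      push_cast; rw [abs_of_pos (by have : (0:ℝ) ≤ r := Nat.cast_nonneg r
                                    linarith)]; ring
    rw [h7]
    push_cast at h4
    simp only [mul_zero, zero_div, zero_pow (two_ne_zero), sub_zero, add_zero] at hk
    linarith
  · obtain ⟨r, rfl⟩ := Nat.exists_eq_add_of_le hnk
    rw [if_neg (not_lt.mpr hnk)] at e1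
    have h3 := EE_add α p δ k r
    have h4 := hw1 r k
    have h7 : |(k : ℝ) - ((k + r : ℕ) : ℝ)| = r := by
      push_cast; rw [abs_sub_comm, add_sub_cancel_left, abs_of_nonneg (Nat.cast_nonneg r)]
    rw [h7]
    simp only [mul_zero, zero_div, zero_pow (two_ne_zero), sub_zero, add_zero] at hk
    linarith

def LagB (α p : ℝ) (γ : ℕ → ℂ) (ε C' : ℝ) : Prop :=
  ∀ M n k : ℕ, n < M → k < M →
      ‖(Lagrange.basis (Finset.range M) γ n).coeff k‖ * Wt α p k ≤
        C' * Real.exp (-ε * |(k : ℝ) - n|) * Qz α p (γ n)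

lemma fin_est {α p : ℝ} (hp : 1 ≤ p) {γ : ℕ → ℂ} (hinj : Function.Injective γ)
    {ε C' : ℝ} (hε : 0 < ε) (hC' : 0 < C') (hL : LagB α p γ ε C') :
    ∃ C : ℝ, 0 < C ∧ ∀ (M : ℕ) (v : ℕ → ℂ),
      SN α p (Lagrange.interpolate (Finset.range M) γ v).coeff ≤
        ENNReal.ofReal C * ∑' n, if n < M then ENNReal.ofReal ((‖v n‖ * Qz α p (γ n)) ^ p)
          else 0 := by
  have hp0 : 0 < p := by linarith
  obtain ⟨D, hD, hcol⟩ := colBound hε 0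
  obtain ⟨C2, hC2, hS⟩ := schurU hp hε (fun n => (n : ℝ)) D (hcol _ (by simp))
  refine ⟨C2 * C' ^ p, by positivity, fun M v => ?_⟩
  have hS' := hS C' hC'.le (fun n => if n < M then ENNReal.ofReal (‖v n‖ * Qz α p (γ n)) else 0)
  have e : ∀ n, (if n < M then ENNReal.ofReal ((‖v n‖ * Qz α p (γ n)) ^ p) else 0) =
      (if n < M then ENNReal.ofReal (‖v n‖ * Qz α p (γ n)) else 0) ^ p := by
    intro n
    have := Qz_pos α p (γ n)
    split_ifs
    · rw [ENNReal.ofReal_rpow_of_nonneg (by positivity) hp0.le]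
    · rw [ENNReal.zero_rpow_of_pos hp0]
  simp_rw [e]
  refine le_trans ?_ hS'
  unfold SN
  refine ENNReal.tsum_le_tsum fun k => ?_
  rw [SN_term hp]
  refine ENNReal.rpow_le_rpow ?_ hp0.le
  rcases lt_or_ge k M with hk | hk
  · have h1 : (Lagrange.interpolate (Finset.range M) γ v).coeff k =
        ∑ n ∈ Finset.range M, v n * (Lagrange.basis (Finset.range M) γ n).coeff k := by
      simp [Lagrange.interpolate_apply, Polynomial.finsetSum_coeff, Polynomial.coeff_C_mul]
    have h2 : ‖(Lagrange.interpolate (Finset.range M) γ v).coeff k‖ * Wt α p k ≤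
        ∑ n ∈ Finset.range M, C' * Real.exp (-ε * |(k : ℝ) - n|) * (‖v n‖ * Qz α p (γ n)) := by
      rw [h1]
      calc _ ≤ (∑ n ∈ Finset.range M, ‖v n * (Lagrange.basis (Finset.range M) γ n).coeff k‖) *
            Wt α p k := by
              have := Wt_pos α p k
              gcongr
              exact norm_sum_le _ _
        _ ≤ _ := by
          rw [Finset.sum_mul]
          refine Finset.sum_le_sum fun n hn => ?_
          rw [norm_mul, mul_assoc]
          have := hL M n k (Finset.mem_range.mp hn) hk
          calc _ ≤ ‖v n‖ * (C' * Real.exp (-ε * |(k : ℝ) - n|) * Qz α p (γ n)) := by gcongr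
            _ = _ := by ring
    refine (ENNReal.ofReal_le_ofReal h2).trans ?_
    rw [ENNReal.ofReal_sum_of_nonneg (fun n _ => by
      have := Qz_pos α p (γ n)
      positivity)]
    refine le_trans (Finset.sum_le_sum fun n hn => ?_) (ENNReal.sum_le_tsum (Finset.range M))
    rw [if_pos (Finset.mem_range.mp hn), ENNReal.ofReal_mul (by positivity)]
  · have : (Lagrange.interpolate (Finset.range M) γ v).coeff k = 0 := by
      apply Polynomial.coeff_eq_zero_of_degree_lt
      refine (Lagrange.degree_interpolate_lt _ hinj.injOn).trans_le ?_
      rw [Finset.card_range]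
      exact_mod_cast hk
    rw [this]
    simp

lemma int_of_fin {α p : ℝ} (hα : 0 < α) (hp : 1 ≤ p) {γ : ℕ → ℂ} (hinj : Function.Injective γ)
    {C : ℝ} (hC : 0 < C) (hF : ∀ (M : ℕ) (v : ℕ → ℂ),
      SN α p (Lagrange.interpolate (Finset.range M) γ v).coeff ≤
        ENNReal.ofReal C * ∑' n, if n < M then ENNReal.ofReal ((‖v n‖ * Qz α p (γ n)) ^ p)
          else 0) : IntN α p γ := by
  have hp0 : 0 < p := by linarith
  intro v hv
  set V := ∑' n, ENNReal.ofReal ((‖v n‖ * Qz α p (γ n)) ^ p) with hV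
  set b : ℕ → ℕ → ℂ := fun M => (Lagrange.interpolate (Finset.range M) γ v).coeff with hb
  have hbS : ∀ M, SN α p (b M) ≤ ENNReal.ofReal C * V := by
    intro M
    refine (hF M v).trans ?_
    refine mul_le_mul_right (ENNReal.tsum_le_tsum fun n => ?_) _
    split_ifs
    · exact le_rfl
    · exact zero_le
  set S : ℝ := (C * V.toReal) ^ p⁻¹ with hS
  have hS0 : 0 ≤ S := by positivity
  have hSp : ENNReal.ofReal (S ^ p) = ENNReal.ofReal C * V := by
    rw [hS, ← Real.rpow_mul (by positivity), inv_mul_cancel₀ hp0.ne', Real.rpow_one,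
      ENNReal.ofReal_mul hC.le, ENNReal.ofReal_toReal hv.ne]
  have hbc : ∀ M k, ‖b M k‖ * Wt α p k ≤ S := fun M k =>
    coef_le_of_SN hp _ hS0 (by rw [hSp]; exact hbS M) k
  have hbk : ∀ M k, ‖b M k‖ ≤ S / Wt α p k := fun M k => by
    rw [le_div_iff₀ (Wt_pos α p k)]; exact hbc M k
  have hcomp : IsCompact (Set.pi Set.univ fun k => Metric.closedBall (0 : ℂ) (S / Wt α p k)) :=
    isCompact_univ_pi fun k => isCompact_closedBall _ _
  obtain ⟨a, -, ψ, hψ, hlim⟩ := hcomp.tendsto_subseq (x := b) (fun M => by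
    rw [Set.mem_univ_pi]
    intro k
    rw [mem_closedBall_zero_iff]
    exact hbk M k)
  rw [tendsto_pi_nhds] at hlim
  have hSa : SN α p a ≤ ENNReal.ofReal C * V := by
    unfold SN
    rw [ENNReal.tsum_eq_iSup_sum]
    refine iSup_le fun s => ?_
    have ht : Filter.Tendsto (fun j => ∑ k ∈ s, ENNReal.ofReal ((‖b (ψ j) k‖ * Wt α p k) ^ p))
        Filter.atTop (nhds (∑ k ∈ s, ENNReal.ofReal ((‖a k‖ * Wt α p k) ^ p))) := by
      refine tendsto_finsetSum _ fun k _ => ?_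
      refine ENNReal.tendsto_ofReal ?_
      exact (((hlim k).norm).mul_const _).rpow_const (Or.inr hp0.le)
    refine le_of_tendsto ht (Filter.Eventually.of_forall fun j => ?_)
    exact (ENNReal.sum_le_tsum s).trans (hbS (ψ j))
  have hSa' : SN α p a < ⊤ := hSa.trans_lt (ENNReal.mul_lt_top ENNReal.ofReal_lt_top hv)
  refine ⟨a, _, exists_rep_of_SN hα hp a hSa', hSa', fun n => ?_⟩
  have hsum : Summable (fun k : ℕ => S / Wt α p k * ‖γ n‖ ^ k) := by
    have := (exists_rep_of_bdd hα hp (fun k => ((S / Wt α p k : ℝ) : ℂ)) (S := S) (fun k => by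
      rw [Complex.norm_real, Real.norm_of_nonneg (div_nonneg hS0 (Wt_pos α p k).le),
        div_mul_cancel₀ _ (Wt_pos α p k).ne']) (γ n)).summable.norm
    refine this.congr fun k => ?_
    rw [norm_mul, norm_pow, Complex.norm_real,
      Real.norm_of_nonneg (div_nonneg hS0 (Wt_pos α p k).le)]
  have hdc : Filter.Tendsto (fun j => ∑' k, b (ψ j) k * γ n ^ k) Filter.atTop
      (nhds (∑' k, a k * γ n ^ k)) := by
    refine tendsto_tsum_of_dominated_convergence hsum (fun k => (hlim k).mul_const _)
      (Filter.Eventually.of_forall fun j k => ?_)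
    rw [norm_mul, norm_pow]
    gcongr
    exact hbk _ _
  have hev : ∀ᶠ j in Filter.atTop, ∑' k, b (ψ j) k * γ n ^ k = v n := by
    filter_upwards [Filter.eventually_gt_atTop n] with j hj
    rw [((rep_poly (Lagrange.interpolate (Finset.range (ψ j)) γ v)) (γ n)).tsum_eq]
    exact Lagrange.eval_interpolate_at_node _ hinj.injOn
      (Finset.mem_range.mpr (hj.trans_le (hψ.id_le j)))
  exact tendsto_nhds_unique (hdc.congr' hev) tendsto_const_nhds |>.symm ▸ rfl

lemma samp_of_fin {α p : ℝ} (hp : 1 ≤ p) {γ : ℕ → ℂ} (hinj : Function.Injective γ)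
    {C : ℝ} (hC : 0 < C) (hF : ∀ (M : ℕ) (v : ℕ → ℂ),
      SN α p (Lagrange.interpolate (Finset.range M) γ v).coeff ≤
        ENNReal.ofReal C * ∑' n, if n < M then ENNReal.ofReal ((‖v n‖ * Qz α p (γ n)) ^ p)
          else 0)
    {C2 : ℝ} (hC2 : 0 < C2)
    (hD : ∀ a f, PSRep a f → DN α p γ f ≤ ENNReal.ofReal C2 * SN α p a) : SampN α p γ := by
  have hp0 : 0 < p := by linarith
  set K : ℝ := C * 2 ^ (p - 1) with hK
  have hK0 : 0 < K := by positivity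
  refine ⟨K + C2, by positivity, fun a f hr ha => ⟨?_, ?_⟩⟩
  swap
  · refine (hD a f hr).trans ?_
    gcongr; linarith
  suffices h : SN α p a ≤ ENNReal.ofReal K * DN α p γ f by
    refine h.trans ?_
    gcongr; linarith
  set P : ℕ → Polynomial ℂ := fun M => ∑ k ∈ Finset.range M, Polynomial.monomial k (a k) with hP
  have hPc : ∀ M k, (P M).coeff k = if k < M then a k else 0 := by
    intro M k
    simp [hP, Polynomial.finsetSum_coeff, Polynomial.coeff_monomial]
  set x : ℕ → ℝ≥0∞ := fun k => ENNReal.ofReal ((‖a k‖ * Wt α p k) ^ p) with hx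
  have htail : ∀ M, SN α p (fun k => a k - (P M).coeff k) = ∑' k, x (k + M) := by
    intro M
    unfold SN
    rw [← Summable.sum_add_tsum_nat_add' (k := M) ENNReal.summable]
    rw [Finset.sum_eq_zero, zero_add]
    · congr 1; ext k
      simp [hPc, hx]
    · intro k hk
      simp [hPc, Finset.mem_range.mp hk, Real.zero_rpow hp0.ne']
  have hmain : ∀ M, ∑ k ∈ Finset.range M, x k ≤
      ENNReal.ofReal K * (DN α p γ f + ENNReal.ofReal C2 * ∑' k, x (k + M)) := by
    intro M
    have h1 : ∑ k ∈ Finset.range M, x k ≤ SN α p (P M).coeff := by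
      unfold SN
      refine le_trans (Finset.sum_le_sum fun k hk => ?_) (ENNReal.sum_le_tsum (Finset.range M))
      rw [hPc, if_pos (Finset.mem_range.mp hk)]
    have h2 : P M = Lagrange.interpolate (Finset.range M) γ (fun n => (P M).eval (γ n)) := by
      apply Lagrange.eq_interpolate hinj.injOn
      rw [Finset.card_range, Polynomial.degree_lt_iff_coeff_zero]
      intro m hm
      rw [hPc, if_neg (not_lt.mpr hm)]
    have h3 : SN α p (P M).coeff ≤ ENNReal.ofReal C * DN α p γ (fun z => (P M).eval z) := by
      have := hF M (fun n => (P M).eval (γ n))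
      rw [← h2] at this
      refine this.trans (mul_le_mul_right (ENNReal.tsum_le_tsum fun n => ?_) _)
      split_ifs
      · exact le_rfl
      · exact zero_le
    have h4 : DN α p γ (fun z => (P M).eval z) ≤ ENNReal.ofReal (2 ^ (p - 1)) *
        (DN α p γ f + DN α p γ (fun z => f z - (P M).eval z)) := by
      unfold DN
      rw [← ENNReal.tsum_add, ← ENNReal.tsum_mul_left]
      refine ENNReal.tsum_le_tsum fun n => ?_
      have hQ := Qz_pos α p (γ n)
      rw [← ENNReal.ofReal_rpow_of_nonneg (by positivity) hp0.le,
        ← ENNReal.ofReal_rpow_of_nonneg (by positivity) hp0.le,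
        ← ENNReal.ofReal_rpow_of_nonneg (by positivity) hp0.le]
      have h5 := ENNReal.rpow_add_le_mul_rpow_add_rpow (ENNReal.ofReal (‖f (γ n)‖ * Qz α p (γ n)))
        (ENNReal.ofReal (‖f (γ n) - (P M).eval (γ n)‖ * Qz α p (γ n))) hp
      rw [← ENNReal.ofReal_rpow_of_pos (by norm_num), ENNReal.ofReal_ofNat]
      refine le_trans (ENNReal.rpow_le_rpow ?_ hp0.le) h5
      rw [← ENNReal.ofReal_add (by positivity) (by positivity), ← add_mul]
      gcongr
      have := norm_sub_le (f (γ n)) (f (γ n) - (P M).eval (γ n))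
      simpa using this
    have h5 := hD _ _ (hr.sub (rep_poly (P M)))
    rw [htail] at h5
    calc _ ≤ _ := h1.trans h3
      _ ≤ ENNReal.ofReal C * (ENNReal.ofReal (2 ^ (p - 1)) *
          (DN α p γ f + ENNReal.ofReal C2 * ∑' k, x (k + M))) := by
          refine mul_le_mul_right (h4.trans ?_) _
          gcongr
      _ = _ := by rw [hK, ENNReal.ofReal_mul hC.le, mul_assoc]
  have hlim : Filter.Tendsto (fun M => ENNReal.ofReal K *
      (DN α p γ f + ENNReal.ofReal C2 * ∑' k, x (k + M))) Filter.atTop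
      (nhds (ENNReal.ofReal K * (DN α p γ f + ENNReal.ofReal C2 * 0))) := by
    refine ENNReal.Tendsto.const_mul ?_ (Or.inr ENNReal.ofReal_ne_top)
    refine tendsto_const_nhds.add ?_
    refine ENNReal.Tendsto.const_mul ?_ (Or.inr ENNReal.ofReal_ne_top)
    exact ENNReal.tendsto_sum_nat_add x ha.ne
  rw [mul_zero, add_zero] at hlim
  exact le_of_tendsto_of_tendsto' ENNReal.summable.hasSum.tendsto_sum_nat hlim hmain

lemma sep_of_dRho {α : ℝ} (hα : 0 < α) {γ : ℕ → ℂ} (hinj : Function.Injective γ)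
    (h : DRhoSeparated α (Set.range γ)) :
    ∃ c0 : ℝ, 0 < c0 ∧ ∀ m n, m ≠ n → c0 * min ‖γ m‖ ‖γ n‖ ≤ ‖γ m - γ n‖ := by
  obtain ⟨ε, hε, h⟩ := h
  have hs : 0 < Real.sqrt (2 * α) := by positivity
  refine ⟨ε / Real.sqrt (2 * α), by positivity, fun m n hmn => ?_⟩
  have h1 := h _ ⟨m, rfl⟩ _ ⟨n, rfl⟩ (hinj.ne hmn)
  unfold dRho rhoF at h1
  rw [min_div_div_right hs.le] at h1
  have hmin : 0 ≤ min ‖γ m‖ ‖γ n‖ := le_min (norm_nonneg _) (norm_nonneg _)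
  rw [le_div_iff₀ (by positivity)] at h1
  refine le_trans ?_ h1
  rw [mul_add, mul_one, div_mul_eq_mul_div, mul_div_assoc]
  linarith

lemma bdd_avg {δ : ℕ → ℝ} {B : ℝ} (hB : ∀ n, |δ n| ≤ B) {N : ℕ} (hN : 1 ≤ N) (n : ℕ) :
    |avgD δ N n| ≤ B := by
  unfold avgD
  have hN0 : (0 : ℝ) < N := by exact_mod_cast hN
  rw [abs_mul, abs_of_pos (by positivity), one_div, inv_mul_le_iff₀ hN0]
  refine (Finset.abs_sum_le_sum_abs _ _).trans ?_
  refine (Finset.sum_le_sum fun k _ => hB (n + k)).trans ?_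
  simp

lemma sum_of_avg {δ : ℕ → ℝ} {N : ℕ} (hN : 1 ≤ N) (n : ℕ) :
    ∑ j ∈ Finset.range N, δ (n + j) = N * avgD δ N n := by
  unfold avgD
  have hN0 : (N : ℝ) ≠ 0 := by positivity
  field_simp

lemma sufficiency {α p : ℝ} (hα : 0 < α) (hp : 1 < p) {γ : ℕ → ℂ} (hinj : Function.Injective γ)
    {δ : ℕ → ℝ} (hn : ∀ n, ‖γ n‖ = Real.exp (tt α δ n)) {B : ℝ} (hB : ∀ n, |δ n| ≤ B)
    (hsep : DRhoSeparated α (Set.range γ)) {N : ℕ} (hN : 1 ≤ N)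
    (h1 : UU α p - 1 / (2 * α) < ⨅ n : ℕ, avgD δ N n)
    (h2 : ⨆ n : ℕ, avgD δ N n < UU α p) : SampN α p γ ∧ IntN α p γ := by
  obtain ⟨c0, hc0, hsep⟩ := sep_of_dRho hα hinj hsep
  have hN0 : (0 : ℝ) < N := by exact_mod_cast hN
  set η1 := (⨅ n : ℕ, avgD δ N n) - (UU α p - 1 / (2 * α)) with hη1
  set η2 := UU α p - ⨆ n : ℕ, avgD δ N n with hη2
  have hw1 := window (x := fun m => UU α p - δ m) (K := |UU α p| + B) (η := min η1 η2)
    (fun n => (abs_sub _ _).trans (by gcongr; exact hB n))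
    (lt_min (by linarith) (by linarith)) hN (fun n => by
      rw [Finset.sum_sub_distrib, sum_of_avg hN]
      simp only [Finset.sum_const, Finset.card_range, nsmul_eq_mul]
      have h3 : avgD δ N n ≤ ⨆ n : ℕ, avgD δ N n := le_ciSup (f := fun n => avgD δ N n)
        ⟨B, by rintro _ ⟨m, rfl⟩; exact (abs_le.mp (bdd_avg hB hN m)).2⟩ n
      have h4 := min_le_right η1 η2
      nlinarith)
  have hw2 := window (x := fun m => δ m - (UU α p - 1 / (2 * α)))
    (K := B + |UU α p - 1 / (2 * α)|) (η := min η1 η2)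
    (fun n => (abs_sub _ _).trans (by gcongr; exact hB n))
    (lt_min (by linarith) (by linarith)) hN (fun n => by
      rw [Finset.sum_sub_distrib, sum_of_avg hN]
      simp only [Finset.sum_const, Finset.card_range, nsmul_eq_mul]
      have h3 : ⨅ n : ℕ, avgD δ N n ≤ avgD δ N n := ciInf_le (f := fun n => avgD δ N n)
        ⟨-B, by rintro _ ⟨m, rfl⟩; exact (abs_le.mp (bdd_avg hB hN m)).1⟩ n
      have h4 := min_le_left η1 η2
      nlinarith)
  set ε := min η1 η2 with hε
  have hε0 : 0 < ε := lt_min (by linarith) (by linarith)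
  set Cw := max ((|UU α p| + B + ε) * N) ((B + |UU α p - 1 / (2 * α)| + ε) * N) with hCw
  obtain ⟨C', hC', hL⟩ := lag_coef (ε := ε) (C := Cw) hα hp.le hinj hn hB hc0 hsep
    (fun r n => (sub_le_sub_left (le_max_left _ _) _).trans (hw1 r n))
    (fun r n => (sub_le_sub_left (le_max_right _ _) _).trans (hw2 r n))
  obtain ⟨C, hC, hF⟩ := fin_est hp.le hinj hε0 hC' hL
  obtain ⟨D, hD, hcol⟩ := colBound (c := 1) one_pos (1 + 2 * α * B)
  obtain ⟨C2, hC2, hD2⟩ := DN_le hα hp.le (hcol _ (uu_bdd hα hn hB))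
  exact ⟨samp_of_fin hp.le hinj hC hF hC2 hD2, int_of_fin hα hp.le hinj hC hF⟩

lemma SN_single {α p : ℝ} (hp : 1 ≤ p) (j : ℕ) :
    SN α p (Pi.single j 1) = ENNReal.ofReal (Wt α p j ^ p) := by
  have hp0 : p ≠ 0 := by linarith
  unfold SN
  rw [tsum_eq_single j]
  · simp
  · intro k hk
    rw [Pi.single_eq_of_ne hk]
    simp [Real.zero_rpow hp0]

lemma rep_single (j : ℕ) : PSRep (Pi.single j 1) (fun z => z ^ j) := by
  intro z
  have := hasSum_single (f := fun k => (Pi.single j 1 : ℕ → ℂ) k * z ^ k) j (by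
    intro k hk; rw [Pi.single_eq_of_ne hk]; simp)
  simpa using this

lemma nec_col {α p : ℝ} (hα : 0 < α) (hp : 1 ≤ p) {γ : ℕ → ℂ} (hS : SampN α p γ) :
    ∃ D : ℝ, 0 < D ∧ ∀ k : ℕ,
      ∑' n, ENNReal.ofReal (Real.exp (-1 * |uu α γ n - k|)) ≤ ENNReal.ofReal D := by
  have hp0 : 0 < p := by linarith
  obtain ⟨C, hC, h⟩ := hS
  obtain ⟨T, hT, hTs⟩ := tsumExp (c := 1) one_pos
  set c0 : ℝ := Real.exp (-(1 / (4 * α))) with hc0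
  have hc0p : 0 < c0 ^ p := by positivity
  set A : ℝ := Real.exp 1 / c0 ^ p with hA
  have hA0 : 0 < A := by positivity
  refine ⟨A * C * T, by positivity, fun k => ?_⟩
  have key : ∀ n, ENNReal.ofReal (Real.exp (-1 * |uu α γ n - k|)) ≤
      ∑' j : ℕ, ENNReal.ofReal (A * Real.exp (-1 * |(k : ℝ) - j|) / Wt α p j ^ p) *
        ENNReal.ofReal ((‖γ n ^ j‖ * Qz α p (γ n)) ^ p) := by
    intro n
    refine le_trans ?_ (ENNReal.le_tsum ⌊uu α γ n⌋₊)
    set j := ⌊uu α γ n⌋₊ with hj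
    have hW := Wt_pos α p j
    have hu := uu_nonneg hα γ n
    have h1 : (j : ℝ) ≤ uu α γ n := Nat.floor_le hu
    have h2 : uu α γ n < j + 1 := Nat.lt_floor_add_one _
    rw [← ENNReal.ofReal_mul (by positivity)]
    refine ENNReal.ofReal_le_ofReal ?_
    have h3 : 1 ≤ ‖γ n‖ ∨ j = 0 := by
      by_contra! hc
      have : lpz (γ n) = 0 := by
        unfold lpz logPlus
        exact max_eq_right (Real.log_nonpos (norm_nonneg _) hc.1.le)
      have : uu α γ n = 0 := by unfold uu; rw [this, mul_zero]
      apply hc.2; rw [hj, this]; simp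
    rw [norm_pow, kb_eq hα hp j (γ n) h3, Real.mul_rpow hW.le (gk_pos _ _ _).le]
    have h4 : c0 ≤ gk α p (2 * α * lpz (γ n) - j) := by
      unfold gk; rw [hc0]
      apply Real.exp_le_exp.mpr
      have hx : 2 * α * lpz (γ n) = uu α γ n := rfl
      rw [hx]
      set s := uu α γ n - j with hs
      have hs0 : 0 ≤ s := by linarith
      have hs1 : s ≤ 1 := by linarith
      have : s ^ 2 ≤ 1 := by nlinarith
      have h5 : s ^ 2 / (4 * α) ≤ 1 / (4 * α) := by gcongr
      have h6 : 0 ≤ s / (p * α) := by positivity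
      rw [neg_div]; linarith
    have h5 : c0 ^ p ≤ gk α p (2 * α * lpz (γ n) - j) ^ p :=
      Real.rpow_le_rpow (by positivity) h4 hp0.le
    have h6 : Real.exp (-1 * |uu α γ n - k|) ≤ Real.exp 1 * Real.exp (-1 * |(k : ℝ) - j|) := by
      rw [← Real.exp_add]
      apply Real.exp_le_exp.mpr
      have : |(k : ℝ) - j| ≤ |uu α γ n - k| + 1 := by
        rw [abs_le]
        have := abs_le.mp (le_refl |uu α γ n - k|)
        constructor <;> linarith
      linarith
    have hWp : 0 < Wt α p j ^ p := by positivity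
    calc _ ≤ Real.exp 1 * Real.exp (-1 * |(k : ℝ) - j|) := h6
      _ = A * Real.exp (-1 * |(k : ℝ) - j|) / Wt α p j ^ p * (Wt α p j ^ p * c0 ^ p) := by
          rw [hA]; field_simp
      _ ≤ _ := by gcongr
  calc _ ≤ ∑' n, ∑' j : ℕ, ENNReal.ofReal (A * Real.exp (-1 * |(k : ℝ) - j|) / Wt α p j ^ p) *
        ENNReal.ofReal ((‖γ n ^ j‖ * Qz α p (γ n)) ^ p) := ENNReal.tsum_le_tsum key
    _ = ∑' j : ℕ, ENNReal.ofReal (A * Real.exp (-1 * |(k : ℝ) - j|) / Wt α p j ^ p) *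
        DN α p γ (fun z => z ^ j) := by
          rw [ENNReal.tsum_comm]; unfold DN; simp_rw [ENNReal.tsum_mul_left]
    _ ≤ ∑' j : ℕ, ENNReal.ofReal (A * C) * ENNReal.ofReal (Real.exp (-1 * |(k : ℝ) - j|)) := by
          refine ENNReal.tsum_le_tsum fun j => ?_
          have hW := Wt_pos α p j
          have := (h _ _ (rep_single j) (by rw [SN_single hp]; exact ENNReal.ofReal_lt_top)).2
          rw [SN_single hp] at this
          refine (mul_le_mul_right this _).trans ?_
          rw [← ENNReal.ofReal_mul hC.le, ← ENNReal.ofReal_mul (by positivity),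
            ← ENNReal.ofReal_mul (by positivity)]
          refine ENNReal.ofReal_le_ofReal (le_of_eq ?_)
          have hWp : 0 < Wt α p j ^ p := by positivity
          field_simp
    _ ≤ _ := by
          rw [ENNReal.tsum_mul_left, ENNReal.ofReal_mul (p := A * C) (by positivity)]
          exact mul_le_mul_right (hTs _) _

lemma SN_ne_zero {α p : ℝ} (hp : 1 ≤ p) {a : ℕ → ℂ} (h : SN α p a = 0) : a = 0 := by
  unfold SN at h
  rw [ENNReal.tsum_eq_zero] at h
  ext k
  have h1 := h k
  have hW := Wt_pos α p k
  have hp0 : p ≠ 0 := by linarith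
  rw [ENNReal.ofReal_eq_zero] at h1
  by_contra hc
  have : 0 < ‖a k‖ := norm_pos_iff.mpr hc
  have : 0 < (‖a k‖ * Wt α p k) ^ p := by positivity
  linarith

/-- uniform gap contradiction -/
lemma nec_gap {α p : ℝ} (hα : 0 < α) (hp : 1 ≤ p) {γ : ℕ → ℂ} (hS : SampN α p γ) :
    ∃ R : ℝ, 0 < R ∧ ∀ a f, PSRep a f → SN α p a < ⊤ →
      (∀ n k : ℕ, f (γ n) ≠ 0 → a k ≠ 0 → R ≤ |uu α γ n - k|) → a = 0 := by
  have hp0 : 0 < p := by linarith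
  obtain ⟨D, hD, hcol⟩ := nec_col hα hp hS
  obtain ⟨C1, hC1, h1⟩ := DN_le_R hα hp hcol
  obtain ⟨C, hC, h⟩ := hS
  refine ⟨C * C1 + 1, by positivity, fun a f hf hfin hR => ?_⟩
  by_contra hne
  have h2 := h1 _ a f hf hR
  have h3 := (h a f hf hfin).1
  have h4 := h3.trans (mul_le_mul_right h2 _)
  rw [← mul_assoc, ← ENNReal.ofReal_mul hC.le] at h4
  have h0 : SN α p a ≠ 0 := fun hz => hne (SN_ne_zero hp hz)
  have h5 : C * (C1 * Real.exp (-(C * C1 + 1)) ^ p) < 1 := by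
    have hx : 0 < C * C1 := by positivity
    have : Real.exp (-(C * C1 + 1)) ^ p ≤ Real.exp (-(C * C1 + 1)) := by
      rw [← Real.exp_mul]; apply Real.exp_le_exp.mpr; nlinarith
    calc _ = C * C1 * Real.exp (-(C * C1 + 1)) ^ p := by ring
      _ ≤ C * C1 * Real.exp (-(C * C1 + 1)) := by gcongr
      _ < 1 := by
        rw [Real.exp_neg, ← div_eq_mul_inv, div_lt_one (Real.exp_pos _)]
        have := Real.add_one_le_exp (C * C1 + 1)
        linarith
  have h6 : ENNReal.ofReal (C * (C1 * Real.exp (-(C * C1 + 1)) ^ p)) * SN α p a < 1 * SN α p a := by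
    refine ENNReal.mul_lt_mul_left h0 hfin.ne ?_
    rw [← ENNReal.ofReal_one]
    exact (ENNReal.ofReal_lt_ofReal_iff one_pos).mpr h5
  rw [one_mul] at h6
  exact absurd h4 (not_le.mpr h6)

lemma SN_finite_supp {α p : ℝ} (hp : 1 ≤ p) (a : ℕ → ℂ) (M : ℕ) (h : ∀ k, M ≤ k → a k = 0) :
    SN α p a < ⊤ := by
  have hp0 : p ≠ 0 := by linarith
  unfold SN
  rw [tsum_eq_sum (s := Finset.range M)]
  · exact ENNReal.sum_lt_top.mpr fun _ _ => ENNReal.ofReal_lt_top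
  · intro k hk
    rw [h k (by simpa using hk)]
    simp [Real.zero_rpow hp0]

lemma SN_add {α p : ℝ} (hp : 1 ≤ p) (a b : ℕ → ℂ) (ha : SN α p a < ⊤) (hb : SN α p b < ⊤) :
    SN α p (fun k => a k + b k) < ⊤ := by
  have hp0 : 0 < p := by linarith
  have : SN α p (fun k => a k + b k) ≤ 2 ^ (p - 1) * (SN α p a + SN α p b) := by
    unfold SN
    simp_rw [SN_term hp]
    rw [← ENNReal.tsum_add, ← ENNReal.tsum_mul_left]
    refine ENNReal.tsum_le_tsum fun k => ?_
    have hW := Wt_pos α p k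
    refine le_trans ?_ (ENNReal.rpow_add_le_mul_rpow_add_rpow _ _ hp)
    rw [← ENNReal.ofReal_rpow_of_nonneg (by positivity) hp0.le]
    refine ENNReal.rpow_le_rpow ?_ hp0.le
    rw [← ENNReal.ofReal_add (by positivity) (by positivity), ← add_mul]
    refine ENNReal.ofReal_le_ofReal ?_
    gcongr
    exact norm_add_le _ _
  refine this.trans_lt (ENNReal.mul_lt_top ?_ (ENNReal.add_lt_top.mpr ⟨ha, hb⟩))
  exact ENNReal.rpow_lt_top_of_nonneg (by linarith) (by norm_num)

lemma SN_smul {α p : ℝ} (c : ℂ) (a : ℕ → ℂ) :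
    SN α p (fun k => c * a k) = ENNReal.ofReal (‖c‖ ^ p) * SN α p a := by
  unfold SN
  rw [← ENNReal.tsum_mul_left]
  refine tsum_congr fun k => ?_
  have hW := Wt_pos α p k
  rw [← ENNReal.ofReal_mul (by positivity), norm_mul, mul_assoc,
    Real.mul_rpow (norm_nonneg _) (by positivity)]

lemma SN_sum {α p : ℝ} (hp : 1 ≤ p) (s : Finset ℕ) (a : ℕ → ℕ → ℂ) (c : ℕ → ℂ)
    (h : ∀ i ∈ s, SN α p (a i) < ⊤) : SN α p (fun k => ∑ i ∈ s, c i * a i k) < ⊤ := by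
  classical
  induction s using Finset.induction_on with
  | empty =>
    refine SN_finite_supp hp _ 0 (by simp)
  | insert i s hi ih =>
    simp_rw [Finset.sum_insert hi]
    refine SN_add hp _ _ ?_ (ih fun j hj => h j (Finset.mem_insert_of_mem hj))
    rw [SN_smul]
    exact ENNReal.mul_lt_top ENNReal.ofReal_lt_top (h i (Finset.mem_insert_self _ _))

/-- delta interpolants -/
lemma IntN.delta {α p : ℝ} (hp : 1 ≤ p) {γ : ℕ → ℂ} (hI : IntN α p γ) (v : ℕ → ℂ) (m : ℕ) :
    ∃ a f, PSRep a f ∧ SN α p a < ⊤ ∧ ∀ n, f (γ n) = if n = m then v m else 0 := by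
  have hp0 : p ≠ 0 := by linarith
  obtain ⟨a, f, h⟩ := hI (fun n => if n = m then v m else 0) (by
    rw [tsum_eq_single m]
    · exact ENNReal.ofReal_lt_top
    · intro k hk; simp [hk, Real.zero_rpow hp0])
  exact ⟨a, f, h⟩

lemma uu_mono {α : ℝ} (hα : 0 < α) {γ : ℕ → ℂ} (hm : Monotone fun n => ‖γ n‖)
    (hne : ∀ n, γ n ≠ 0) : Monotone (uu α γ) := by
  intro m n h
  unfold uu lpz logPlus
  have := Real.log_le_log (norm_pos_iff.mpr (hne m)) (hm h)
  gcongr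

lemma nec_uu {α p : ℝ} (hα : 0 < α) (hp : 1 ≤ p) {γ : ℕ → ℂ} (hm : Monotone fun n => ‖γ n‖)
    (hne : ∀ n, γ n ≠ 0) (hS : SampN α p γ) (hI : IntN α p γ) :
    ∃ R : ℝ, 0 < R ∧ ∀ n : ℕ, |uu α γ n - n| ≤ R := by
  obtain ⟨R, hR, h⟩ := nec_gap hα hp hS
  have hu := uu_mono hα hm hne
  refine ⟨R, hR, fun n => ?_⟩
  rw [abs_le]
  constructor
  · by_contra! hc
    choose A F hA hA2 hF using fun m => hI.delta hp (fun _ => 1) m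
    obtain ⟨v, hv, hv0⟩ : ∃ v : Fin (n + 1) → ℂ, v ≠ 0 ∧
        ∀ k : Fin n, ∑ i : Fin (n + 1), v i * A i k = 0 := by
      let T : (Fin (n + 1) → ℂ) →ₗ[ℂ] (Fin n → ℂ) :=
        { toFun := fun v k => ∑ i : Fin (n + 1), v i * A i k
          map_add' := by intro v w; ext k; simp [add_mul, Finset.sum_add_distrib]
          map_smul' := by intro c v; ext k; simp [Finset.mul_sum, mul_assoc] }
      have hk : LinearMap.ker T ≠ ⊥ := LinearMap.ker_ne_bot_of_finrank_lt (by simp)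
      obtain ⟨v, hv, hv0⟩ := (Submodule.ne_bot_iff _).mp hk
      refine ⟨v, hv0, fun k => ?_⟩
      have : T v = 0 := hv
      exact congrFun this k
    set w : ℕ → ℂ := fun i => if h : i < n + 1 then v ⟨i, h⟩ else 0 with hw
    have hsum : ∀ g : ℕ → ℂ, ∑ i ∈ Finset.range (n + 1), w i * g i = ∑ i : Fin (n + 1), v i * g i := by
      intro g
      rw [Finset.sum_range]
      refine Finset.sum_congr rfl fun i _ => ?_
      simp only [hw, dif_pos i.2, Fin.eta]
    have hrep := PSRep.sum (Finset.range (n + 1)) (a := A) (f := F) (fun i _ => hA i) w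
    have hfin := SN_sum (α := α) (p := p) hp (Finset.range (n + 1)) A w (fun i _ => hA2 i)
    have hval : ∀ m, ∑ i ∈ Finset.range (n + 1), w i * F i (γ m) = w m := by
      intro m
      simp_rw [hF]
      simp only [mul_ite, mul_one, mul_zero, Finset.sum_ite_eq, Finset.mem_range]
      split_ifs with hmn
      · rfl
      · simp only [hw, dif_neg hmn]
    have hz := h _ _ hrep hfin (by
      intro m k hm' hk
      change ∑ i ∈ Finset.range (n + 1), w i * F i (γ m) ≠ 0 at hm'
      rw [hval m] at hm'
      have hmn : m < n + 1 := by by_contra hc'; exact hm' (by simp only [hw, dif_neg hc'])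
      have hkn : n ≤ k := by
        by_contra! hc'
        exact hk (by rw [hsum (fun i => A i k)]; exact hv0 ⟨k, hc'⟩)
      have h1 := hu (Nat.lt_succ_iff.mp hmn)
      have h2 : (n : ℝ) ≤ k := by exact_mod_cast hkn
      rw [abs_sub_comm]
      refine le_trans ?_ (le_abs_self _)
      linarith)
    apply hv
    ext i
    have h3 := hval i
    have h4 := hrep (γ i)
    simp only at h4
    rw [h3] at h4
    have h5 : HasSum (fun k => (∑ i ∈ Finset.range (n + 1), w i * A i k) * γ i ^ k) 0 := by
      have : ∀ k, ∑ i ∈ Finset.range (n + 1), w i * A i k = 0 := fun k => congrFun hz k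
      simp [this, hasSum_zero]
    have := h4.unique h5
    simpa only [hw, dif_pos i.2, Fin.eta, Pi.zero_apply] using this
  · by_contra! hc
    set P : Polynomial ℂ := ∏ m ∈ Finset.range n, (Polynomial.X - Polynomial.C (γ m)) with hP
    have hmon : P.Monic := Polynomial.monic_prod_of_monic _ _ fun m _ => Polynomial.monic_X_sub_C _
    have hdeg : P.natDegree = n := by
      rw [hP, Polynomial.natDegree_prod_of_monic _ _ fun m _ => Polynomial.monic_X_sub_C _]
      simp
    have hz := h _ _ (rep_poly P) (SN_finite_supp hp _ (n + 1) fun k hk =>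
      Polynomial.coeff_eq_zero_of_natDegree_lt (by omega)) (by
      intro m k hm' hk
      have hmn : n ≤ m := by
        by_contra! hc'
        apply hm'
        rw [hP, Polynomial.eval_prod]
        exact Finset.prod_eq_zero (Finset.mem_range.mpr hc') (by simp)
      have hkn : k ≤ n := by
        by_contra! hc'
        exact hk (Polynomial.coeff_eq_zero_of_natDegree_lt (by omega))
      have h1 := hu hmn
      have h2 : (k : ℝ) ≤ n := by exact_mod_cast hkn
      refine le_trans ?_ (le_abs_self _)
      linarith)
    have h1 : P.coeff n = 1 := by rw [← hdeg]; exact hmon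
    rw [hz] at h1
    simp at h1

lemma nec_bdd {α p : ℝ} (hα : 0 < α) (hp : 1 ≤ p) {γ : ℕ → ℂ} {δ : ℕ → ℝ}
    (hn : ∀ n, ‖γ n‖ = Real.exp (tt α δ n)) (hm : Monotone fun n => ‖γ n‖)
    (hne : ∀ n, γ n ≠ 0) (hS : SampN α p γ) (hI : IntN α p γ) :
    ∃ B : ℝ, ∀ n : ℕ, |δ n| ≤ B := by
  obtain ⟨R, hR, h⟩ := nec_uu hα hp hm hne hS hI
  have hb : ∀ n : ℕ, |δ n| ≤ (∑ j ∈ Finset.range (⌊R⌋₊ + 1), |δ j|) + (R + 1) / (2 * α) := by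
    intro n
    have hs0 : 0 ≤ ∑ j ∈ Finset.range (⌊R⌋₊ + 1), |δ j| := Finset.sum_nonneg fun _ _ => abs_nonneg _
    have hs1 : 0 ≤ (R + 1) / (2 * α) := by positivity
    by_cases hc : n < ⌊R⌋₊ + 1
    · have := Finset.single_le_sum (f := fun j => |δ j|) (fun j _ => abs_nonneg _) (Finset.mem_range.mpr hc)
      linarith
    · have hnR : R < n := by
        have := Nat.lt_of_floor_lt (n := n) (a := R) (by omega)
        exact this
      have h1 := h n
      have hpos : 0 < lpz (γ n) := by
        by_contra! hc'
        have h0 : lpz (γ n) = 0 := le_antisymm hc' (lpz_nonneg _)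
        unfold uu at h1
        rw [h0, mul_zero, zero_sub, abs_neg, abs_of_nonneg (Nat.cast_nonneg n)] at h1
        linarith
      have h2 : lpz (γ n) = tt α δ n := by
        rw [lpz_eq hn] at hpos ⊢
        rcases le_total (tt α δ n) 0 with h3 | h3
        · rw [max_eq_right h3] at hpos; exact absurd hpos (lt_irrefl _)
        · exact max_eq_left h3
      have h3 : uu α γ n - n = 1 + 2 * α * δ n := by
        unfold uu; rw [h2]; unfold tt; field_simp; ring
      rw [h3] at h1
      have h4 : |δ n| * (2 * α) ≤ R + 1 := by
        have : |2 * α * δ n| ≤ R + 1 := by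
          have := abs_le.mp h1
          rw [abs_le]; constructor <;> linarith
        rw [abs_mul, abs_of_pos (by positivity : 0 < 2 * α)] at this
        linarith
      rw [← le_div_iff₀ (by positivity)] at h4
      linarith
  exact ⟨_, hb⟩

lemma exp_diff {ε : ℝ} (hε : 0 < ε) (hε1 : ε ≤ 1) (x y c : ℝ) :
    |Real.exp (-ε * |x - c|) - Real.exp (-ε * |y - c|)| ≤
      Real.exp (-ε * |x - c|) * (ε * Real.exp (2 * |y - x|)) := by
  set r := |y - x| with hr
  have hr0 : 0 ≤ r := abs_nonneg _
  have h1 : Real.exp (-ε * |y - c|) = Real.exp (-ε * |x - c|) * Real.exp (ε * (|x - c| - |y - c|)) := by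
    rw [← Real.exp_add]; congr 1; ring
  set s := ε * (|x - c| - |y - c|) with hs
  have hsr : |s| ≤ ε * r := by
    rw [hs, abs_mul, abs_of_pos hε]
    gcongr
    refine (abs_abs_sub_abs_le_abs_sub _ _).trans ?_
    rw [hr, abs_sub_comm]; simp
  have h2 : |1 - Real.exp s| ≤ ε * Real.exp (2 * r) := by
    have hs' := abs_le.mp hsr
    have e1 : 1 - ε * r ≤ Real.exp s := by
      have := Real.add_one_le_exp s; linarith
    have e2 : Real.exp s ≤ 1 + ε * r * Real.exp r := by
      have h3 : Real.exp s ≤ Real.exp (ε * r) := Real.exp_le_exp.mpr hs'.2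
      have h4 := Real.add_one_le_exp (-(ε * r))
      have h5 : Real.exp (-(ε * r)) * Real.exp (ε * r) = 1 := by rw [← Real.exp_add]; simp
      have h6 : Real.exp (ε * r) ≤ Real.exp r := Real.exp_le_exp.mpr (by nlinarith)
      have h7 := Real.exp_pos (ε * r)
      have h8 : ε * r * Real.exp (ε * r) ≤ ε * r * Real.exp r := by gcongr
      nlinarith
    have e3 : r ≤ Real.exp r := by have := Real.add_one_le_exp r; linarith
    have e4 : Real.exp (2 * r) = Real.exp r * Real.exp r := by rw [← Real.exp_add]; congr 1; ring
    have e5 : 1 ≤ Real.exp r := Real.one_le_exp hr0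
    have e6 : ε * r * Real.exp r ≤ ε * Real.exp (2 * r) := by
      rw [e4, mul_assoc]; gcongr
    have e7 : ε * r ≤ ε * r * Real.exp r := le_mul_of_one_le_right (by positivity) e5
    rw [abs_le]; constructor <;> linarith
  rw [h1]
  have : Real.exp (-ε * |x - c|) - Real.exp (-ε * |x - c|) * Real.exp s =
      Real.exp (-ε * |x - c|) * (1 - Real.exp s) := by ring
  rw [this, abs_mul, abs_of_pos (Real.exp_pos _)]
  gcongr

lemma combes {α p : ℝ} (hα : 0 < α) (hp : 1 ≤ p) {γ : ℕ → ℂ} (hS : SampN α p γ)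
    {R0 : ℝ} (hR : ∀ n : ℕ, |uu α γ n - n| ≤ R0) :
    ∃ ε : ℝ, 0 < ε ∧ ε ≤ 1 ∧ ∃ C : ℝ, 0 < C ∧ ∀ a f, PSRep a f → SN α p a < ⊤ → ∀ (k0 : ℕ) (S : ℝ),
      0 ≤ S → ∑' n : ℕ, ENNReal.ofReal
        ((Real.exp (-ε * |(n : ℝ) - k0|) * (‖f (γ n)‖ * Qz α p (γ n))) ^ p) ≤ ENNReal.ofReal (S ^ p) →
      ‖a k0‖ * Wt α p k0 ≤ C * S := by
  have hp0 : 0 < p := by linarith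
  obtain ⟨D, hD, hcol⟩ := nec_col hα hp hS
  obtain ⟨C, hC, hs⟩ := hS
  obtain ⟨C3, hC3, hg⟩ := gk_decay hα hp (b := 3) (by norm_num)
  obtain ⟨C5, hC5, hSch⟩ := schurU hp (c := 1) one_pos (uu α γ) D hcol
  set C4 : ℝ := C3 * Real.exp (2 * R0) with hC4
  have hC40 : 0 < C4 := by positivity
  set K : ℝ := C * 2 ^ (p - 1) * (C5 * C4 ^ p) with hK
  have hK0 : 0 < K := by positivity
  set ε : ℝ := min 1 (1 / (2 * K)) with hε
  have hε0 : 0 < ε := lt_min one_pos (by positivity)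
  have hε1 : ε ≤ 1 := min_le_left _ _
  have hεK : K * ε ^ p ≤ 1 / 2 := by
    have h1 : ε ^ p ≤ ε := by
      simpa using Real.rpow_le_rpow_of_exponent_ge hε0 hε1 hp
    have h2 : ε ≤ 1 / (2 * K) := min_le_right _ _
    calc K * ε ^ p ≤ K * (1 / (2 * K)) := by gcongr; exact h1.trans h2
      _ = 1 / 2 := by field_simp
  set C6 : ℝ := 2 * (C * 2 ^ (p - 1)) with hC6
  have hC60 : 0 < C6 := by positivity
  refine ⟨ε, hε0, hε1, C6 ^ (1 / p), by positivity, fun a f hf hfin k0 S hS0 hsum => ?_⟩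
  set Dk : ℕ → ℝ := fun k => Real.exp (-ε * |(k : ℝ) - k0|) with hDk
  have hDk0 : ∀ k, 0 < Dk k := fun k => Real.exp_pos _
  have hDk1 : ∀ k, Dk k ≤ 1 := fun k => by
    rw [hDk]; simp only
    rw [Real.exp_le_one_iff]
    have := abs_nonneg ((k : ℝ) - k0)
    nlinarith
  set b : ℕ → ℂ := fun k => (Dk k : ℂ) * a k with hb
  have hbn : ∀ k, ‖b k‖ = Dk k * ‖a k‖ := fun k => by
    rw [hb]; simp only [norm_mul, Complex.norm_real, Real.norm_eq_abs, abs_of_pos (hDk0 k)]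
  have hbfin : SN α p b < ⊤ := by
    refine lt_of_le_of_lt ?_ hfin
    unfold SN
    refine ENNReal.tsum_le_tsum fun k => ENNReal.ofReal_le_ofReal ?_
    have hW := Wt_pos α p k
    rw [hbn]
    have : Dk k * ‖a k‖ ≤ ‖a k‖ := mul_le_of_le_one_left (norm_nonneg _) (hDk1 k)
    have := hDk0 k
    gcongr
  have hrep := exists_rep_of_SN hα hp b hbfin
  set F : ℂ → ℂ := fun z => ∑' k, b k * z ^ k with hF
  have h1 := (hs b F hrep hbfin).1
  -- pointwise
  have hpt : ∀ n, ENNReal.ofReal (‖F (γ n)‖ * Qz α p (γ n)) ≤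
      ENNReal.ofReal (Dk n * (‖f (γ n)‖ * Qz α p (γ n))) +
      ∑' k : ℕ, ENNReal.ofReal (ε * C4 * Real.exp (-1 * |uu α γ n - k|)) *
        ENNReal.ofReal (‖b k‖ * Wt α p k) := by
    intro n
    have hQ := Qz_pos α p (γ n)
    have hr2 : PSRep (fun k => b k - (Dk n : ℂ) * a k) (fun z => F z - (Dk n : ℂ) * f z) := by
      intro z
      have := (hrep z).sub ((hf z).mul_left (Dk n : ℂ))
      have e : (fun k => (b k - (Dk n : ℂ) * a k) * z ^ k) =
          fun k => b k * z ^ k - (Dk n : ℂ) * (a k * z ^ k) := by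
        ext k; ring
      rw [e]; exact this
    have h2 := pointEval hα hp hr2 (γ n)
    have h3 : ‖F (γ n)‖ * Qz α p (γ n) ≤ Dk n * (‖f (γ n)‖ * Qz α p (γ n)) +
        ‖F (γ n) - (Dk n : ℂ) * f (γ n)‖ * Qz α p (γ n) := by
      have : ‖F (γ n)‖ ≤ Dk n * ‖f (γ n)‖ + ‖F (γ n) - (Dk n : ℂ) * f (γ n)‖ := by
        calc ‖F (γ n)‖ = ‖(Dk n : ℂ) * f (γ n) + (F (γ n) - (Dk n : ℂ) * f (γ n))‖ := by congr 1; ring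
          _ ≤ _ := norm_add_le _ _
          _ = _ := by rw [norm_mul, Complex.norm_real, Real.norm_eq_abs, abs_of_pos (hDk0 n)]
      calc _ ≤ (Dk n * ‖f (γ n)‖ + ‖F (γ n) - (Dk n : ℂ) * f (γ n)‖) * Qz α p (γ n) := by gcongr
        _ = _ := by ring
    refine (ENNReal.ofReal_le_ofReal h3).trans ?_
    have hd := hDk0 n
    rw [ENNReal.ofReal_add (by positivity) (by positivity)]
    gcongr
    refine h2.trans (ENNReal.tsum_le_tsum fun k => ?_)
    have hW := Wt_pos α p k
    rw [← ENNReal.ofReal_mul (gk_pos _ _ _).le, ← ENNReal.ofReal_mul (by positivity)]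
    refine ENNReal.ofReal_le_ofReal ?_
    have h4 : ‖b k - (Dk n : ℂ) * a k‖ ≤ ‖b k‖ * (ε * Real.exp (2 * |(n : ℝ) - k|)) := by
      rw [hbn]
      have e : b k - (Dk n : ℂ) * a k = ((Dk k - Dk n : ℝ) : ℂ) * a k := by
        rw [hb]; push_cast; ring
      rw [e, norm_mul, Complex.norm_real, Real.norm_eq_abs]
      have := exp_diff hε0 hε1 (k : ℝ) n k0
      calc _ ≤ Dk k * (ε * Real.exp (2 * |(n : ℝ) - k|)) * ‖a k‖ := by
            gcongr
        _ = _ := by ring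
    have h5 : gk α p (2 * α * lpz (γ n) - k) ≤ C3 * Real.exp (-3 * |uu α γ n - k|) := hg _
    have h6 : Real.exp (-3 * |uu α γ n - k|) * Real.exp (2 * |(n : ℝ) - k|) ≤
        Real.exp (2 * R0) * Real.exp (-1 * |uu α γ n - k|) := by
      rw [← Real.exp_add, ← Real.exp_add]
      apply Real.exp_le_exp.mpr
      have : |(n : ℝ) - k| ≤ |uu α γ n - k| + R0 := by
        have h7 := abs_sub_le (n : ℝ) (uu α γ n) k
        have h8 := hR n
        rw [abs_sub_comm] at h8
        linarith
      linarith
    calc _ ≤ C3 * Real.exp (-3 * |uu α γ n - k|) *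
          (‖b k‖ * (ε * Real.exp (2 * |(n : ℝ) - k|)) * Wt α p k) := by
            gcongr
      _ = C3 * ε * ‖b k‖ * Wt α p k *
          (Real.exp (-3 * |uu α γ n - k|) * Real.exp (2 * |(n : ℝ) - k|)) := by ring
      _ ≤ C3 * ε * ‖b k‖ * Wt α p k * (Real.exp (2 * R0) * Real.exp (-1 * |uu α γ n - k|)) := by
            gcongr
      _ = _ := by rw [hC4]; ring
  have h7 := hSch (ε * C4) (by positivity) (fun k => ENNReal.ofReal (‖b k‖ * Wt α p k))
  have h8 : DN α p γ F ≤ ENNReal.ofReal (2 ^ (p - 1)) * (ENNReal.ofReal (S ^ p) +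
      ENNReal.ofReal (C5 * (ε * C4) ^ p) * SN α p b) := by
    have e1 : SN α p b = ∑' k, ENNReal.ofReal (‖b k‖ * Wt α p k) ^ p := by
      unfold SN; simp_rw [SN_term hp]
    rw [e1]
    refine le_trans ?_ (mul_le_mul_right (add_le_add hsum h7) _)
    rw [← ENNReal.tsum_add, ← ENNReal.tsum_mul_left]
    unfold DN
    refine ENNReal.tsum_le_tsum fun n => ?_
    have hQ := Qz_pos α p (γ n)
    rw [← ENNReal.ofReal_rpow_of_nonneg (by positivity) hp0.le,
      ← ENNReal.ofReal_rpow_of_nonneg (x := Real.exp (-ε * |(n : ℝ) - k0|) * (‖f (γ n)‖ * Qz α p (γ n)))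
        (by positivity) hp0.le]
    have e2 : ENNReal.ofReal ((2 : ℝ) ^ (p - 1)) = 2 ^ (p - 1) := by
      rw [← ENNReal.ofReal_rpow_of_pos (by norm_num)]; norm_num
    rw [e2]
    refine le_trans ?_ (ENNReal.rpow_add_le_mul_rpow_add_rpow _ _ hp)
    exact ENNReal.rpow_le_rpow (hpt n) hp0.le
  -- absorb
  obtain ⟨x, hx0, hx⟩ : ∃ x : ℝ, 0 ≤ x ∧ SN α p b = ENNReal.ofReal x :=
    ⟨(SN α p b).toReal, ENNReal.toReal_nonneg, (ENNReal.ofReal_toReal hbfin.ne).symm⟩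
  have h9 := h1.trans (mul_le_mul_right h8 _)
  have hSp : 0 ≤ S ^ p := by positivity
  rw [hx, ← ENNReal.ofReal_mul (by positivity), ← ENNReal.ofReal_add (by positivity) (by positivity),
    ← ENNReal.ofReal_mul (by positivity), ← ENNReal.ofReal_mul (by positivity),
    ENNReal.ofReal_le_ofReal_iff (by positivity), Real.mul_rpow hε0.le hC40.le] at h9
  have h10 : x ≤ C6 * S ^ p := by
    have : C * (2 ^ (p - 1) * (S ^ p + C5 * (ε ^ p * C4 ^ p) * x)) =
        C * 2 ^ (p - 1) * S ^ p + (K * ε ^ p) * x := by rw [hK]; ring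
    rw [this] at h9
    have := mul_le_mul_of_nonneg_right hεK hx0
    rw [hC6]; linarith
  have h11 : ‖b k0‖ * Wt α p k0 ≤ C6 ^ (1 / p) * S := by
    refine coef_le_of_SN hp b (by positivity) ?_ k0
    rw [hx, Real.mul_rpow (by positivity) hS0, ← Real.rpow_mul hC60.le, one_div_mul_cancel hp0.ne',
      Real.rpow_one]
    exact ENNReal.ofReal_le_ofReal h10
  rw [hbn] at h11
  have : Dk k0 = 1 := by rw [hDk]; simp
  rwa [this, one_mul] at h11

lemma zpow_diff {ζ : ℂ} (h : ‖1 - ζ‖ ≤ 1 / 2) (n k : ℕ) :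
    ‖1 - ζ ^ k / ζ ^ n‖ ≤ 2 * Real.exp |(n : ℝ) - k| * ‖1 - ζ‖ := by
  have base : ∀ w : ℂ, ‖w‖ ≤ 2 → ∀ j : ℕ, ‖1 - w ^ j‖ ≤ 2 ^ j * ‖1 - w‖ := by
    intro w hw j
    induction j with
    | zero => simp
    | succ j ih =>
      have e : 1 - w ^ (j + 1) = (1 - w ^ j) + w ^ j * (1 - w) := by ring
      rw [e]
      refine (norm_add_le _ _).trans ?_
      rw [norm_mul, norm_pow, pow_succ]
      have : ‖w‖ ^ j ≤ 2 ^ j := by gcongr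
      have h2 := mul_le_mul_of_nonneg_right this (norm_nonneg (1 - w))
      linarith
  have h2e : ∀ j : ℕ, (2 : ℝ) ^ j ≤ Real.exp j := by
    intro j
    have : (2 : ℝ) ≤ Real.exp 1 := by have := Real.add_one_le_exp (1 : ℝ); linarith
    calc (2 : ℝ) ^ j ≤ Real.exp 1 ^ j := by gcongr
      _ = _ := by rw [← Real.exp_nat_mul, mul_one]
  have hz1 : 1 / 2 ≤ ‖ζ‖ := by
    have := norm_sub_norm_le (1 : ℂ) (1 - ζ)
    simp only [norm_one, sub_sub_cancel] at this
    linarith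
  have hz2 : ‖ζ‖ ≤ 2 := by
    have := norm_sub_norm_le ζ 1
    rw [norm_sub_rev, norm_one] at this
    linarith
  have hz0 : ζ ≠ 0 := by intro h0; rw [h0, norm_zero] at hz1; norm_num at hz1
  have hnn := norm_nonneg (1 - ζ)
  rcases le_total n k with hnk | hnk
  · have e : ζ ^ k / ζ ^ n = ζ ^ (k - n) := by rw [pow_sub₀ _ hz0 hnk, div_eq_mul_inv]
    have e2 : |(n : ℝ) - k| = ((k - n : ℕ) : ℝ) := by
      rw [Nat.cast_sub hnk, abs_sub_comm, abs_of_nonneg]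
      have : (n : ℝ) ≤ k := by exact_mod_cast hnk
      linarith
    rw [e, e2]
    refine (base ζ hz2 _).trans ?_
    have := h2e (k - n)
    have h3 := Real.exp_pos ((k - n : ℕ) : ℝ)
    gcongr
    linarith
  · have e : ζ ^ k / ζ ^ n = ζ⁻¹ ^ (n - k) := by
      rw [inv_pow, pow_sub₀ _ hz0 hnk]; field_simp
    have e2 : |(n : ℝ) - k| = ((n - k : ℕ) : ℝ) := by
      rw [Nat.cast_sub hnk, abs_of_nonneg]
      have : (k : ℝ) ≤ n := by exact_mod_cast hnk
      linarith
    rw [e, e2]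
    have hi : ‖ζ⁻¹‖ ≤ 2 := by
      rw [norm_inv]
      calc ‖ζ‖⁻¹ ≤ (1 / 2)⁻¹ := by gcongr
        _ = 2 := by norm_num
    have h4 : ‖1 - ζ⁻¹‖ ≤ 2 * ‖1 - ζ‖ := by
      have : 1 - ζ⁻¹ = -(ζ⁻¹ * (1 - ζ)) := by field_simp; ring
      rw [this, norm_neg, norm_mul]; gcongr
    refine (base ζ⁻¹ hi _).trans ?_
    calc _ ≤ Real.exp ((n - k : ℕ) : ℝ) * (2 * ‖1 - ζ‖) := by
          gcongr; exact h2e _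
      _ = _ := by ring

/-- normalized delta interpolants with exponentially decaying coefficients -/
lemma nec_delta {α p : ℝ} (hp : 1 ≤ p) {γ : ℕ → ℂ} (hI : IntN α p γ) {ε C : ℝ} (hε : 0 < ε)
    (hct : ∀ a f, PSRep a f → SN α p a < ⊤ → ∀ (k0 : ℕ) (S : ℝ),
      0 ≤ S → ∑' n : ℕ, ENNReal.ofReal
        ((Real.exp (-ε * |(n : ℝ) - k0|) * (‖f (γ n)‖ * Qz α p (γ n))) ^ p) ≤ ENNReal.ofReal (S ^ p) →
      ‖a k0‖ * Wt α p k0 ≤ C * S) (n : ℕ) :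
    ∃ a f, PSRep a f ∧ (∀ k : ℕ, ‖a k‖ * Wt α p k ≤ C * Real.exp (-ε * |(n : ℝ) - k|)) ∧
      (∀ m, m ≠ n → f (γ m) = 0) ∧ ‖f (γ n)‖ * Qz α p (γ n) = 1 := by
  have hp0 : p ≠ 0 := by linarith
  obtain ⟨a, f, hf, hfin, hv⟩ := hI.delta hp (fun m => ((Qz α p (γ m))⁻¹ : ℝ)) n
  have hQ := Qz_pos α p (γ n)
  have h1 : ‖f (γ n)‖ * Qz α p (γ n) = 1 := by
    rw [hv, if_pos rfl, Complex.norm_real, Real.norm_eq_abs, abs_of_pos (by positivity)]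
    field_simp
  refine ⟨a, f, hf, fun k => ?_, fun m hm => by rw [hv, if_neg hm], h1⟩
  refine hct a f hf hfin k _ (Real.exp_pos _).le ?_
  rw [tsum_eq_single n]
  · rw [h1, mul_one]
  · intro m hm
    rw [hv, if_neg hm]; simp [Real.zero_rpow hp0]

lemma nec_sep {α p : ℝ} (hα : 0 < α) (hp : 1 ≤ p) {γ : ℕ → ℂ} (hI : IntN α p γ) {ε C : ℝ}
    (hε : 0 < ε) (hC : 0 < C)
    (hct : ∀ a f, PSRep a f → SN α p a < ⊤ → ∀ (k0 : ℕ) (S : ℝ),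
      0 ≤ S → ∑' n : ℕ, ENNReal.ofReal
        ((Real.exp (-ε * |(n : ℝ) - k0|) * (‖f (γ n)‖ * Qz α p (γ n))) ^ p) ≤ ENNReal.ofReal (S ^ p) →
      ‖a k0‖ * Wt α p k0 ≤ C * S)
    {R0 : ℝ} (hR : ∀ n : ℕ, |uu α γ n - n| ≤ R0)
    (hne : ∀ n, γ n ≠ 0) (hm : Monotone fun n => ‖γ n‖) :
    DRhoSeparated α (Set.range γ) := by
  obtain ⟨C3, hC3, hg⟩ := gk_decay hα hp (b := 2) (by norm_num)
  obtain ⟨T, hT, hTs⟩ := tsumExp (c := 1) one_pos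
  set K := C3 * C * 2 * Real.exp R0 * T with hK
  have hK0 : 0 < K := by positivity
  set c := min (1 / 2) (1 / K) with hc
  have hc0 : 0 < c := lt_min (by norm_num) (by positivity)
  have key : ∀ n m, m ≠ n → c * ‖γ n‖ ≤ ‖γ n - γ m‖ := by
    intro n m hmn
    set ζ := γ m / γ n with hζ
    have hγ := norm_pos_iff.mpr (hne n)
    have e : ‖γ n - γ m‖ = ‖1 - ζ‖ * ‖γ n‖ := by
      rw [← norm_mul, hζ, sub_mul, one_mul, div_mul_cancel₀ _ (hne n)]
    rw [e]
    gcongr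
    rcases le_or_gt (1 / 2) ‖1 - ζ‖ with h | h
    · exact (min_le_left _ _).trans h
    refine (min_le_right _ _).trans ?_
    have hz0 : ζ ≠ 0 := div_ne_zero (hne m) (hne n)
    obtain ⟨a, f, hf, hX, hzero, hone⟩ := nec_delta hp hI hε hct n
    have hr : PSRep (fun k => a k * (1 - ζ ^ k / ζ ^ n)) (fun z => f z - (ζ ^ n)⁻¹ * f (ζ * z)) := by
      intro z
      have := (hf z).sub ((hf (ζ * z)).mul_left (ζ ^ n)⁻¹)
      have e : (fun k => a k * (1 - ζ ^ k / ζ ^ n) * z ^ k) =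
          fun k => a k * z ^ k - (ζ ^ n)⁻¹ * (a k * (ζ * z) ^ k) := by
        ext k; rw [mul_pow]; ring
      rw [e]; exact this
    have h1 := pointEval hα hp hr (γ n)
    have e2 : ζ * γ n = γ m := div_mul_cancel₀ _ (hne n)
    simp only [e2, hzero m hmn, mul_zero, sub_zero, hone] at h1
    have h2 : ∑' k : ℕ, ENNReal.ofReal (gk α p (2 * α * lpz (γ n) - k)) *
        ENNReal.ofReal (‖a k * (1 - ζ ^ k / ζ ^ n)‖ * Wt α p k) ≤
        ∑' k : ℕ, ENNReal.ofReal (C3 * C * 2 * Real.exp R0 * ‖1 - ζ‖) *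
          ENNReal.ofReal (Real.exp (-1 * |uu α γ n - k|)) := by
      refine ENNReal.tsum_le_tsum fun k => ?_
      have hW := Wt_pos α p k
      rw [← ENNReal.ofReal_mul (gk_pos _ _ _).le, ← ENNReal.ofReal_mul (by positivity)]
      refine ENNReal.ofReal_le_ofReal ?_
      have h3 : gk α p (2 * α * lpz (γ n) - k) ≤ C3 * Real.exp (-2 * |uu α γ n - k|) := hg _
      have h4 : ‖a k‖ * Wt α p k ≤ C := by
        refine (hX k).trans (mul_le_of_le_one_right hC.le ?_)
        rw [Real.exp_le_one_iff]
        have := abs_nonneg ((n : ℝ) - k)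
        nlinarith
      have h5 := zpow_diff h.le n k
      have h6 : Real.exp (-2 * |uu α γ n - k|) * Real.exp |(n : ℝ) - k| ≤
          Real.exp R0 * Real.exp (-1 * |uu α γ n - k|) := by
        rw [← Real.exp_add, ← Real.exp_add]
        apply Real.exp_le_exp.mpr
        have h7 := abs_sub_le (n : ℝ) (uu α γ n) k
        have h8 := hR n
        rw [abs_sub_comm] at h8
        linarith
      calc _ = gk α p (2 * α * lpz (γ n) - k) * ((‖a k‖ * Wt α p k) * ‖1 - ζ ^ k / ζ ^ n‖) := by
            rw [norm_mul]; ring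
        _ ≤ C3 * Real.exp (-2 * |uu α γ n - k|) * (C * (2 * Real.exp |(n : ℝ) - k| * ‖1 - ζ‖)) := by
            gcongr
        _ = C3 * C * 2 * ‖1 - ζ‖ * (Real.exp (-2 * |uu α γ n - k|) * Real.exp |(n : ℝ) - k|) := by
            ring
        _ ≤ C3 * C * 2 * ‖1 - ζ‖ * (Real.exp R0 * Real.exp (-1 * |uu α γ n - k|)) := by
            gcongr
        _ = _ := by ring
    rw [ENNReal.tsum_mul_left] at h2
    have h3 := (h1.trans h2).trans (mul_le_mul_right (hTs _) _)
    rw [← ENNReal.ofReal_mul (by positivity), ENNReal.ofReal_le_ofReal_iff (by positivity)] at h3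
    rw [div_le_iff₀ hK0, hK]
    linarith
  have hγ0 := norm_pos_iff.mpr (hne 0)
  have hsq : 0 < Real.sqrt (2 * α) := Real.sqrt_pos.mpr (by positivity)
  set E := 1 / ‖γ 0‖ + 1 / Real.sqrt (2 * α) with hE
  have hE0 : 0 < E := by positivity
  refine ⟨c / E, by positivity, ?_⟩
  rintro _ ⟨n, rfl⟩ _ ⟨m, rfl⟩ hnm
  have h1 := key n m (fun h => hnm (by rw [h]))
  have hγ := norm_pos_iff.mpr (hne n)
  unfold dRho rhoF
  have hmin : min (‖γ n‖ / Real.sqrt (2 * α)) (‖γ m‖ / Real.sqrt (2 * α)) ≤ ‖γ n‖ / Real.sqrt (2 * α) :=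
    min_le_left _ _
  have hmin0 : 0 ≤ min (‖γ n‖ / Real.sqrt (2 * α)) (‖γ m‖ / Real.sqrt (2 * α)) := by positivity
  rw [div_le_div_iff₀ hE0 (by linarith)]
  have h2 : 1 ≤ ‖γ n‖ / ‖γ 0‖ := by
    rw [one_le_div hγ0]; exact hm (Nat.zero_le n)
  have h3 : 1 + min (‖γ n‖ / Real.sqrt (2 * α)) (‖γ m‖ / Real.sqrt (2 * α)) ≤ ‖γ n‖ * E := by
    rw [hE, mul_add, mul_one_div, mul_one_div]; linarith
  calc _ ≤ c * (‖γ n‖ * E) := by gcongr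
    _ = c * ‖γ n‖ * E := by ring
    _ ≤ _ := by gcongr

lemma factor_zeros {f : ℂ → ℂ} (hf : Differentiable ℂ f) {γ : ℕ → ℂ} (hinj : Function.Injective γ)
    (A : Finset ℕ) (h0 : ∀ m ∈ A, f (γ m) = 0) :
    ∃ g : ℂ → ℂ, Differentiable ℂ g ∧ ∀ z, f z = g z * ∏ m ∈ A, (z - γ m) := by
  classical
  induction A using Finset.induction_on with
  | empty => exact ⟨f, hf, by simp⟩
  | insert i A hi ih =>
    obtain ⟨g, hg, hfg⟩ := ih fun m hm => h0 m (Finset.mem_insert_of_mem hm)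
    have hgi : g (γ i) = 0 := by
      have h1 := h0 i (Finset.mem_insert_self _ _)
      rw [hfg] at h1
      rcases mul_eq_zero.mp h1 with h2 | h2
      · exact h2
      · obtain ⟨m, hm, h3⟩ := Finset.prod_eq_zero_iff.mp h2
        exact absurd (hinj (sub_eq_zero.mp h3) ▸ hm) hi
    refine ⟨dslope g (γ i), ?_, fun z => ?_⟩
    · rw [← differentiableOn_univ, Complex.differentiableOn_dslope Filter.univ_mem]
      exact hg.differentiableOn
    · rw [hfg, Finset.prod_insert hi]
      have := sub_smul_dslope g (γ i) z
      rw [hgi, sub_zero, smul_eq_mul] at this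
      rw [← this]; ring

lemma jens {f : ℂ → ℂ} (hf : Differentiable ℂ f) {γ : ℕ → ℂ} (hinj : Function.Injective γ)
    {τ : ℕ → ℝ} (hn : ∀ n, ‖γ n‖ = Real.exp (τ n))
    (A : Finset ℕ) (h0 : ∀ m ∈ A, f (γ m) = 0) {t M : ℝ} (ht : ∀ m ∈ A, τ m < t)
    (hM : ∀ z, ‖z‖ = Real.exp t → ‖f z‖ ≤ M) {z0 : ℂ} (hz0 : ‖z0‖ ≤ Real.exp t) :
    ‖f z0‖ * ∏ m ∈ A, (Real.exp (t - τ m) - 1) ≤ M * ∏ m ∈ A, (1 + ‖z0‖ * Real.exp (-τ m)) := by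
  obtain ⟨g, hg, hfg⟩ := factor_zeros hf hinj A h0
  have hpos : ∀ m ∈ A, 0 < Real.exp t - Real.exp (τ m) := fun m hm => by
    have := Real.exp_lt_exp.mpr (ht m hm); linarith
  have hP : 0 < ∏ m ∈ A, (Real.exp t - Real.exp (τ m)) := Finset.prod_pos hpos
  set P := ∏ m ∈ A, (Real.exp t - Real.exp (τ m)) with hPd
  have h1 : ∀ z ∈ frontier (Metric.ball (0 : ℂ) (Real.exp t)), ‖g z‖ ≤ M / P := by
    intro z hz
    rw [frontier_ball _ (Real.exp_pos t).ne', mem_sphere_zero_iff_norm] at hz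
    have h2 := hM z hz
    rw [hfg, norm_mul, norm_prod] at h2
    rw [le_div_iff₀ hP]
    refine le_trans ?_ h2
    refine mul_le_mul_of_nonneg_left ?_ (norm_nonneg _)
    refine Finset.prod_le_prod (fun m hm => (hpos m hm).le) fun m hm => ?_
    have := norm_sub_norm_le z (γ m)
    rw [hz, hn] at this
    exact this
  have h2 : ‖g z0‖ ≤ M / P := by
    refine Complex.norm_le_of_forall_mem_frontier_norm_le Metric.isBounded_ball
      hg.diffContOnCl h1 ?_
    rw [closure_ball _ (Real.exp_pos t).ne']
    simpa using hz0
  rw [le_div_iff₀ hP] at h2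
  have e1 : ∏ m ∈ A, (Real.exp (t - τ m) - 1) = P * ∏ m ∈ A, Real.exp (-τ m) := by
    rw [hPd, ← Finset.prod_mul_distrib]
    refine Finset.prod_congr rfl fun m _ => ?_
    rw [sub_mul, ← Real.exp_add, ← Real.exp_add]; simp [sub_eq_add_neg]
  have e2 : ∏ m ∈ A, (1 + ‖z0‖ * Real.exp (-τ m)) =
      (∏ m ∈ A, (Real.exp (τ m) + ‖z0‖)) * ∏ m ∈ A, Real.exp (-τ m) := by
    rw [← Finset.prod_mul_distrib]
    refine Finset.prod_congr rfl fun m _ => ?_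
    rw [add_mul, ← Real.exp_add]; simp
  have hE : 0 < ∏ m ∈ A, Real.exp (-τ m) := Finset.prod_pos fun _ _ => Real.exp_pos _
  rw [e1, e2, ← mul_assoc, ← mul_assoc]
  refine mul_le_mul_of_nonneg_right ?_ hE.le
  rw [hfg, norm_mul, norm_prod]
  have h3 : ∏ m ∈ A, ‖z0 - γ m‖ ≤ ∏ m ∈ A, (Real.exp (τ m) + ‖z0‖) := by
    refine Finset.prod_le_prod (fun _ _ => norm_nonneg _) fun m _ => ?_
    have := norm_sub_le z0 (γ m)
    rw [hn] at this; linarith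
  have hM0 : 0 ≤ M := (mul_nonneg (norm_nonneg _) hP.le).trans h2
  calc ‖g z0‖ * (∏ m ∈ A, ‖z0 - γ m‖) * P = ‖g z0‖ * P * ∏ m ∈ A, ‖z0 - γ m‖ := by ring
    _ ≤ M * ∏ m ∈ A, (Real.exp (τ m) + ‖z0‖) :=
      mul_le_mul h2 h3 (Finset.prod_nonneg fun _ _ => norm_nonneg _) hM0

lemma lpz_of_exp {z : ℂ} {t : ℝ} (ht : 0 ≤ t) (hz : ‖z‖ = Real.exp t) : lpz z = t := by
  unfold lpz logPlus; rw [hz, Real.log_exp, max_eq_left ht]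

lemma circ {α p : ℝ} (hα : 0 < α) (hp : 1 ≤ p) {ε b0 : ℝ} (hε : 0 < ε) (hε1 : ε ≤ 1) (hb0 : 0 ≤ b0) :
    ∃ C : ℝ, 0 < C ∧ ∀ a f, PSRep a f → ∀ (k1 k : ℕ) (S : ℝ), 0 ≤ S →
      (∀ j : ℕ, ‖a j‖ * Wt α p j ≤ S * Real.exp (-ε * |(k1 : ℝ) - j|)) →
      ∀ z, ‖z‖ = Real.exp (k / (2 * α) + b0) →
        ‖f z‖ ≤ C * S * Real.exp (-ε * |(k1 : ℝ) - k|) *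
          Real.exp (-(2 * (k / (2 * α) + b0) / p - α * (k / (2 * α) + b0) ^ 2)) := by
  obtain ⟨C3, hC3, hg⟩ := gk_decay hα hp (b := 2) (by norm_num)
  obtain ⟨T, hT, hTs⟩ := tsumExp (c := 1) one_pos
  refine ⟨C3 * Real.exp (2 * α * b0) * T, by positivity, fun a f hf k1 k S hS hX z hz => ?_⟩
  set t := (k : ℝ) / (2 * α) + b0 with ht
  have ht0 : 0 ≤ t := by positivity
  have hl : lpz z = t := lpz_of_exp ht0 hz
  have h1 := pointEval hα hp hf z
  have hQ : Qz α p z = Real.exp (2 * t / p - α * t ^ 2) := by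
    unfold Qz phi; rw [hl]; congr 2
    change α * lpz z ^ 2 = _
    rw [hl]
  have hQ0 := Qz_pos α p z
  rw [hl] at h1
  have hk : 2 * α * t = k + 2 * α * b0 := by rw [ht]; field_simp
  have h2 : ∑' j : ℕ, ENNReal.ofReal (gk α p (2 * α * t - j)) * ENNReal.ofReal (‖a j‖ * Wt α p j) ≤
      ∑' j : ℕ, ENNReal.ofReal (C3 * Real.exp (2 * α * b0) * S * Real.exp (-ε * |(k1 : ℝ) - k|)) *
        ENNReal.ofReal (Real.exp (-1 * |2 * α * t - j|)) := by
    refine ENNReal.tsum_le_tsum fun j => ?_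
    rw [← ENNReal.ofReal_mul (gk_pos _ _ _).le, ← ENNReal.ofReal_mul (by positivity)]
    refine ENNReal.ofReal_le_ofReal ?_
    have h6 : Real.exp (-2 * |2 * α * t - j|) * Real.exp (-ε * |(k1 : ℝ) - j|) ≤
        Real.exp (2 * α * b0) * Real.exp (-ε * |(k1 : ℝ) - k|) * Real.exp (-1 * |2 * α * t - j|) := by
      rw [← Real.exp_add, ← Real.exp_add, ← Real.exp_add]
      apply Real.exp_le_exp.mpr
      have h7 := abs_sub_le (k1 : ℝ) j k
      have h8 : |(j : ℝ) - k| ≤ |2 * α * t - j| + 2 * α * b0 := by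
        have := abs_sub_le (j : ℝ) (2 * α * t) k
        rw [abs_sub_comm (j : ℝ) (2 * α * t), hk, add_sub_cancel_left,
          abs_of_nonneg (by positivity : 0 ≤ 2 * α * b0)] at this
        rw [hk]; exact this
      have h9 : ε * |(j : ℝ) - k| ≤ |(j : ℝ) - k| := mul_le_of_le_one_left (abs_nonneg _) hε1
      have h10 := mul_le_mul_of_nonneg_left h7 hε.le
      linarith
    have hW := Wt_pos α p j
    calc _ ≤ C3 * Real.exp (-2 * |2 * α * t - j|) * (S * Real.exp (-ε * |(k1 : ℝ) - j|)) := by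
          refine mul_le_mul (hg _) (hX j) (by positivity) (by positivity)
      _ = C3 * S * (Real.exp (-2 * |2 * α * t - j|) * Real.exp (-ε * |(k1 : ℝ) - j|)) := by ring
      _ ≤ C3 * S * (Real.exp (2 * α * b0) * Real.exp (-ε * |(k1 : ℝ) - k|) *
          Real.exp (-1 * |2 * α * t - j|)) := by gcongr
      _ = _ := by ring
  rw [ENNReal.tsum_mul_left] at h2
  have h3 := (h1.trans h2).trans (mul_le_mul_right (hTs _) _)
  rw [← ENNReal.ofReal_mul (by positivity), ENNReal.ofReal_le_ofReal_iff (by positivity), hQ] at h3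
  rw [Real.exp_neg, ← div_eq_mul_inv, le_div_iff₀ (Real.exp_pos _)]
  refine h3.trans (le_of_eq ?_)
  ring

lemma nec_lower {α p : ℝ} (hα : 0 < α) (hp : 1 ≤ p) {γ : ℕ → ℂ} (hinj : Function.Injective γ)
    (hI : IntN α p γ) {δ : ℕ → ℝ} (hn : ∀ n, ‖γ n‖ = Real.exp (tt α δ n))
    {B : ℝ} (hB : ∀ n, |δ n| ≤ B) {ε C : ℝ} (hε : 0 < ε) (hε1 : ε ≤ 1) (hC : 0 < C)
    (hct : ∀ a f, PSRep a f → SN α p a < ⊤ → ∀ (k0 : ℕ) (S : ℝ),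
      0 ≤ S → ∑' n : ℕ, ENNReal.ofReal
        ((Real.exp (-ε * |(n : ℝ) - k0|) * (‖f (γ n)‖ * Qz α p (γ n))) ^ p) ≤ ENNReal.ofReal (S ^ p) →
      ‖a k0‖ * Wt α p k0 ≤ C * S) :
    ∃ C' : ℝ, ∀ n r : ℕ, 1 ≤ r →
      ε * r - C' ≤ ∑ j ∈ Finset.range r, (δ (n + j) - (UU α p - 1 / (2 * α))) := by
  have hB0 : 0 ≤ B := (abs_nonneg _).trans (hB 0)
  have hlog : 0 < Real.log 2 := Real.log_pos (by norm_num)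
  set b0 := B + Real.log 2 with hb0
  have hb00 : 0 ≤ b0 := by positivity
  obtain ⟨C1, hC1, hcirc⟩ := circ hα hp (ε := ε) (b0 := b0) hε hε1 hb00
  obtain ⟨C2, hC2, hlo⟩ := prod_lowerR hα hB b0
  obtain ⟨C3, hC3, hup⟩ := prod_upper hα hB (1 / (2 * α) + B)
  obtain ⟨C4, hC4, hQn⟩ := Qn_id hα hp hn hB
  refine ⟨C2 + Real.log (C1 * C) + C3 + C4 + (2 * b0 / p - α * b0 ^ 2) * (-1) + b0 + B,
    fun n r hr => ?_⟩
  set k := n + r with hk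
  set t := (k : ℝ) / (2 * α) + b0 with ht
  obtain ⟨a, f, hf, hX, hzero, hone⟩ := nec_delta hp hI hε hct n
  have hM := hcirc a f hf n k C hC.le hX
  rw [← ht] at hM
  set A := (Finset.range k).erase n with hA
  have hAm : ∀ m ∈ A, m < k ∧ m ≠ n := fun m hm => by
    rw [hA, Finset.mem_erase, Finset.mem_range] at hm; exact ⟨hm.2, hm.1⟩
  have htm : ∀ m, m < k → Real.log 2 ≤ t - tt α δ m := by
    intro m hm
    have h1 := (abs_le.mp (hB m)).2
    have h2 : (1 + (m : ℝ)) / (2 * α) ≤ k / (2 * α) := by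
      gcongr
      have : m + 1 ≤ k := hm
      have : ((m + 1 : ℕ) : ℝ) ≤ k := by exact_mod_cast this
      push_cast at this; linarith
    rw [ht, hb0]; unfold tt; linarith
  have htb : |t - k / (2 * α)| ≤ b0 := by
    rw [ht, add_sub_cancel_left, abs_of_nonneg hb00]
  have hnk : n < k := by omega
  have h1 := hlo A k t htb (fun m hm => ⟨(hAm m hm).1, by
    have := htm m (hAm m hm).1
    calc Real.exp (-(t - tt α δ m)) ≤ Real.exp (-Real.log 2) := Real.exp_le_exp.mpr (by linarith)
      _ = 1 / 2 := by rw [Real.exp_neg, Real.exp_log (by norm_num)]; norm_num⟩)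
  have htn := htm n hnk
  have h2 := jens (f := f) hf.differentiable hinj hn A (fun m hm => hzero m (hAm m hm).2)
    (t := t) (fun m hm => by have := htm m (hAm m hm).1; linarith) hM (z0 := γ n) (by
      rw [hn]; exact Real.exp_le_exp.mpr (by linarith))
  have h3 := hup A n (tt α δ n) (by
    have := abs_le.mp (hB n)
    have e : tt α δ n - n / (2 * α) = 1 / (2 * α) + δ n := by unfold tt; ring
    rw [e]
    have : 0 ≤ 1 / (2 * α) := by positivity
    rw [abs_le]; constructor <;> linarith)
  have e3 : ∏ m ∈ A, (1 + ‖γ n‖ * Real.exp (-tt α δ m)) = ∏ m ∈ A, (1 + Real.exp (tt α δ n - tt α δ m)) := by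
    refine Finset.prod_congr rfl fun m _ => ?_
    rw [hn, ← Real.exp_add]; rfl
  rw [e3] at h2
  have e4 : ∑ m ∈ A, (if m < n then tt α δ n - tt α δ m else 0) =
      ∑ m ∈ Finset.range n, (tt α δ n - tt α δ m) := by
    rw [← sum_ite_range _ hnk.le, hA, Finset.sum_erase]
    simp
  have e5 : ∑ m ∈ A, (t - tt α δ m) = ∑ m ∈ Finset.range k, (t - tt α δ m) - (t - tt α δ n) := by
    rw [← Finset.add_sum_erase _ (fun m => t - tt α δ m) (Finset.mem_range.mpr hnk)]; ring
  rw [e4] at h3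
  rw [e5] at h1
  have hQ := Qz_pos α p (γ n)
  have e6 : ‖f (γ n)‖ = Real.exp (-Real.log (Qz α p (γ n))) := by
    rw [Real.exp_neg, Real.exp_log hQ]
    exact eq_inv_of_mul_eq_one_left hone
  have hCC : C1 * C = Real.exp (Real.log (C1 * C)) := (Real.exp_log (by positivity)).symm
  have h4 : Real.exp (-Real.log (Qz α p (γ n)) + (-C2 + (∑ m ∈ Finset.range k, (t - tt α δ m) - (t - tt α δ n))))
      ≤ Real.exp (Real.log (C1 * C) + -ε * |(n : ℝ) - k| + -(2 * t / p - α * t ^ 2) +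
        (C3 + ∑ m ∈ Finset.range n, (tt α δ n - tt α δ m))) := by
    rw [Real.exp_add, Real.exp_add _ (C3 + _), Real.exp_add _ (-(2 * t / p - α * t ^ 2)),
      Real.exp_add (Real.log (C1 * C)), ← hCC, ← e6]
    refine (mul_le_mul_of_nonneg_left h1 (norm_nonneg _)).trans (h2.trans ?_)
    gcongr
  rw [Real.exp_le_exp] at h4
  have h5 := key_id hα hp δ k t
  have e7 : t - k / (2 * α) = b0 := by rw [ht]; ring
  rw [e7] at h5
  have h6 := abs_le.mp (hQn n)
  have e8 : |(n : ℝ) - k| = r := by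
    rw [hk]; push_cast
    rw [show (n : ℝ) - (n + r) = -r by ring, abs_neg, abs_of_nonneg (Nat.cast_nonneg r)]
  rw [e8] at h4
  have h7 : t - tt α δ n ≤ r / (2 * α) + b0 + B := by
    have h8 := (abs_le.mp (hB n)).1
    have : t - tt α δ n = r / (2 * α) + b0 - δ n - 1 / (2 * α) := by
      rw [ht, hk]; unfold tt; push_cast; field_simp; ring
    have : 0 ≤ 1 / (2 * α) := by positivity
    linarith
  have h8 := EE_add α p δ n r
  rw [← hk] at h8
  have h9 : ∑ j ∈ Finset.range r, (δ (n + j) - (UU α p - 1 / (2 * α))) =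
      -(∑ j ∈ Finset.range r, (UU α p - δ (n + j))) + r / (2 * α) := by
    rw [← Finset.sum_neg_distrib]
    have : (r : ℝ) / (2 * α) = ∑ j ∈ Finset.range r, 1 / (2 * α) := by
      simp [div_eq_mul_inv]
    rw [this, ← Finset.sum_add_distrib]
    exact Finset.sum_congr rfl fun _ _ => by ring
  rw [h9]
  linarith [h6.1, h6.2]

lemma nec_upper {α p : ℝ} (hα : 0 < α) (hp : 1 ≤ p) {γ : ℕ → ℂ} (hinj : Function.Injective γ)
    {δ : ℕ → ℝ} (hn : ∀ n, ‖γ n‖ = Real.exp (tt α δ n))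
    {B : ℝ} (hB : ∀ n, |δ n| ≤ B) {ε C : ℝ} (hε : 0 < ε) (hε1 : ε ≤ 1) (hC : 0 < C)
    (hct : ∀ a f, PSRep a f → SN α p a < ⊤ → ∀ (k0 : ℕ) (S : ℝ),
      0 ≤ S → ∑' n : ℕ, ENNReal.ofReal
        ((Real.exp (-ε * |(n : ℝ) - k0|) * (‖f (γ n)‖ * Qz α p (γ n))) ^ p) ≤ ENNReal.ofReal (S ^ p) →
      ‖a k0‖ * Wt α p k0 ≤ C * S) :
    ∃ C' : ℝ, ∀ n r : ℕ,
      ε * r - C' ≤ ∑ j ∈ Finset.range r, (UU α p - δ (n + j)) := by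
  have hp0 : 0 < p := by linarith
  have hB0 : 0 ≤ B := (abs_nonneg _).trans (hB 0)
  have hlog : 0 < Real.log 2 := Real.log_pos (by norm_num)
  set b0 := B + Real.log 2 with hb0
  have hb00 : 0 ≤ b0 := by positivity
  obtain ⟨C1, hC1, hcirc⟩ := circ hα hp (ε := ε) (b0 := b0) hε hε1 hb00
  obtain ⟨C2, hC2, hlo⟩ := prod_lowerR hα hB b0
  obtain ⟨C3, hC3, hup⟩ := prod_upper hα hB (1 / (2 * α) + B)
  obtain ⟨C4, hC4, hg⟩ := gk_decay hα hp (b := 2) (by norm_num)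
  obtain ⟨T, hT, hTs⟩ := tsumExp (c := 1) one_pos
  set R0 := 1 + 2 * α * B with hR0
  have hR := uu_bdd hα hn hB
  set C5 := Real.exp C3 * C4 * Real.exp (2 * R0) with hC5
  have hC50 : 0 < C5 := by positivity
  set C6 := C1 * (C * (C5 * (T + 1))) with hC6
  have hC60 : 0 < C6 := by positivity
  refine ⟨Real.log C6 + C2 - (2 * b0 / p - α * b0 ^ 2), fun n r => ?_⟩
  set M := n + r with hMd
  set P : Polynomial ℂ := ∏ m ∈ Finset.range M, (1 - Polynomial.C (γ m)⁻¹ * Polynomial.X) with hP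
  have hne : ∀ m, γ m ≠ 0 := fun m h => by
    have := hn m; rw [h, norm_zero] at this; exact (Real.exp_pos _).ne this
  have heval : ∀ z, P.eval z = ∏ m ∈ Finset.range M, (1 - (γ m)⁻¹ * z) := by
    intro z; rw [hP, Polynomial.eval_prod]; simp
  have hzero : ∀ m, m < M → P.eval (γ m) = 0 := by
    intro m hm
    rw [heval]
    exact Finset.prod_eq_zero (Finset.mem_range.mpr hm) (by rw [inv_mul_cancel₀ (hne m), sub_self])
  have hval : ∀ m, ‖P.eval (γ m)‖ * Qz α p (γ m) ≤
      C5 * Real.exp (EE α p δ M) * Real.exp (-2 * |(m : ℝ) - M|) := by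
    intro m
    have hQ := Qz_pos α p (γ m)
    by_cases hm : m < M
    · rw [hzero m hm, norm_zero, zero_mul]; positivity
    push Not at hm
    have h3 := hup (Finset.range M) m (tt α δ m) (by
      have := abs_le.mp (hB m)
      have e : tt α δ m - m / (2 * α) = 1 / (2 * α) + δ m := by unfold tt; ring
      rw [e]
      have : 0 ≤ 1 / (2 * α) := by positivity
      rw [abs_le]; constructor <;> linarith)
    have h4 : ‖P.eval (γ m)‖ ≤ ∏ i ∈ Finset.range M, (1 + Real.exp (tt α δ m - tt α δ i)) := by
      rw [heval, norm_prod]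
      refine Finset.prod_le_prod (fun _ _ => norm_nonneg _) fun i _ => ?_
      refine (norm_sub_le _ _).trans (le_of_eq ?_)
      rw [norm_one, norm_mul, norm_inv, hn, hn, ← Real.exp_neg, ← Real.exp_add]
      congr 2; ring
    have h5 : ∑ i ∈ Finset.range M, (if i < m then tt α δ m - tt α δ i else 0) ≤
        ∑ i ∈ Finset.range M, (lpz (γ m) - tt α δ i) := by
      refine Finset.sum_le_sum fun i hi => ?_
      rw [if_pos (lt_of_lt_of_le (Finset.mem_range.mp hi) hm), lpz_eq hn]
      have := le_max_left (tt α δ m) 0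
      linarith
    have h6 := key_id hα hp δ M (lpz (γ m))
    have h7 : Qz α p (γ m) = Real.exp (2 * lpz (γ m) / p - α * lpz (γ m) ^ 2) := rfl
    have h8 : gk α p (uu α γ m - M) = Real.exp (2 * (lpz (γ m) - M / (2 * α)) / p -
        α * (lpz (γ m) - M / (2 * α)) ^ 2) := by
      unfold gk uu; congr 1; field_simp; ring
    calc _ ≤ Real.exp (C3 + ∑ i ∈ Finset.range M, (lpz (γ m) - tt α δ i)) * Qz α p (γ m) := by
          gcongr
          refine h4.trans (h3.trans (Real.exp_le_exp.mpr ?_))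
          linarith
      _ = Real.exp C3 * Real.exp (EE α p δ M) * gk α p (uu α γ m - M) := by
          rw [h7, h8, ← Real.exp_add, ← Real.exp_add, ← Real.exp_add]
          congr 1; linarith
      _ ≤ Real.exp C3 * Real.exp (EE α p δ M) * (C4 * Real.exp (-2 * |uu α γ m - M|)) := by
          gcongr; exact hg _
      _ ≤ Real.exp C3 * Real.exp (EE α p δ M) * (C4 * (Real.exp (2 * R0) * Real.exp (-2 * |(m : ℝ) - M|))) := by
          gcongr
          rw [← Real.exp_add]
          apply Real.exp_le_exp.mpr
          have h7 := abs_sub_le (m : ℝ) (uu α γ m) M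
          have h8 := hR m
          rw [abs_sub_comm] at h8
          linarith
      _ = _ := by rw [hC5]; ring
  have hdeg : P.natDegree ≤ M := by
    rw [hP]
    refine (Polynomial.natDegree_prod_le _ _).trans ?_
    refine (Finset.sum_le_card_nsmul _ _ 1 fun m _ => ?_).trans (by simp)
    refine (Polynomial.natDegree_sub_le _ _).trans ?_
    simp only [Polynomial.natDegree_one]
    refine max_le (by norm_num) ?_
    exact (Polynomial.natDegree_C_mul_le _ _).trans (by simp)
  have hfin : SN α p P.coeff < ⊤ := SN_finite_supp hp _ (M + 1) fun k hk =>
      Polynomial.coeff_eq_zero_of_natDegree_lt (by omega)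
  have hX : ∀ j : ℕ, ‖P.coeff j‖ * Wt α p j ≤
      (C * (C5 * (T + 1)) * Real.exp (EE α p δ M)) * Real.exp (-ε * |(M : ℝ) - j|) := by
    intro j
    set S := C5 * (T + 1) * Real.exp (EE α p δ M) * Real.exp (-ε * |(M : ℝ) - j|) with hSd
    have hS0 : 0 ≤ S := by positivity
    have := hct _ _ (rep_poly P) hfin j S hS0 (by
      set S1 := C5 * Real.exp (EE α p δ M) * Real.exp (-ε * |(M : ℝ) - j|) with hS1
      have hS10 : 0 < S1 := by positivity
      calc _ ≤ ∑' m : ℕ, ENNReal.ofReal (S1 ^ p) * ENNReal.ofReal (Real.exp (-1 * |(M : ℝ) - m|)) := by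
            refine ENNReal.tsum_le_tsum fun m => ?_
            have hQ := Qz_pos α p (γ m)
            rw [← ENNReal.ofReal_mul (by positivity)]
            refine ENNReal.ofReal_le_ofReal ?_
            have h1 : Real.exp (-ε * |(m : ℝ) - j|) * (‖P.eval (γ m)‖ * Qz α p (γ m)) ≤
                S1 * Real.exp (-1 * |(M : ℝ) - m|) := by
              calc _ ≤ Real.exp (-ε * |(m : ℝ) - j|) *
                  (C5 * Real.exp (EE α p δ M) * Real.exp (-2 * |(m : ℝ) - M|)) := by
                    exact mul_le_mul_of_nonneg_left (hval m) (Real.exp_pos _).le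
                _ = C5 * Real.exp (EE α p δ M) * (Real.exp (-ε * |(m : ℝ) - j|) *
                    Real.exp (-2 * |(m : ℝ) - M|)) := by ring
                _ ≤ C5 * Real.exp (EE α p δ M) * (Real.exp (-ε * |(M : ℝ) - j|) *
                    Real.exp (-1 * |(M : ℝ) - m|)) := by
                    gcongr C5 * Real.exp (EE α p δ M) * ?_
                    rw [← Real.exp_add, ← Real.exp_add]
                    apply Real.exp_le_exp.mpr
                    have h7 := abs_sub_le (M : ℝ) m j
                    have h9 : ε * |(M : ℝ) - m| ≤ |(M : ℝ) - m| :=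
                      mul_le_of_le_one_left (abs_nonneg _) hε1
                    have h10 := mul_le_mul_of_nonneg_left h7 hε.le
                    rw [abs_sub_comm (m : ℝ) M]
                    linarith
                _ = _ := by rw [hS1]; ring
            refine (Real.rpow_le_rpow (by positivity) h1 hp0.le).trans ?_
            rw [Real.mul_rpow hS10.le (Real.exp_pos _).le]
            gcongr
            rw [← Real.exp_mul]
            apply Real.exp_le_exp.mpr
            have := abs_nonneg ((M : ℝ) - m)
            nlinarith
        _ ≤ ENNReal.ofReal (S1 ^ p) * ENNReal.ofReal T := by
            rw [ENNReal.tsum_mul_left]; exact mul_le_mul_right (hTs _) _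
        _ ≤ _ := by
            rw [← ENNReal.ofReal_mul (by positivity)]
            refine ENNReal.ofReal_le_ofReal ?_
            have e : S = S1 * (T + 1) := by rw [hSd, hS1]; ring
            rw [e, Real.mul_rpow hS10.le (by positivity)]
            gcongr
            have : T + 1 ≤ (T + 1) ^ p := Real.self_le_rpow_of_one_le (by linarith) hp
            linarith)
    refine this.trans (le_of_eq ?_)
    rw [hSd]; ring
  set t := (n : ℝ) / (2 * α) + b0 with ht
  have hM := hcirc _ _ (rep_poly P) M n _ (by positivity) hX
  rw [← ht] at hM
  have htm : ∀ m, m < n → Real.log 2 ≤ t - tt α δ m := by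
    intro m hm
    have h1 := (abs_le.mp (hB m)).2
    have h2 : (1 + (m : ℝ)) / (2 * α) ≤ n / (2 * α) := by
      gcongr
      have : m + 1 ≤ n := hm
      have : ((m + 1 : ℕ) : ℝ) ≤ n := by exact_mod_cast this
      push_cast at this; linarith
    rw [ht, hb0]; unfold tt; linarith
  have htb : |t - n / (2 * α)| ≤ b0 := by
    rw [ht, add_sub_cancel_left, abs_of_nonneg hb00]
  have h1 := hlo (Finset.range n) n t htb (fun m hm => ⟨Finset.mem_range.mp hm, by
    have := htm m (Finset.mem_range.mp hm)
    calc Real.exp (-(t - tt α δ m)) ≤ Real.exp (-Real.log 2) := Real.exp_le_exp.mpr (by linarith)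
      _ = 1 / 2 := by rw [Real.exp_neg, Real.exp_log (by norm_num)]; norm_num⟩)
  have h2 := jens (f := fun z => P.eval z) P.differentiable hinj hn (Finset.range n)
    (fun m hm => hzero m (by have := Finset.mem_range.mp hm; omega))
    (t := t) (fun m hm => by have := htm m (Finset.mem_range.mp hm); linarith) hM (z0 := 0) (by
      rw [norm_zero]; exact (Real.exp_pos _).le)
  have e0 : P.eval 0 = 1 := by rw [heval]; simp
  simp only [e0, norm_one, one_mul, norm_zero, zero_mul, add_zero, Finset.prod_const_one, mul_one] at h2
  have e8 : |(M : ℝ) - n| = r := by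
    rw [hMd]; push_cast
    rw [add_sub_cancel_left, abs_of_nonneg (Nat.cast_nonneg r)]
  rw [e8] at h2
  have h4 : Real.exp (-C2 + ∑ m ∈ Finset.range n, (t - tt α δ m)) ≤
      Real.exp (Real.log C6 + EE α p δ M + -ε * r + -(2 * t / p - α * t ^ 2)) := by
    refine (h1.trans h2).trans (le_of_eq ?_)
    rw [Real.exp_add, Real.exp_add, Real.exp_add, Real.exp_log hC60, hC6]
    ring
  rw [Real.exp_le_exp] at h4
  have h5 := key_id hα hp δ n t
  have e7 : t - n / (2 * α) = b0 := by rw [ht]; ring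
  rw [e7] at h5
  have h8 := EE_add α p δ n r
  rw [← hMd] at h8
  linarith

lemma necessity {α p : ℝ} (hα : 0 < α) (hp : 1 ≤ p) {γ : ℕ → ℂ} (hinj : Function.Injective γ)
    {δ : ℕ → ℝ} (hn : ∀ n, ‖γ n‖ = Real.exp (tt α δ n)) (hm : Monotone fun n => ‖γ n‖)
    (hS : SampN α p γ) (hI : IntN α p γ) :
    DRhoSeparated α (Set.range γ) ∧ (∃ M : ℝ, ∀ n, |δ n| ≤ M) ∧
       (∃ N : ℕ, 1 ≤ N ∧ UU α p - 1 / (2 * α) < (⨅ n : ℕ, avgD δ N n) ∧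
         (⨆ n : ℕ, avgD δ N n) < UU α p) := by
  have hne : ∀ m, γ m ≠ 0 := fun m h => by
    have := hn m; rw [h, norm_zero] at this; exact (Real.exp_pos _).ne this
  obtain ⟨B, hB⟩ := nec_bdd hα hp hn hm hne hS hI
  have hR := uu_bdd hα hn hB
  obtain ⟨ε, hε, hε1, C, hC, hct⟩ := combes hα hp hS hR
  refine ⟨nec_sep hα hp hI hε hC hct hR hne hm, ⟨B, hB⟩, ?_⟩
  obtain ⟨C1, h1⟩ := nec_lower hα hp hinj hI hn hB hε hε1 hC hct
  obtain ⟨C2, h2⟩ := nec_upper hα hp hinj hn hB hε hε1 hC hct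
  obtain ⟨N, hN⟩ := exists_nat_gt (max (max C1 C2 / (ε / 2)) 1)
  have hN1 : (1 : ℝ) < N := (le_max_right _ _).trans_lt hN
  have hN1' : 1 ≤ N := by
    have : 1 < N := by exact_mod_cast hN1
    omega
  have hN2 : max C1 C2 < N * (ε / 2) := by
    have := (le_max_left _ _).trans_lt hN
    rwa [div_lt_iff₀ (by positivity)] at this
  have hC1 := (le_max_left C1 C2).trans_lt hN2
  have hC2 := (le_max_right C1 C2).trans_lt hN2
  have hN0 : (0 : ℝ) < N := by linarith
  refine ⟨N, hN1', ?_, ?_⟩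
  · refine lt_of_lt_of_le (by linarith : UU α p - 1 / (2 * α) < UU α p - 1 / (2 * α) + ε / 2) ?_
    refine le_ciInf fun n => ?_
    have h := h1 n N hN1'
    rw [Finset.sum_sub_distrib, sum_of_avg hN1'] at h
    simp only [Finset.sum_const, Finset.card_range, nsmul_eq_mul] at h
    have : N * (UU α p - 1 / (2 * α) + ε / 2) ≤ N * avgD δ N n := by linarith
    exact le_of_mul_le_mul_left this hN0
  · refine lt_of_le_of_lt ?_ (by linarith : UU α p - ε / 2 < UU α p)
    refine ciSup_le fun n => ?_
    have h := h2 n N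
    rw [Finset.sum_sub_distrib, sum_of_avg hN1'] at h
    simp only [Finset.sum_const, Finset.card_range, nsmul_eq_mul] at h
    have : N * avgD δ N n ≤ N * (UU α p - ε / 2) := by linarith
    exact le_of_mul_le_mul_left this hN0

theorem main1 (α p q : ℝ) (hα : 0 < α) (hp : 4 / 3 < p) 
    (hq : 1 / p + 1 / q = 1)
    (γ : ℕ → ℂ) (hinj : Function.Injective γ)
    (hmono : ∀ n, ‖γ n‖ ≤ ‖γ (n + 1)‖)
    (δ θ : ℕ → ℝ)
    (hdecomp : ∀ n, γ n =
      (Real.exp ((1 + (n : ℝ)) / (2 * α) + δ n) : ℂ) * Complex.exp ((θ n : ℂ) * Complex.I)) :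
    CompleteInterpolating α p (Set.range γ) ↔
      (DRhoSeparated α (Set.range γ) ∧
       (∃ M : ℝ, ∀ n, |δ n| ≤ M) ∧
       (∃ N : ℕ, 1 ≤ N ∧
         1 / (4 * α) - 1 / (q * α) < (⨅ n : ℕ, avgD δ N n) ∧
         (⨆ n : ℕ, avgD δ N n) < 1 / (p * α) - 1 / (4 * α))) := by
  have hp1 : 1 < p := by linarith
  have hn : ∀ n, ‖γ n‖ = Real.exp (tt α δ n) := by
    intro n
    rw [hdecomp n, norm_mul, Complex.norm_exp_ofReal_mul_I, mul_one]
    rw [Complex.norm_real, Real.norm_eq_abs, abs_of_pos (Real.exp_pos _)]; rfl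
  have hm : Monotone fun n => ‖γ n‖ := monotone_nat_of_le_succ hmono
  have e1 : 1 / (4 * α) - 1 / (q * α) = UU α p - 1 / (2 * α) := by
    have h1 : 1 / (q * α) = (1 / q) * (1 / α) := by rw [one_div_mul_one_div]
    have h2 : 1 / (p * α) = (1 / p) * (1 / α) := by rw [one_div_mul_one_div]
    have h3 : 1 / q = 1 - 1 / p := by linarith
    unfold UU
    rw [h1, h2, h3]
    field_simp
    ring
  have e2 : 1 / (p * α) - 1 / (4 * α) = UU α p := rfl
  rw [e1, e2]
  unfold CompleteInterpolating
  rw [sampling_iff hα hp1 hinj, interpolating_iff hα hp1 hinj]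
  constructor
  · rintro ⟨hS, hI⟩
    exact necessity hα hp1.le hinj hn hm hS hI
  · rintro ⟨hsep, ⟨B, hB⟩, N, hN, h1, h2⟩
    exact sufficiency hα hp1 hinj hn hB hsep hN h1 h2

/-- for `4/3 < p < 4`, `Γ` is a complete interpolating sequence for `F^p_φ`
iff `Γ` is `d_ρ`-separated, `(δ_n)` is bounded, and
`1/(4α) - 1/(qα) < ∇_N ≤ Δ_N < 1/(pα) - 1/(4α)` for some `N ≥ 1`. -/
theorem statement1 (α p q : ℝ) (hα : 0 < α) (hp : 4 / 3 < p) (hp' : p < 4)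
    (hq : 1 / p + 1 / q = 1)
    (γ : ℕ → ℂ) (hinj : Function.Injective γ)
    (hmono : ∀ n, ‖γ n‖ ≤ ‖γ (n + 1)‖)
    (δ θ : ℕ → ℝ)
    (hdecomp : ∀ n, γ n =
      (Real.exp ((1 + (n : ℝ)) / (2 * α) + δ n) : ℂ) * Complex.exp ((θ n : ℂ) * Complex.I)) :
    CompleteInterpolating α p (Set.range γ) ↔
      (DRhoSeparated α (Set.range γ) ∧
       (∃ M : ℝ, ∀ n, |δ n| ≤ M) ∧
       (∃ N : ℕ, 1 ≤ N ∧
         1 / (4 * α) - 1 / (q * α) < (⨅ n : ℕ, avgD δ N n) ∧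
         (⨆ n : ℕ, avgD δ N n) < 1 / (p * α) - 1 / (4 * α))) := by
  exact main1 α p q hα hp hq γ hinj hmono δ θ hdecomp

end
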